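/- Put μ = 1/(2ℓ(n−1)). There exist an admissible pair (N, T₀) and constants c > 0 and X₁ > 0 such that for every real X > X₁ there exist at least c·X^μ integers τ, each suitable with respect to (N, T₀), such that the number fields K_{a(τ)} are pairwise non-isomorphic and each has discriminant of absolute value at most X. -/

import Mathlib

open Polynomial NumberField

set_option synthInstance.maxHeartbeats 1000000
set_option maxHeartbeats 1000000

/-- The main polynomial
`f(t,x) = (x−a_1)⋯(x−a_{n-1})·(x − (−1)^{n-1}(t^ℓ−1)/(a_1⋯a_{n-1})) − 1`,
viewed as a polynomial in `x` over `ℚ(t)`. -/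
noncomputable def mainPoly (n ℓ : ℕ) (a : Fin (n - 1) → ℤ) : Polynomial (RatFunc ℚ) :=
  (∏ i, (X - C ((a i : ℤ) : RatFunc ℚ))) *
    (X - C ((-1) ^ (n - 1) * (RatFunc.X ^ ℓ - 1) / (((∏ i, a i : ℤ) : RatFunc ℚ)))) - 1

/-- The specialization `f(0,x) ∈ ℚ[x]`. -/
noncomputable def mainPolyZero (n ℓ : ℕ) (a : Fin (n - 1) → ℤ) : Polynomial ℚ :=
  (∏ i, (X - C ((a i : ℤ) : ℚ))) *
    (X - C ((-1) ^ (n - 1) * ((0 : ℚ) ^ ℓ - 1) / (((∏ i, a i : ℤ) : ℚ)))) - 1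

/-- `a(τ) = (−1)^{n-1}(τ^ℓ−1)/(a_1⋯a_{n-1})`, an integer whenever
`τ ≡ 1 (mod a_1⋯a_{n-1})`. -/
noncomputable def aTau (n ℓ : ℕ) (a : Fin (n - 1) → ℤ) (τ : ℤ) : ℤ :=
  (-1) ^ (n - 1) * ((τ ^ ℓ - 1) / ∏ i, a i)

/-- The specialization `f(τ,x)`, viewed in `ℚ[x]`. -/
noncomputable def specPolyQ (n ℓ : ℕ) (a : Fin (n - 1) → ℤ) (τ : ℤ) : Polynomial ℚ :=
  (∏ i, (X - C ((a i : ℤ) : ℚ))) * (X - C ((aTau n ℓ a τ : ℤ) : ℚ)) - 1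

/-- `ℚ[x]/(p)` is a number field when `p` is irreducible. -/
noncomputable instance (p : Polynomial ℚ) [h : Fact (Irreducible p)] :
    NumberField (AdjoinRoot p) := by
  haveI : CharZero (AdjoinRoot p) :=
    charZero_of_injective_algebraMap (algebraMap ℚ (AdjoinRoot p)).injective
  haveI : FiniteDimensional ℚ (AdjoinRoot p) :=
    Module.Finite.of_basis (AdjoinRoot.powerBasis h.out.ne_zero).basis
  exact ⟨⟩

/-- The subgroup of the unit group of the ring of integers of
`K_{a(τ)} = ℚ[x]/(f(τ,x))` generated by `−1` and the ABC-units
`ξ−a_1, …, ξ−a_{n-1}`. -/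
noncomputable def abcUnitSubgroup (n ℓ : ℕ) (a : Fin (n - 1) → ℤ) (τ : ℤ)
    [Fact (Irreducible (specPolyQ n ℓ a τ))] :
    Subgroup ((𝓞 (AdjoinRoot (specPolyQ n ℓ a τ)))ˣ) :=
  Subgroup.closure {u : (𝓞 (AdjoinRoot (specPolyQ n ℓ a τ)))ˣ |
    algebraMap (𝓞 (AdjoinRoot (specPolyQ n ℓ a τ)))
      (AdjoinRoot (specPolyQ n ℓ a τ)) ↑u = -1 ∨
    ∃ i, algebraMap (𝓞 (AdjoinRoot (specPolyQ n ℓ a τ)))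
      (AdjoinRoot (specPolyQ n ℓ a τ)) ↑u =
        AdjoinRoot.root (specPolyQ n ℓ a τ) - (a i : AdjoinRoot (specPolyQ n ℓ a τ))}

/-- A pair `(N, T₀)` of positive integers is *admissible* if for every integer `τ`
with `|τ| ≥ T₀`, `τ ≡ 1 (mod a_1⋯a_{n-1})`, such that the Galois group of `f(τ,x)`
over `ℚ` is `S_n` and `|disc K_{a(τ)}| > |τ|^{2/(n+2)}`, the subgroup of the units
generated by `−1` and the ABC-units has finite index at most `N`. -/
def Admissible (n ℓ : ℕ) (a : Fin (n - 1) → ℤ) (N T₀ : ℕ) : Prop :=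
  0 < N ∧ 0 < T₀ ∧
    ∀ τ : ℤ, (T₀ : ℤ) ≤ |τ| → ((∏ i, a i) ∣ (τ - 1)) →
      Nonempty ((specPolyQ n ℓ a τ).Gal ≃* Equiv.Perm (Fin n)) →
      ∀ [Fact (Irreducible (specPolyQ n ℓ a τ))],
        |(NumberField.discr (AdjoinRoot (specPolyQ n ℓ a τ)) : ℝ)| >
            |(τ : ℝ)| ^ ((2 : ℝ) / ((n : ℝ) + 2)) →
          (abcUnitSubgroup n ℓ a τ).index ≠ 0 ∧ (abcUnitSubgroup n ℓ a τ).index ≤ N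

/-- An integer `τ` is *suitable* with respect to an admissible pair `(N, T₀)`. -/
def Suitable (n ℓ : ℕ) (a : Fin (n - 1) → ℤ) (N T₀ : ℕ) (τ : ℤ) : Prop :=
  (T₀ : ℤ) ≤ |τ| ∧ ((∏ i, a i) ∣ (τ - 1)) ∧
    (∀ Dz : ℤ, (Dz : ℚ) = (∏ i, ((a i : ℤ) : ℚ)) *
        ((mainPolyZero n ℓ a).derivative.eval 0) → Int.gcd τ Dz = 1) ∧
    Nonempty ((specPolyQ n ℓ a τ).Gal ≃* Equiv.Perm (Fin n)) ∧
    ∀ [Fact (Irreducible (specPolyQ n ℓ a τ))],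
      |(NumberField.discr (AdjoinRoot (specPolyQ n ℓ a τ)) : ℝ)| >
          |(τ : ℝ)| ^ ((2 : ℝ) / ((n : ℝ) + 2)) ∧
      ∀ (ν : ℕ) (νs : Fin (n - 1) → ℕ), 1 ≤ ν → ν ≤ N → (∀ i, νs i < ν * ℓ) →
        ∀ ζ : AlgebraicClosure (AdjoinRoot (specPolyQ n ℓ a τ)),
          ζ ^ (ℓ * ν) =
            algebraMap (AdjoinRoot (specPolyQ n ℓ a τ))
                (AlgebraicClosure (AdjoinRoot (specPolyQ n ℓ a τ)))
                (AdjoinRoot.root (specPolyQ n ℓ a τ)) ^ ν *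
              ∏ i, (algebraMap (AdjoinRoot (specPolyQ n ℓ a τ))
                  (AlgebraicClosure (AdjoinRoot (specPolyQ n ℓ a τ)))
                  (AdjoinRoot.root (specPolyQ n ℓ a τ)) -
                (a i : AlgebraicClosure (AdjoinRoot (specPolyQ n ℓ a τ)))) ^ (νs i) →
          ℓ ≤ Module.finrank (AdjoinRoot (specPolyQ n ℓ a τ))
            (IntermediateField.adjoin (AdjoinRoot (specPolyQ n ℓ a τ)) {ζ})

section
open Polynomial NumberField Filter Topology

open Classical in
/-- counting function -/
noncomputable def cnt (B : Set ℕ) (T : ℕ) : ℕ := ((Finset.range T).filter (· ∈ B)).card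

/-- zero density -/
def DZ (B : Set ℕ) : Prop := ∀ ε : ℝ, 0 < ε → ∀ᶠ T : ℕ in atTop, (cnt B T : ℝ) ≤ ε * T

lemma cnt_mono {A B : Set ℕ} (h : A ⊆ B) (T : ℕ) : cnt A T ≤ cnt B T := by
  classical
  unfold cnt
  apply Finset.card_le_card
  intro x hx
  simp only [Finset.mem_filter] at hx ⊢
  exact ⟨hx.1, h hx.2⟩

lemma cnt_union (A B : Set ℕ) (T : ℕ) : cnt (A ∪ B) T ≤ cnt A T + cnt B T := by
  classical
  unfold cnt
  refine le_trans (Finset.card_le_card ?_) (Finset.card_union_le _ _)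
  intro x hx
  simp only [Finset.mem_filter, Finset.mem_union, Set.mem_union] at hx ⊢
  tauto

lemma DZ.mono {A B : Set ℕ} (hB : DZ B) (h : A ⊆ B) : DZ A := by
  intro ε hε
  filter_upwards [hB ε hε] with T hT
  exact le_trans (by exact_mod_cast cnt_mono h T) hT

lemma DZ.union {A B : Set ℕ} (hA : DZ A) (hB : DZ B) : DZ (A ∪ B) := by
  intro ε hε
  filter_upwards [hA (ε/2) (by linarith), hB (ε/2) (by linarith)] with T h1 h2
  have : (cnt (A ∪ B) T : ℝ) ≤ cnt A T + cnt B T := by exact_mod_cast cnt_union A B T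
  linarith

lemma DZ.of_finite {A : Set ℕ} (hA : A.Finite) : DZ A := by
  classical
  intro ε hε
  have h1 : ∀ T, cnt A T ≤ hA.toFinset.card := by
    intro T
    apply Finset.card_le_card
    intro x hx
    simp only [Finset.mem_filter] at hx
    simpa using hx.2
  obtain ⟨N, hN⟩ := exists_nat_gt ((hA.toFinset.card : ℝ) / ε)
  filter_upwards [eventually_ge_atTop N] with T hT
  have h2 : (cnt A T : ℝ) ≤ hA.toFinset.card := by exact_mod_cast h1 T
  rw [div_lt_iff₀ hε] at hN
  have : (N : ℝ) ≤ T := by exact_mod_cast hT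
  nlinarith

lemma DZ.iUnion {ι : Type*} [Finite ι] {A : ι → Set ℕ} (h : ∀ i, DZ (A i)) : DZ (⋃ i, A i) := by
  classical
  have key : ∀ s : Finset ι, DZ (⋃ i ∈ s, A i) := by
    intro s
    induction s using Finset.induction_on with
    | empty => simpa using DZ.of_finite Set.finite_empty
    | insert i s hi ih =>
      rw [Finset.set_biUnion_insert]
      exact (h i).union ih
  have := Fintype.ofFinite ι
  simpa using key Finset.univ

/-- If `B` has positive upper density, so has `B ∩ (B - d)` for some `d > 0`. -/
lemma exists_shift {B : Set ℕ} (hB : ¬ DZ B) : ∃ d : ℕ, 0 < d ∧ ¬ DZ {x | x ∈ B ∧ x + d ∈ B} := by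
  classical
  by_contra hcon
  push Not at hcon
  apply hB
  intro ε hε
  obtain ⟨W, hW⟩ := exists_nat_gt (2 / ε)
  have hWpos : (0:ℝ) < W := lt_trans (by positivity) hW
  have hWpos' : 0 < W := by exact_mod_cast hWpos
  -- isolated elements
  set I : Set ℕ := {x | x ∈ B ∧ ∀ d, 0 < d → d ≤ W → x + d ∉ B} with hI
  have hU : DZ (⋃ d : Fin W, {x | x ∈ B ∧ x + (d.1 + 1) ∈ B}) :=
    DZ.iUnion fun d => hcon (d.1 + 1) (Nat.succ_pos _)
  have hsub : B ⊆ I ∪ ⋃ d : Fin W, {x | x ∈ B ∧ x + (d.1 + 1) ∈ B} := by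
    intro x hx
    by_cases h : x ∈ I
    · exact Or.inl h
    · right
      simp only [hI, Set.mem_setOf_eq, not_and, not_forall, not_not] at h
      obtain ⟨d, h1, h2, h3⟩ := h hx
      simp only [Set.mem_iUnion, Set.mem_setOf_eq]
      refine ⟨⟨d - 1, by omega⟩, hx, ?_⟩
      have : x + (d - 1 + 1) = x + d := by omega
      simpa [this] using h3
  have hIc : ∀ T, cnt I T ≤ T / W + 1 := by
    intro T
    have : cnt I T ≤ (Finset.range (T / W + 1)).card := by
      apply Finset.card_le_card_of_injOn (fun x => x / W)
      · intro x hx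
        simp only [Finset.coe_filter, Finset.mem_range, Set.mem_setOf_eq] at hx
        simp only [Finset.coe_range, Set.mem_Iio]
        exact Nat.lt_succ_of_le (Nat.div_le_div_right hx.1.le)
      · intro x hx y hy hxy
        simp only [Finset.coe_filter, Finset.mem_range, Set.mem_setOf_eq] at hx hy
        simp only at hxy
        by_contra hne
        have h1 := Nat.div_add_mod x W
        have h2 := Nat.div_add_mod y W
        have h3 := Nat.mod_lt x hWpos'
        have h4 := Nat.mod_lt y hWpos'
        rw [hxy] at h1
        rcases lt_or_gt_of_ne hne with hlt | hlt
        · apply hx.2.2 (y - x) (by omega) (by omega)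
          have : x + (y - x) = y := by omega
          rw [this]; exact hy.2.1
        · apply hy.2.2 (x - y) (by omega) (by omega)
          have : y + (x - y) = x := by omega
          rw [this]; exact hx.2.1
    simpa using this
  obtain ⟨N, hN⟩ := exists_nat_gt (4 / ε)
  filter_upwards [hU (ε/4) (by linarith), eventually_ge_atTop N] with T h1 h2
  have h3 : (cnt B T : ℝ) ≤ cnt I T + cnt (⋃ d : Fin W, {x | x ∈ B ∧ x + (d.1 + 1) ∈ B}) T := by
    exact_mod_cast (cnt_mono hsub T).trans (cnt_union _ _ T)
  have h4 : (cnt I T : ℝ) ≤ T / W + 1 := by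
    calc (cnt I T : ℝ) ≤ ((T / W + 1 : ℕ) : ℝ) := by exact_mod_cast hIc T
      _ ≤ T / W + 1 := by
        push_cast
        linarith [@Nat.cast_div_le ℝ _ _ _ T W]
  have h5 : (T : ℝ) / W ≤ ε / 2 * T := by
    rw [div_le_iff₀ hWpos]
    rw [div_lt_iff₀ hε] at hW
    have : (0:ℝ) ≤ T := by positivity
    nlinarith
  have h6 : (1:ℝ) ≤ ε / 4 * T := by
    rw [div_lt_iff₀ hε] at hN
    have : (N : ℝ) ≤ T := by exact_mod_cast h2
    nlinarith
  linarith

lemma not_DZ_frequently {B : Set ℕ} (hB : ¬ DZ B) : ∃ᶠ x : ℕ in atTop, x ∈ B := by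
  intro h
  apply hB
  apply DZ.of_finite
  rw [eventually_atTop] at h
  obtain ⟨N, hN⟩ := h
  apply (Set.finite_Iio N).subset
  intro x hx
  by_contra hx'
  exact hN x (not_lt.mp hx') hx
end

section
open Polynomial NumberField Filter Topology Asymptotics

lemma analyticAt_rpow_const' {x : ℝ} (hx : 0 < x) (s : ℝ) : AnalyticAt ℝ (fun y : ℝ => y ^ s) x := by
  have h : AnalyticAt ℝ (fun y : ℝ => Real.exp (Real.log y * s)) x :=
    (analyticAt_rexp.fun_comp ((analyticAt_log hx).mul analyticAt_const))
  refine h.congr ?_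
  filter_upwards [lt_mem_nhds hx] with y hy
  rw [Real.rpow_def_of_pos hy]

/-- the local parameter `τ^{-1/ν}` -/
noncomputable def uu (ν : ℕ) (τ : ℝ) : ℝ := τ ^ (-(1:ℝ) / ν)

lemma uu_pos (ν : ℕ) {τ : ℝ} (h : 0 < τ) : 0 < uu ν τ := Real.rpow_pos_of_pos h _

lemma uu_pow {ν : ℕ} (hν : 0 < ν) {τ : ℝ} (h : 0 < τ) : uu ν τ ^ ν = τ⁻¹ := by
  unfold uu
  rw [← Real.rpow_natCast, ← Real.rpow_mul h.le, div_mul_cancel₀ _ (by positivity), Real.rpow_neg_one]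

lemma uu_mul {ν k : ℕ} (hk : 0 < k) {τ : ℝ} (h : 0 < τ) : uu (ν * k) τ ^ k = uu ν τ := by
  unfold uu
  rw [← Real.rpow_natCast, ← Real.rpow_mul h.le]
  congr 1
  push_cast
  have : (k:ℝ) ≠ 0 := by positivity
  by_cases h0 : (ν : ℝ) = 0
  · simp [h0]
  · field_simp

lemma uu_tendsto {ν : ℕ} (hν : 0 < ν) : Tendsto (uu ν) atTop (𝓝[>] 0) := by
  rw [tendsto_nhdsWithin_iff]
  constructor
  · have := tendsto_rpow_neg_atTop (y := (1:ℝ)/ν) (by positivity)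
    refine this.congr fun x => ?_
    unfold uu; congr 1; ring
  · filter_upwards [eventually_gt_atTop 0] with τ h using uu_pos ν h

lemma uu_tendsto0 {ν : ℕ} (hν : 0 < ν) : Tendsto (uu ν) atTop (𝓝 0) :=
  (uu_tendsto hν).mono_right nhdsWithin_le_nhds

/-- shift of the parameter -/
noncomputable def shf (ν d : ℕ) (u : ℝ) : ℝ := u * (1 + d * u ^ ν) ^ (-(1:ℝ)/ν)

lemma uu_shift {ν : ℕ} (hν : 0 < ν) (d : ℕ) {τ : ℝ} (h : 0 < τ) : uu ν (τ + d) = shf ν d (uu ν τ) := by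
  unfold shf
  rw [uu_pow hν h]
  unfold uu
  rw [← Real.mul_rpow h.le (by positivity)]
  congr 1
  field_simp

lemma q_analytic {ν : ℕ} (hν : 0 < ν) (d : ℕ) (s : ℝ) :
    AnalyticAt ℝ (fun u : ℝ => (1 + d * u ^ ν) ^ s) 0 := by
  have h1 : AnalyticAt ℝ (fun u : ℝ => 1 + d * u ^ ν) 0 := by fun_prop
  have h2 : AnalyticAt ℝ (fun y : ℝ => y ^ s) (1 + d * (0:ℝ) ^ ν) := by
    apply analyticAt_rpow_const'
    rw [zero_pow hν.ne']; norm_num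
  exact h2.comp (f := fun u : ℝ => 1 + d * u ^ ν) h1

lemma shf_analytic {ν : ℕ} (hν : 0 < ν) (d : ℕ) : AnalyticAt ℝ (shf ν d) 0 := by
  unfold shf
  exact analyticAt_id.mul (q_analytic hν d _)

lemma shf_zero (ν d : ℕ) : shf ν d 0 = 0 := by simp [shf]

lemma q_bigO {ν : ℕ} (hν : 0 < ν) (d : ℕ) (s : ℝ) :
    (fun u : ℝ => (1 + d * u ^ ν) ^ s - 1) =O[𝓝 0] (fun u : ℝ => u ^ ν) := by
  have h2 : AnalyticAt ℝ (fun w : ℝ => (1 + d * w) ^ s) 0 := by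
    simpa using q_analytic (ν := 1) one_pos d s
  have h3 := h2.differentiableAt.isBigO_sub
  have h4 : Tendsto (fun u : ℝ => u ^ ν) (𝓝 0) (𝓝 0) := by
    have : Continuous (fun u : ℝ => u ^ ν) := by fun_prop
    simpa [hν.ne'] using this.tendsto 0
  have h5 := h3.comp_tendsto h4
  simpa [Function.comp_def] using h5

lemma analytic_factor {E : ℝ → ℝ} (hE : AnalyticAt ℝ E 0) {ν : ℕ}
    (hO : E =O[𝓝 0] (fun u : ℝ => u ^ ν)) :
    ∃ G, AnalyticAt ℝ G 0 ∧ ∀ᶠ u in 𝓝 0, E u = u ^ ν * G u := by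
  have := (natCast_le_analyticOrderAt hE (n := ν)).1 ?_
  · simpa using this
  by_contra hlt
  rw [not_le] at hlt
  have hne : analyticOrderAt E 0 ≠ ⊤ := ne_top_of_lt hlt
  obtain ⟨k, hk⟩ := ENat.ne_top_iff_exists.1 hne
  rw [← hk] at hlt
  have hkν : k < ν := by exact_mod_cast hlt
  obtain ⟨G, hG, hG0, hEG⟩ := (hE.analyticOrderAt_eq_natCast).1 hk.symm
  -- G = O(u^(ν-k)) on punctured nbhd
  have h1 : G =O[𝓝[≠] 0] (fun u : ℝ => u ^ (ν - k)) := by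
    obtain ⟨c, hc⟩ := hO.bound
    apply IsBigO.of_bound c
    have hc' : ∀ᶠ u in 𝓝[≠] (0:ℝ), ‖E u‖ ≤ c * ‖u ^ ν‖ := nhdsWithin_le_nhds hc
    have hEG' : ∀ᶠ u in 𝓝[≠] (0:ℝ), E u = (u - 0) ^ k • G u := nhdsWithin_le_nhds hEG
    filter_upwards [hc', hEG', self_mem_nhdsWithin] with u h2 h3 h4
    have h4 : u ≠ 0 := h4
    rw [h3] at h2
    simp only [sub_zero, smul_eq_mul, norm_mul, norm_pow] at h2
    have h5 : 0 < ‖u‖ ^ k := by positivity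
    rw [norm_pow]
    have h6 : ‖u‖ ^ ν = ‖u‖ ^ k * ‖u‖ ^ (ν - k) := by rw [← pow_add]; congr 1; omega
    rw [h6] at h2
    nlinarith
  have h2 : Tendsto (fun u : ℝ => u ^ (ν - k)) (𝓝[≠] 0) (𝓝 0) := by
    have : Continuous (fun u : ℝ => u ^ (ν - k)) := by fun_prop
    have h := this.tendsto 0
    rw [zero_pow (by omega)] at h
    exact h.mono_left nhdsWithin_le_nhds
  have h3 := h1.trans_tendsto h2
  have h4 : Tendsto G (𝓝[≠] 0) (𝓝 (G 0)) := hG.continuousAt.tendsto.mono_left nhdsWithin_le_nhds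
  exact hG0 (tendsto_nhds_unique h4 h3)

/-- functions `τ^K F(τ^{-1/ν})` -/
def HasE (ν K : ℕ) (g : ℝ → ℝ) : Prop :=
  ∃ F : ℝ → ℝ, AnalyticAt ℝ F 0 ∧ ∀ᶠ τ : ℝ in atTop, g τ = τ ^ K * F (uu ν τ)

lemma tendsto_add_nat_atTop (d : ℕ) : Tendsto (fun τ : ℝ => τ + d) atTop atTop :=
  tendsto_atTop_add_const_right _ _ tendsto_id

lemma HasE.diff {ν K : ℕ} (hν : 0 < ν) {g : ℝ → ℝ} (h : HasE ν (K + 1) g) (d : ℕ) :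
    HasE ν K (fun τ => g (τ + d) - g τ) := by
  obtain ⟨F, hF, hg⟩ := h
  set E : ℝ → ℝ := fun u => (1 + d * u ^ ν) ^ (K + 1) * F (shf ν d u) - F u with hE
  have hs := shf_analytic hν d
  have hFs : AnalyticAt ℝ (fun u => F (shf ν d u)) 0 := by
    apply AnalyticAt.fun_comp _ hs
    rwa [shf_zero]
  have hEa : AnalyticAt ℝ E 0 := by
    refine AnalyticAt.sub (AnalyticAt.mul ?_ hFs) hF
    fun_prop
  have hEO : E =O[𝓝 0] (fun u : ℝ => u ^ ν) := by
    have e1 : E = fun u => (1 + d * u ^ ν) ^ (K + 1) * (F (shf ν d u) - F u)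
        + ((1 + d * u ^ ν) ^ ((K + 1 : ℕ) : ℝ) - 1) * F u := by
      funext u
      simp only [hE, Real.rpow_natCast]
      ring
    rw [e1]
    have c1 : (fun u : ℝ => (1 + d * u ^ ν) ^ (K + 1)) =O[𝓝 0] (fun _ => (1:ℝ)) := by
      have : ContinuousAt (fun u : ℝ => (1 + d * u ^ ν) ^ (K + 1)) 0 := by fun_prop
      exact this.tendsto.isBigO_one ℝ
    have c2 : F =O[𝓝 0] (fun _ => (1:ℝ)) := hF.continuousAt.tendsto.isBigO_one ℝ
    have c3 : (fun u => F (shf ν d u) - F u) =O[𝓝 0] (fun u : ℝ => u ^ ν) := by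
      have h1 := hF.hasStrictFDerivAt.isBigO_sub
      have h2 : Tendsto (fun u => (shf ν d u, u)) (𝓝 0) (𝓝 ((0:ℝ), (0:ℝ))) := by
        have := (hs.continuousAt.prodMk (continuousAt_id (x := (0:ℝ)))).tendsto
        simpa [shf_zero] using this
      have h3 := h1.comp_tendsto h2
      refine h3.trans ?_
      have h4 := (q_bigO hν d (-(1:ℝ)/ν))
      have h5 : (fun u : ℝ => u) =O[𝓝 0] (fun _ => (1:ℝ)) :=
        (continuousAt_id (x := (0:ℝ))).tendsto.isBigO_one ℝ
      have h6 := h5.mul h4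
      simp only [one_mul] at h6
      refine h6.congr_left fun u => ?_
      simp only [Function.comp, shf]; ring
    have a1 := c1.mul c3
    simp only [one_mul] at a1
    have a2 := (q_bigO hν d ((K + 1 : ℕ) : ℝ)).mul c2
    simp only [mul_one] at a2
    exact a1.add a2
  obtain ⟨G, hG, hEG⟩ := analytic_factor hEa hEO
  refine ⟨G, hG, ?_⟩
  filter_upwards [hg, (tendsto_add_nat_atTop d).eventually hg, (uu_tendsto0 hν).eventually hEG,
    eventually_gt_atTop 0] with τ h1 h2 h3 h4
  rw [h1, h2, uu_shift hν d h4]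
  have h5 : (uu ν τ) ^ ν * G (uu ν τ) = E (uu ν τ) := h3.symm
  simp only [hE] at h5
  rw [uu_pow hν h4] at h5
  have h6 : G (uu ν τ) = τ * ((1 + d * τ⁻¹) ^ (K + 1) * F (shf ν d (uu ν τ)) - F (uu ν τ)) := by
    rw [← h5]; field_simp
  rw [h6]
  have h7 : τ + d = τ * (1 + d * τ⁻¹) := by field_simp
  rw [h7, mul_pow]
  ring

lemma HasE.eventually_eq_of_frequently {ν K : ℕ} (hν : 0 < ν) {g : ℝ → ℝ} (h : HasE ν K g)
    (hf : ∃ᶠ x : ℕ in atTop, g x = 0) : ∀ᶠ τ : ℝ in atTop, g τ = 0 := by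
  obtain ⟨F, hF, hg⟩ := h
  have h0 : ∀ᶠ z in 𝓝 0, F z = 0 := by
    rw [← hF.frequently_zero_iff_eventually_zero]
    have h1 : Tendsto (fun x : ℕ => uu ν x) atTop (𝓝[≠] 0) :=
      ((uu_tendsto hν).mono_right (nhdsWithin_mono _ fun x hx => ne_of_gt hx)).comp
        tendsto_natCast_atTop_atTop
    refine h1.frequently ?_
    have h2 := tendsto_natCast_atTop_atTop (R := ℝ) |>.eventually (hg.and (eventually_gt_atTop 0))
    refine (hf.and_eventually h2).mono ?_
    rintro x ⟨h3, h4, h5⟩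
    rw [h3] at h4
    have := h4.symm
    rw [mul_eq_zero] at this
    exact this.resolve_left (by positivity)
  filter_upwards [hg, (uu_tendsto0 hν).eventually h0] with τ h1 h2
  rw [h1, h2, mul_zero]

/-- difference equation for rational polynomials -/
lemma exists_antidiff (d : ℕ) (hd : 0 < d) (P : ℚ[X]) :
    ∃ Q : ℚ[X], Q.comp (X + C (d:ℚ)) - Q = P := by
  suffices H : ∀ k : ℕ, ∀ P : ℚ[X], P.degree < k → ∃ Q : ℚ[X], Q.comp (X + C (d:ℚ)) - Q = P from
    H _ P (lt_of_le_of_lt P.degree_le_natDegree (by exact_mod_cast Nat.lt_succ_self _))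
  intro k
  induction k with
  | zero =>
    intro P hP
    refine ⟨0, ?_⟩
    have : P = 0 := by
      by_contra h
      rw [Polynomial.degree_eq_natDegree h] at hP
      exact absurd hP (by simp)
    simp [this]
  | succ k ih =>
    intro P hP
    set c : ℚ := P.coeff k / ((k+1) * d) with hc
    set M : ℚ[X] := C c * X ^ (k + 1) with hM
    have hdiff : (P - (M.comp (X + C (d:ℚ)) - M)).degree < k := by
      rw [Polynomial.degree_lt_iff_coeff_zero]
      intro m hm
      have e : (M.comp (X + C (d:ℚ)) - M).coeff m = c * (((d:ℚ) ^ (k + 1 - m)) * ((k+1).choose m) - if m = k + 1 then 1 else 0) := by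
        simp only [hM, mul_comp, C_comp, pow_comp, X_comp, coeff_sub, coeff_C_mul,
          coeff_X_add_C_pow, coeff_X_pow]
        ring
      rw [coeff_sub, e]
      rcases Nat.eq_or_lt_of_le hm with h | h
      · subst h
        have h1 : k + 1 - k = 1 := by omega
        have h2 : (k + 1).choose k = k + 1 := by simp
        have : (d:ℚ) ≠ 0 := by positivity
        have h3 : (k:ℚ) + 1 ≠ 0 := by positivity
        rw [h1, h2, if_neg (by omega), hc]
        push_cast
        field_simp
        ring
      · have h0 : P.coeff m = 0 := Polynomial.coeff_eq_zero_of_degree_lt (lt_of_lt_of_le hP (by exact_mod_cast h))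
        rw [h0]
        rcases Nat.eq_or_lt_of_le h with h' | h'
        · have : m = k + 1 := h'.symm
          subst this; simp
        · rw [Nat.choose_eq_zero_of_lt (by omega), if_neg (by omega)]; simp
    obtain ⟨Q, hQ⟩ := ih _ hdiff
    refine ⟨Q + M, ?_⟩
    rw [add_comp]
    linear_combination hQ

/-- A function having an expansion which is eventually `d`-periodic is constant. -/
lemma periodic_const {ν : ℕ} (hν : 0 < ν) {g : ℝ → ℝ} {K : ℕ} (h : HasE ν K g) {d : ℕ} (hd : 0 < d)
    (hp : ∀ᶠ τ : ℝ in atTop, g (τ + d) = g τ) : ∃ c : ℝ, ∀ᶠ τ : ℝ in atTop, g τ = c := by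
  obtain ⟨τ₀, hτ₀⟩ := eventually_atTop.1 hp
  have per : ∀ τ ≥ τ₀, ∀ j : ℕ, g (τ + j * d) = g τ := by
    intro τ hτ j
    induction j with
    | zero => simp
    | succ j ih =>
      rw [← ih, ← hτ₀ (τ + j * d) (by have : (0:ℝ) ≤ j * d := by positivity
                                      linarith)]
      congr 1; push_cast; ring
  -- reference value along the progression
  obtain ⟨F, hF, hg⟩ := h
  have lim : Tendsto (fun j : ℕ => τ₀ + j * d) atTop (atTop : Filter ℝ) := by
    apply tendsto_atTop_add_const_left
    exact tendsto_natCast_atTop_atTop.atTop_mul_const (by positivity)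
  -- `u^{νK} g = F` so the function  F(u) - c u^{νK} vanishes along the progression
  have hF2 : AnalyticAt ℝ (fun u => F u - g τ₀ * u ^ (ν * K)) 0 := by
    refine hF.sub ?_
    fun_prop
  have h0 : ∀ᶠ z in 𝓝 0, F z - g τ₀ * z ^ (ν * K) = 0 := by
    rw [← hF2.frequently_zero_iff_eventually_zero]
    have h1 : Tendsto (fun j : ℕ => uu ν (τ₀ + j * d)) atTop (𝓝[≠] 0) :=
      ((uu_tendsto hν).mono_right (nhdsWithin_mono _ fun x hx => ne_of_gt hx)).comp lim
    refine h1.frequently (Eventually.frequently ?_)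
    filter_upwards [lim.eventually (hg.and (eventually_gt_atTop 0))] with j hj
    obtain ⟨h3, h4⟩ := hj
    rw [per τ₀ le_rfl j] at h3
    rw [h3, pow_mul, uu_pow hν h4, inv_pow]
    field_simp
    simp
  refine ⟨g τ₀, ?_⟩
  filter_upwards [hg, (uu_tendsto0 hν).eventually h0, eventually_gt_atTop 0] with τ h1 h2 h3
  rw [h1, sub_eq_zero.1 h2, pow_mul, uu_pow hν h3, inv_pow]
  field_simp

lemma HasE.mono {ν K K' : ℕ} (hν : 0 < ν) {g : ℝ → ℝ} (h : HasE ν K g) (hK : K ≤ K') : HasE ν K' g := by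
  obtain ⟨F, hF, hg⟩ := h
  refine ⟨fun u => u ^ (ν * (K' - K)) * F u, by fun_prop, ?_⟩
  filter_upwards [hg, eventually_gt_atTop 0] with τ h1 h3
  rw [h1, pow_mul, uu_pow hν h3]
  obtain ⟨r, rfl⟩ := Nat.exists_eq_add_of_le hK
  rw [Nat.add_sub_cancel_left, pow_add, inv_pow]
  field_simp

lemma HasE.add {ν K : ℕ} {g g' : ℝ → ℝ} (h : HasE ν K g) (h' : HasE ν K g') :
    HasE ν K (g + g') := by
  obtain ⟨F, hF, hg⟩ := h
  obtain ⟨F', hF', hg'⟩ := h'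
  refine ⟨fun u => F u + F' u, hF.add hF', ?_⟩
  filter_upwards [hg, hg'] with τ h1 h2
  rw [Pi.add_apply, h1, h2]; ring

lemma HasE.mul {ν K K' : ℕ} {g g' : ℝ → ℝ} (h : HasE ν K g) (h' : HasE ν K' g') :
    HasE ν (K + K') (g * g') := by
  obtain ⟨F, hF, hg⟩ := h
  obtain ⟨F', hF', hg'⟩ := h'
  refine ⟨fun u => F u * F' u, hF.mul hF', ?_⟩
  filter_upwards [hg, hg'] with τ h1 h2
  rw [Pi.mul_apply, h1, h2]; ring

lemma hasE_const (ν : ℕ) (c : ℝ) : HasE ν 0 (fun _ => c) :=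
  ⟨fun _ => c, analyticAt_const, by simp⟩

/-- the ring of functions having an expansion -/
def EE (ν : ℕ) (hν : 0 < ν) : Subring (ℝ → ℝ) where
  carrier := {g | ∃ K, HasE ν K g}
  mul_mem' := by rintro a b ⟨K, h⟩ ⟨K', h'⟩; exact ⟨_, h.mul h'⟩
  one_mem' := ⟨0, hasE_const ν 1⟩
  add_mem' := by
    rintro a b ⟨K, h⟩ ⟨K', h'⟩
    exact ⟨max K K', (h.mono hν (le_max_left _ _)).add (h'.mono hν (le_max_right _ _))⟩
  zero_mem' := ⟨0, hasE_const ν 0⟩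
  neg_mem' := by
    rintro a ⟨K, h⟩
    obtain ⟨F, hF, hg⟩ := h
    refine ⟨K, fun u => - F u, hF.neg, ?_⟩
    filter_upwards [hg] with τ h1
    rw [Pi.neg_apply, h1]; ring

lemma mem_EE {ν : ℕ} (hν : 0 < ν) {g : ℝ → ℝ} : g ∈ EE ν hν ↔ ∃ K, HasE ν K g := Iff.rfl

lemma const_mem_EE {ν : ℕ} (hν : 0 < ν) (c : ℝ) : (fun _ => c) ∈ EE ν hν := ⟨0, hasE_const ν c⟩

lemma id_mem_EE {ν : ℕ} (hν : 0 < ν) : (fun τ => τ) ∈ EE ν hν :=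
  ⟨1, fun _ => 1, analyticAt_const, by simp⟩

lemma poly_mem_EE {ν : ℕ} (hν : 0 < ν) (P : ℚ[X]) : (fun τ : ℝ => aeval τ P) ∈ EE ν hν := by
  induction P using Polynomial.induction_on' with
  | add p q hp hq =>
    simp only [map_add]
    exact (EE ν hν).add_mem hp hq
  | monomial n c =>
    simp only [aeval_monomial]
    exact (EE ν hν).mul_mem (const_mem_EE hν _) ((EE ν hν).pow_mem (id_mem_EE hν) n)

/-- main sparse-values lemma -/
theorem integral_values {ν : ℕ} (hν : 0 < ν) {B : Set ℕ} (hB : ¬ DZ B) {g : ℝ → ℝ}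
    (hg : g ∈ EE ν hν) (hint : ∀ x ∈ B, ∃ k : ℤ, g x = k) :
    ∃ P : ℚ[X], ∀ᶠ τ : ℝ in atTop, g τ = aeval τ P := by
  obtain ⟨K, hK⟩ := hg
  -- common final step
  have step : ∀ (B : Set ℕ) (g : ℝ → ℝ), (∃ᶠ x : ℕ in atTop, x ∈ B) → g ∈ EE ν hν →
      (∀ x ∈ B, ∃ k : ℤ, g x = k) → ∀ d : ℕ, 0 < d →
      (∃ P : ℚ[X], ∀ᶠ τ : ℝ in atTop, g (τ + d) - g τ = aeval τ P) →
      ∃ P : ℚ[X], ∀ᶠ τ : ℝ in atTop, g τ = aeval τ P := by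
    rintro B g hB hg hint d hd ⟨P, hP⟩
    obtain ⟨Q, hQ⟩ := exists_antidiff d hd P
    obtain ⟨K', hK'⟩ := (EE ν hν).sub_mem hg (poly_mem_EE hν Q)
    obtain ⟨c, hc⟩ := periodic_const hν hK' hd (by
      filter_upwards [hP] with τ h1
      have h2 : aeval τ P = aeval (τ + d) Q - aeval τ Q := by
        rw [← hQ, map_sub, aeval_comp]; simp
      simp only [Pi.sub_apply]
      linarith)
    obtain ⟨x, hxB, hx⟩ := (hB.and_eventually (tendsto_natCast_atTop_atTop.eventually hc)).exists
    obtain ⟨k, hk⟩ := hint x hxB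
    simp only [Pi.sub_apply] at hx hc
    refine ⟨Q + C ((k:ℚ) - Q.eval (x:ℚ)), ?_⟩
    filter_upwards [hc] with τ hτ
    have h3 : (aeval (x:ℝ) Q : ℝ) = ((Q.eval (x:ℚ) : ℚ) : ℝ) := by
      have := Polynomial.aeval_algebraMap_apply ℝ (x:ℚ) Q
      simpa using this
    simp only [map_add, aeval_C, eq_ratCast, Rat.cast_sub, Rat.cast_intCast]
    rw [← h3]
    linarith
  induction K generalizing g B with
  | zero =>
    obtain ⟨d, hd, hBd⟩ := exists_shift hB
    refine step B g (not_DZ_frequently hB) ⟨0, hK⟩ hint d hd ⟨0, ?_⟩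
    have h1 : HasE ν 1 (fun τ => g τ) := hK.mono hν (by omega)
    have h2 := h1.diff hν d
    simp only [map_zero]
    apply h2.eventually_eq_of_frequently hν
    have hlim : Tendsto (fun τ : ℝ => g (τ + d) - g τ) atTop (𝓝 0) := by
      obtain ⟨F, hF, hg⟩ := hK
      have l1 : Tendsto g atTop (𝓝 (F 0)) := by
        have : Tendsto (fun τ => F (uu ν τ)) atTop (𝓝 (F 0)) :=
          hF.continuousAt.tendsto.comp (uu_tendsto0 hν)
        refine this.congr' ?_
        filter_upwards [hg] with τ h
        rw [h]; simp
      have l2 := (l1.comp (tendsto_add_nat_atTop d)).sub l1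
      simpa using l2
    have hev : ∀ᶠ x : ℕ in atTop, |g ((x:ℝ) + d) - g x| < 1 := by
      have := (hlim.comp (tendsto_natCast_atTop_atTop (R := ℝ))).eventually (Metric.ball_mem_nhds 0 one_pos)
      filter_upwards [this] with x hx
      simpa using hx
    refine ((not_DZ_frequently hBd).and_eventually hev).mono ?_
    rintro x ⟨⟨hx1, hx2⟩, hx3⟩
    obtain ⟨k, hk⟩ := hint x hx1
    obtain ⟨k', hk'⟩ := hint _ hx2
    push_cast at hk'
    rw [hk, hk'] at hx3 ⊢
    have : |k' - k| < 1 := by exact_mod_cast hx3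
    rw [Int.abs_lt_one_iff] at this
    exact_mod_cast this
  | succ K ih =>
    obtain ⟨d, hd, hBd⟩ := exists_shift hB
    refine step B g (not_DZ_frequently hB) ⟨_, hK⟩ hint d hd ?_
    apply ih hBd _ (hK.diff hν d)
    rintro x ⟨hx1, hx2⟩
    obtain ⟨k, hk⟩ := hint x hx1
    obtain ⟨k', hk'⟩ := hint _ hx2
    push_cast at hk'
    refine ⟨k' - k, ?_⟩
    rw [hk, hk']; push_cast; ring
end

section
open Polynomial NumberField Filter Topology Asymptotics

lemma EE_lift {N : ℕ} (hN : 0 < N) {g : ℝ → ℝ} (hg : g ∈ EE 1 one_pos) : g ∈ EE N hN := by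
  obtain ⟨K, F, hF, hg⟩ := hg
  refine ⟨K, fun y => F (y ^ N), ?_, ?_⟩
  · apply AnalyticAt.fun_comp
    · rwa [zero_pow hN.ne']
    · fun_prop
  · filter_upwards [hg, eventually_gt_atTop 0] with τ h1 h2
    rw [h1]
    have := uu_mul (ν := 1) hN h2
    rw [one_mul] at this
    rw [this]

lemma EE_root {N : ℕ} (hN : 0 < N) {g : ℝ → ℝ} (hg : g ∈ EE 1 one_pos) :
    (fun τ => |g τ| ^ ((1:ℝ) / N)) ∈ EE N hN := by
  obtain ⟨K, F, hF, hg⟩ := hg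
  by_cases htop : analyticOrderAt F 0 = ⊤
  · rw [analyticOrderAt_eq_top] at htop
    refine ⟨0, fun _ => 0, analyticAt_const, ?_⟩
    filter_upwards [hg, (uu_tendsto0 one_pos).eventually htop] with τ h1 h2
    rw [h1, h2]
    simp [hN.ne']
  obtain ⟨r, hr⟩ := ENat.ne_top_iff_exists.1 htop
  obtain ⟨G, hG, hG0, hFG⟩ := (hF.analyticOrderAt_eq_natCast).1 hr.symm
  -- |G| analytic
  have habs : ∃ H : ℝ → ℝ, AnalyticAt ℝ H 0 ∧ 0 < H 0 ∧ ∀ᶠ u in 𝓝 0, |G u| = H u := by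
    rcases lt_or_gt_of_ne hG0 with h | h
    · refine ⟨fun u => - G u, hG.neg, by linarith, ?_⟩
      filter_upwards [hG.continuousAt.eventually (gt_mem_nhds h)] with u hu
      exact abs_of_neg hu
    · refine ⟨G, hG, h, ?_⟩
      filter_upwards [hG.continuousAt.eventually (lt_mem_nhds h)] with u hu
      exact abs_of_pos hu
  obtain ⟨H, hH, hH0, hGH⟩ := habs
  have hHpos : ∀ᶠ u in 𝓝 0, 0 < H u := hH.continuousAt.eventually (lt_mem_nhds hH0)
  refine ⟨K, fun y => y ^ (K * (N - 1)) * y ^ r * (H (y ^ N)) ^ ((1:ℝ)/N), ?_, ?_⟩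
  · refine AnalyticAt.mul (by fun_prop) ?_
    have : AnalyticAt ℝ (fun y : ℝ => H (y ^ N)) 0 := by
      apply AnalyticAt.fun_comp
      · rwa [zero_pow hN.ne']
      · fun_prop
    refine AnalyticAt.fun_comp (g := fun y : ℝ => y ^ ((1:ℝ)/N)) (f := fun y : ℝ => H (y ^ N)) ?_ this
    apply analyticAt_rpow_const'
    rwa [zero_pow hN.ne']
  · filter_upwards [hg, (uu_tendsto0 one_pos).eventually (hFG.and (hGH.and hHpos)),
      eventually_gt_atTop 0] with τ h1 ⟨h2, h3, h4⟩ h5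
    have e1 := uu_mul (ν := 1) hN h5
    rw [one_mul] at e1
    have e2 : uu N τ ^ N = τ⁻¹ := uu_pow hN h5
    have p1 := uu_pos N h5
    have p2 := uu_pos 1 h5
    rw [e1]
    have hAN : (τ ^ K * (uu N τ ^ (K * (N - 1)) * uu N τ ^ r * (H (uu 1 τ)) ^ ((1:ℝ)/N))) ^ N
        = |g τ| := by
      rw [mul_pow, mul_pow, mul_pow, ← Real.rpow_natCast (H (uu 1 τ) ^ _), ← Real.rpow_mul h4.le,
        one_div, inv_mul_cancel₀ (by positivity), Real.rpow_one, h1, h2, abs_mul, sub_zero,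
        smul_eq_mul, abs_mul, h3, abs_of_pos (show 0 < τ ^ K by positivity),
        abs_of_pos (show 0 < uu 1 τ ^ r by positivity), ← pow_mul (uu N τ) r, mul_comm r N,
        pow_mul (uu N τ) N r,
        e1, ← pow_mul (uu N τ), mul_comm (K * (N - 1)) N, pow_mul (uu N τ) N, e2]
      obtain ⟨M, rfl⟩ : ∃ M, N = M + 1 := ⟨N - 1, by omega⟩
      rw [Nat.add_sub_cancel, ← pow_mul, mul_add, pow_add, inv_pow, mul_one]
      field_simp
    rw [← hAN, ← Real.rpow_natCast, ← Real.rpow_mul (by positivity), mul_one_div_cancel (by positivity),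
      Real.rpow_one]

lemma EE_root_pow {N : ℕ} (hN : 0 < N) (d : ℕ) {g : ℝ → ℝ} (hg : g ∈ EE 1 one_pos) :
    (fun τ => |g τ| ^ ((d:ℝ) / N)) ∈ EE N hN := by
  have := (EE N hN).pow_mem (EE_root hN hg) d
  convert this using 1
  funext τ
  rw [Pi.pow_apply, ← Real.rpow_natCast, ← Real.rpow_mul (abs_nonneg _)]
  congr 1; ring

lemma EE_congr {N : ℕ} {hN : 0 < N} {g g' : ℝ → ℝ} (hg : g ∈ EE N hN) (h : ∀ᶠ τ in atTop, g' τ = g τ) :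
    g' ∈ EE N hN := by
  obtain ⟨K, F, hF, hg⟩ := hg
  refine ⟨K, F, hF, ?_⟩
  filter_upwards [hg, h] with τ h1 h2
  rw [h2, h1]

/-- analytic function of `u` -/
lemma EE_analytic {N : ℕ} {hN : 0 < N} {F : ℝ → ℝ} (hF : AnalyticAt ℝ F 0) :
    (fun τ => F (uu N τ)) ∈ EE N hN := ⟨0, F, hF, by simp⟩
end

section
open Polynomial NumberField Filter Topology Asymptotics

lemma analytic_inverse {φ : ℝ → ℝ} {x : ℝ} (hφ : AnalyticAt ℝ φ x) (h0 : φ x = 0)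
    (hc : deriv φ x ≠ 0) :
    ∃ g : ℝ → ℝ, AnalyticAt ℝ g 0 ∧ g 0 = x ∧ ∀ᶠ z in 𝓝 0, φ (g z) = z := by
  have h1 := hφ.analyticAt_localInverse hc
  have h2 := hφ.hasStrictDerivAt.eventually_right_inverse hc
  have h3 : (hφ.hasStrictDerivAt.localInverse _ _ _ hc) (φ x) = x := HasStrictFDerivAt.localInverse_apply_image ..
  rw [h0] at h1 h2 h3
  exact ⟨_, h1, h3, h2⟩

lemma logbd {ι : Type*} [Fintype ι] (f : ι → ℝ → ℝ) (hf : ∀ i, ContinuousAt (f i) 0)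
    (h0 : ∀ i, f i 0 ≠ 0) : ∃ c : ℝ, ∀ᶠ z in 𝓝 0, ∀ i, f i z ≠ 0 ∧ |Real.log (f i z)| ≤ c := by
  have h1 : ∀ i, ContinuousAt (fun z => |Real.log (f i z)|) 0 := by
    intro i
    exact ((hf i).log (h0 i)).abs
  refine ⟨∑ i, (|Real.log (f i 0)| + 1), ?_⟩
  rw [eventually_all]
  intro i
  have h2 : |Real.log (f i 0)| < ∑ i, (|Real.log (f i 0)| + 1) := by
    have := Finset.single_le_sum (f := fun i => |Real.log (f i 0)| + 1) (fun i _ => by positivity)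
      (Finset.mem_univ i)
    linarith
  filter_upwards [(hf i).eventually_ne (h0 i), (h1 i).eventually (gt_mem_nhds h2)] with z h3 h4
  exact ⟨h3, h4.le⟩

lemma near_root {m : ℕ} (b : Fin m → ℝ) (hb : Function.Injective b) (i : Fin m) :
    ∃ g : ℝ → ℝ, AnalyticAt ℝ g 0 ∧ g 0 = b i ∧
      ∀ᶠ z in 𝓝[≠] 0, (∏ k, (g z - b k)) * (g z - z⁻¹) = 1 := by
  set P : ℝ → ℝ := fun x => ∏ k, (x - b k) with hP
  have hPa : ∀ x, AnalyticAt ℝ P x := by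
    intro x
    have : AnalyticAt ℝ (fun x : ℝ => ∏ k, (x - b k)) x :=
      Finset.analyticAt_fun_prod _ fun k _ => by fun_prop
    exact this
  have hP0 : P (b i) = 0 := Finset.prod_eq_zero (Finset.mem_univ i) (by simp)
  have hPd : HasDerivAt P (∏ k ∈ Finset.univ.erase i, (b i - b k)) (b i) := by
    have h1 : P = fun x => (x - b i) * ∏ k ∈ Finset.univ.erase i, (x - b k) := by
      funext x
      exact (Finset.mul_prod_erase _ (fun k => x - b k) (Finset.mem_univ i)).symm
    rw [h1]
    have h2 : DifferentiableAt ℝ (fun x : ℝ => ∏ k ∈ Finset.univ.erase i, (x - b k)) (b i) := by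
      have : AnalyticAt ℝ (fun x : ℝ => ∏ k ∈ Finset.univ.erase i, (x - b k)) (b i) :=
        Finset.analyticAt_fun_prod _ fun k _ => by fun_prop
      exact this.differentiableAt
    have h3 := ((hasDerivAt_id (b i)).sub_const (b i)).mul h2.hasDerivAt
    simp only [id, sub_self, zero_mul, add_zero, one_mul] at h3
    exact h3
  have hc : (∏ k ∈ Finset.univ.erase i, (b i - b k)) ≠ 0 := by
    rw [Finset.prod_ne_zero_iff]
    intro k hk
    rw [sub_ne_zero]
    exact fun h => (Finset.ne_of_mem_erase hk) (hb h).symm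
  set φ : ℝ → ℝ := fun x => P x / (x * P x - 1) with hφ
  have hden : (b i) * P (b i) - 1 ≠ 0 := by rw [hP0]; norm_num
  have hφa : AnalyticAt ℝ φ (b i) :=
    (hPa _).div ((analyticAt_id.mul (hPa _)).sub analyticAt_const) hden
  have hφ0 : φ (b i) = 0 := by simp [hφ, hP0]
  have hφd : deriv φ (b i) ≠ 0 := by
    have h3 := hPd.div (((hasDerivAt_id (b i)).mul hPd).sub_const 1) hden
    have h4 : HasDerivAt φ _ (b i) := h3
    rw [h4.deriv]
    simp only [Pi.mul_apply, id, hP0]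
    simpa using hc
  obtain ⟨g, hg, hg0, hgz⟩ := analytic_inverse hφa hφ0 hφd
  refine ⟨g, hg, hg0, ?_⟩
  have hden2 : ∀ᶠ z in 𝓝 0, (g z) * P (g z) - 1 ≠ 0 := by
    have : ContinuousAt (fun z => (g z) * P (g z) - 1) 0 := by
      have h5 : ContinuousAt (fun z => P (g z)) 0 := by
        apply ContinuousAt.comp (g := P) _ hg.continuousAt
        exact (hPa _).continuousAt
      exact (hg.continuousAt.mul h5).sub continuousAt_const
    apply this.eventually_ne
    rw [hg0]; exact hden
  filter_upwards [nhdsWithin_le_nhds hgz, nhdsWithin_le_nhds hden2, self_mem_nhdsWithin] with z h1 h2 h3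
  have h3 : z ≠ 0 := h3
  simp only [hφ] at h1
  rw [div_eq_iff h2] at h1
  change P (g z) * (g z - z⁻¹) = 1
  field_simp
  linarith

theorem exists_roots {m : ℕ} (hm : 0 < m) (b : Fin m → ℝ) (hb : Function.Injective b) :
    ∃ (Ξ : Option (Fin m) → ℝ → ℝ) (c0 : ℝ),
      (∀ i, AnalyticAt ℝ (Ξ (some i)) 0) ∧
      (∀ z, Ξ none z = z⁻¹ + ∑ i, b i - ∑ i, Ξ (some i) z) ∧
      ∀ᶠ z in 𝓝[≠] 0,
        (∏ j, (X - C (Ξ j z)) = (∏ i, (X - C (b i))) * (X - C z⁻¹) - 1) ∧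
        Function.Injective (fun j => Ξ j z) ∧
        (∀ j i, Ξ j z ≠ b i) ∧
        (∀ i k, k ≠ i → |Real.log (Ξ (some i) z - b k)| ≤ c0) ∧
        (∀ i, |Real.log (Ξ (some i) z - b i) - Real.log (z)| ≤ c0) ∧
        (∀ k, |Real.log (Ξ none z - b k) + Real.log (z)| ≤ c0) := by
  choose g hga hg0 hgz using near_root b hb
  set Ξ : Option (Fin m) → ℝ → ℝ := fun j z => j.elim (z⁻¹ + ∑ i, b i - ∑ i, g i z) (fun i => g i z) with hΞ
  have hgc : ∀ i, ContinuousAt (g i) 0 := fun i => (hga i).continuousAt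
  have hsumc : ContinuousAt (fun z => ∑ i, g i z) 0 := by
    have : ContinuousAt (fun z => ∑ i, g i z) 0 := tendsto_finsetSum _ fun i _ => hgc i
    exact this
  -- bounds
  obtain ⟨c1, hc1⟩ := logbd (ι := {p : Fin m × Fin m // p.2 ≠ p.1}) (fun p z => g p.1.1 z - b p.1.2)
    (fun p => (hgc _).sub continuousAt_const)
    (fun p => by rw [hg0, sub_ne_zero]; exact fun h => p.2 (hb h).symm)
  obtain ⟨c2, hc2⟩ := logbd (fun i z => (∏ k ∈ Finset.univ.erase i, (g i z - b k)) * (z * g i z - 1))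
    (fun i => by
      refine ContinuousAt.mul ?_ ((continuousAt_id.mul (hgc i)).sub continuousAt_const)
      exact tendsto_finsetProd _ fun k _ => (hgc i).sub continuousAt_const)
    (fun i => by
      simp only [zero_mul, zero_sub, mul_neg, mul_one, neg_ne_zero]
      rw [Finset.prod_ne_zero_iff]
      intro k hk
      rw [hg0, sub_ne_zero]
      exact fun h => (Finset.ne_of_mem_erase hk) (hb h).symm)
  obtain ⟨c3, hc3⟩ := logbd (fun k z => 1 + z * (∑ i, b i - ∑ i, g i z - b k))
    (fun k => by
      refine continuousAt_const.add (continuousAt_id.mul ?_)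
      exact (continuousAt_const.sub hsumc).sub continuousAt_const)
    (fun k => by simp)
  -- injectivity
  obtain ⟨_, hc4⟩ := logbd (ι := {p : Fin m × Fin m // p.2 ≠ p.1}) (fun p z => g p.1.1 z - g p.1.2 z)
    (fun p => (hgc _).sub (hgc _))
    (fun p => by rw [hg0, hg0, sub_ne_zero]; exact fun h => p.2 (hb h).symm)
  obtain ⟨_, hc5⟩ := logbd (fun k z => 1 + z * (∑ i, b i - ∑ i, g i z - g k z))
    (fun k => by
      refine continuousAt_const.add (continuousAt_id.mul ?_)
      exact (continuousAt_const.sub hsumc).sub (hgc _))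
    (fun k => by simp)
  refine ⟨Ξ, max c1 (max c2 c3), fun i => hga i, fun z => rfl, ?_⟩
  filter_upwards [nhdsWithin_le_nhds hc1, nhdsWithin_le_nhds hc2, nhdsWithin_le_nhds hc3,
    nhdsWithin_le_nhds hc4, nhdsWithin_le_nhds hc5, self_mem_nhdsWithin, eventually_all.2 hgz]
    with z h1 h2 h3 h4 h5 hz hroot
  have hz : z ≠ 0 := hz
  have hinj : Function.Injective (fun i => g i z) := by
    intro i k hik
    by_contra hne
    exact (h4 ⟨(i, k), fun h => hne h.symm⟩).1 (sub_eq_zero.2 hik)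
  set F : ℝ[X] := (∏ i, (X - C (b i))) * (X - C z⁻¹) - 1 with hF
  have hQm : (∏ i, (X - C (b i))).Monic := monic_prod_of_monic _ _ fun i _ => monic_X_sub_C _
  have hQd : (∏ i, (X - C (b i))).natDegree = m := by
    rw [natDegree_prod_of_monic _ _ fun i _ => monic_X_sub_C _]; simp
  have hGm : (∏ i, (X - C (b i)) * (X - C z⁻¹)).Monic :=
    monic_prod_of_monic _ _ fun i _ => (monic_X_sub_C _).mul (monic_X_sub_C _)
  have hG2 : ((∏ i, (X - C (b i))) * (X - C z⁻¹)).Monic := hQm.mul (monic_X_sub_C _)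
  have hGd : ((∏ i, (X - C (b i))) * (X - C z⁻¹)).natDegree = m + 1 := by
    rw [hQm.natDegree_mul (monic_X_sub_C _), hQd, natDegree_X_sub_C]
  have h1d : (1 : ℝ[X]).degree < ((∏ i, (X - C (b i))) * (X - C z⁻¹)).degree := by
    rw [degree_eq_natDegree hG2.ne_zero, hGd, degree_one]; exact_mod_cast Nat.succ_pos m
  have hFm : F.Monic := hG2.sub_of_left h1d
  have hFd : F.natDegree = m + 1 := by
    rw [hF, natDegree_eq_of_degree_eq (degree_sub_eq_left_of_degree_lt h1d), hGd]
  have hdvd : (∏ i, (X - C (g i z))) ∣ F := by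
    apply Finset.prod_dvd_of_coprime
    · intro i _ k _ hik
      exact pairwise_coprime_X_sub_C hinj hik
    · intro i _
      rw [dvd_iff_isRoot, IsRoot, hF]
      simp only [eval_sub, eval_mul, eval_prod, eval_X, eval_C, eval_one]
      rw [hroot i, sub_self]
  obtain ⟨q, hq⟩ := hdvd
  have hRm : (∏ i, (X - C (g i z))).Monic := monic_prod_of_monic _ _ fun i _ => monic_X_sub_C _
  have hRd : (∏ i, (X - C (g i z))).natDegree = m := by
    rw [natDegree_prod_of_monic _ _ fun i _ => monic_X_sub_C _]; simp
  have hqm : q.Monic := hRm.of_mul_monic_left (hq ▸ hFm)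
  have hqd : q.natDegree = 1 := by
    have := hFd
    rw [hq, hRm.natDegree_mul hqm, hRd] at this
    omega
  have hnext : F.coeff m = ((∏ i, (X - C (b i))) * (X - C z⁻¹)).coeff m := by
    rw [hF, coeff_sub, coeff_one, if_neg (by omega), sub_zero]
  have hn1 : F.nextCoeff = - ∑ i, b i - z⁻¹ := by
    have : F.nextCoeff = ((∏ i, (X - C (b i))) * (X - C z⁻¹)).nextCoeff := by
      rw [nextCoeff_of_natDegree_pos (by omega), nextCoeff_of_natDegree_pos (by omega), hFd, hGd]
      exact hnext
    rw [this, Monic.nextCoeff_mul hQm (monic_X_sub_C _), nextCoeff_X_sub_C, Monic.nextCoeff_prod _ _ fun i _ => monic_X_sub_C _]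
    simp only [nextCoeff_X_sub_C, Finset.sum_neg_distrib]
    ring
  have hn2 : F.nextCoeff = - ∑ i, g i z + q.coeff 0 := by
    rw [hq, Monic.nextCoeff_mul hRm hqm, Monic.nextCoeff_prod _ _ fun i _ => monic_X_sub_C _]
    simp only [nextCoeff_X_sub_C, Finset.sum_neg_distrib]
    rw [nextCoeff_of_natDegree_pos (by omega), hqd]
  have hq2 : q = X - C (Ξ none z) := by
    have e1 := hqm.eq_X_add_C hqd
    rw [e1, sub_eq_add_neg, ← C_neg]
    congr 2
    simp only [hΞ, Option.elim]
    linarith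
  have hbig : ∀ k, z * (Ξ none z - b k) = 1 + z * (∑ i, b i - ∑ i, g i z - b k) := by
    intro k
    simp only [hΞ, Option.elim]
    field_simp
    ring
  have hbig2 : ∀ k, z * (Ξ none z - g k z) = 1 + z * (∑ i, b i - ∑ i, g i z - g k z) := by
    intro k
    simp only [hΞ, Option.elim]
    field_simp
    ring
  have hcl : ∀ i, (g i z - b i) * ((∏ k ∈ Finset.univ.erase i, (g i z - b k)) * (z * g i z - 1)) = z := by
    intro i
    have := hroot i
    rw [← Finset.mul_prod_erase _ _ (Finset.mem_univ i)] at this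
    have e : z * g i z - 1 = z * (g i z - z⁻¹) := by field_simp
    rw [e]
    linear_combination z * this
  refine ⟨?_, ?_, ?_, ?_, ?_, ?_⟩
  · rw [Fintype.prod_option, mul_comm, ← hq2, hq]
    rfl
  · have hcross : ∀ k, Ξ none z ≠ g k z := by
      intro k h
      apply (h5 k).1
      rw [← hbig2, h, sub_self, mul_zero]
    rintro (_ | i) (_ | k) h
    · rfl
    · exact absurd h (hcross k)
    · exact absurd h.symm (hcross i)
    · rw [hinj h]
  · intro j i h
    have hzz : (0:ℝ) = z * 0 := by simp
    rcases j with _ | j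
    · apply (h3 i).1
      rw [← hbig, h, sub_self, mul_zero]
    · have hh : g j z = b i := h
      have := hroot j
      rw [Finset.prod_eq_zero (Finset.mem_univ i) (by rw [hh, sub_self])] at this
      simp at this
  · intro i k hki
    exact (h1 ⟨(i, k), hki⟩).2.trans (le_max_left _ _)
  · intro i
    refine le_trans ?_ ((le_max_left c2 c3).trans (le_max_right _ _))
    have e := hcl i
    have n1 : g i z - b i ≠ 0 := by
      intro h; rw [h, zero_mul] at e; exact hz e.symm
    have e2 : Real.log (z) = Real.log (g i z - b i) +
        Real.log ((∏ k ∈ Finset.univ.erase i, (g i z - b k)) * (z * g i z - 1)) := by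
      rw [← Real.log_mul n1 (h2 i).1, e]
    change |Real.log (g i z - b i) - Real.log (z)| ≤ c2
    rw [e2, ← abs_neg]
    have := (h2 i).2
    convert this using 2
    ring
  · intro k
    refine le_trans ?_ ((le_max_right c2 c3).trans (le_max_right _ _))
    have e := hbig k
    have n1 : Ξ none z - b k ≠ 0 := by
      intro h; rw [h, mul_zero] at e; exact (h3 k).1 e.symm
    have e2 : Real.log (Ξ none z - b k) + Real.log (z) = Real.log (1 + z * (∑ i, b i - ∑ i, g i z - b k)) := by
      rw [← e, Real.log_mul hz n1]; ring
    rw [e2]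
    exact (h3 k).2
end

section
open Polynomial NumberField Filter Topology

/-- `σ` enumerates all (real) embeddings -/
def RE (K : Type*) [Field K] {J : Type*} (σ : J → K →+* ℝ) : Prop :=
  Function.Bijective (fun j => Complex.ofRealHom.comp (σ j))

section
variable {K : Type*} [Field K] [NumberField K] {J : Type*} [Fintype J] {σ : J → K →+* ℝ}

noncomputable def RE.equiv (h : RE K σ) : J ≃ (K →ₐ[ℚ] ℂ) :=
  (Equiv.ofBijective _ h).trans (RingHom.equivRatAlgHom K ℂ)

lemma RE.equiv_apply (h : RE K σ) (j : J) (x : K) : h.equiv j x = ((σ j x : ℝ) : ℂ) := rfl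

lemma RE.norm (h : RE K σ) (x : K) : ((Algebra.norm ℚ x : ℚ) : ℝ) = ∏ j, σ j x := by
  have := Algebra.norm_eq_prod_embeddings ℚ ℂ x
  rw [← Equiv.prod_comp h.equiv] at this
  simp only [RE.equiv_apply, eq_ratCast] at this
  exact_mod_cast this

lemma RE.trace (h : RE K σ) (x : K) : ((Algebra.trace ℚ K x : ℚ) : ℝ) = ∑ j, σ j x := by
  have := trace_eq_sum_embeddings (K := ℚ) ℂ (x := x)
  rw [← Equiv.sum_comp h.equiv] at this
  simp only [RE.equiv_apply, eq_ratCast] at this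
  exact_mod_cast this

lemma RE.card (h : RE K σ) : Fintype.card J = Module.finrank ℚ K := by
  rw [← AlgHom.card ℚ K ℂ]
  exact Fintype.card_congr h.equiv

lemma RE.trace_int (h : RE K σ) {x : K} (hx : IsIntegral ℤ x) : ∃ k : ℤ, ∑ j, σ j x = k := by
  obtain ⟨k, hk⟩ := IsIntegrallyClosed.isIntegral_iff.1 (Algebra.isIntegral_trace (L := ℚ) hx)
  refine ⟨k, ?_⟩
  rw [← h.trace, ← hk]; simp

lemma RE.one_le_prod (h : RE K σ) {x : K} (hx : IsIntegral ℤ x) (h0 : x ≠ 0) :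
    1 ≤ ∏ j, |σ j x| := by
  obtain ⟨k, hk⟩ := IsIntegrallyClosed.isIntegral_iff.1 (Algebra.isIntegral_norm ℚ hx)
  have h1 : (Algebra.norm ℚ x) ≠ 0 := by rwa [Algebra.norm_ne_zero_iff]
  rw [← Finset.abs_prod, ← h.norm, ← hk]
  have : k ≠ 0 := by rintro rfl; simp at hk; exact h1 hk.symm
  have := Int.one_le_abs this
  simp only [algebraMap_int_eq, eq_intCast, Rat.cast_intCast]
  exact_mod_cast this

lemma RE.prod_unit (h : RE K σ) {x : K} (hx : IsIntegral ℤ x) (hx' : IsIntegral ℤ x⁻¹) (h0 : x ≠ 0) :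
    ∏ j, |σ j x| = 1 := by
  have h1 := h.one_le_prod hx h0
  have h2 := h.one_le_prod hx' (inv_ne_zero h0)
  simp only [map_inv₀, abs_inv, Finset.prod_inv_distrib] at h2
  have h3 : 0 < ∏ j, |σ j x| := by linarith
  have h4 : (∏ j, |σ j x|) ≤ 1 := by
    by_contra hlt
    rw [not_le] at hlt
    have := inv_lt_one_of_one_lt₀ hlt
    linarith
  linarith

lemma RE.disc_le (h : RE K σ) {x : K} (hx : IsIntegral ℤ x)
    (hinj : Function.Injective (fun j => σ j x)) (w : J → ℝ)
    (hw : ∀ i j, i ≠ j → |σ i x - σ j x| ≤ w i * w j) :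
    |(NumberField.discr K : ℝ)| ≤ (∏ j, w j) ^ (2 * (Fintype.card J - 1)) := by
  classical
  set n := Fintype.card J with hn
  let eJ : J ≃ Fin n := Fintype.equivFin J
  have hc : Fintype.card (Module.Free.ChooseBasisIndex ℤ (𝓞 K)) = n := by
    rw [hn, h.card, ← RingOfIntegers.rank K, Module.finrank_eq_card_chooseBasisIndex]
  let eI : Module.Free.ChooseBasisIndex ℤ (𝓞 K) ≃ Fin n := Fintype.equivFinOfCardEq hc
  let bQ := (integralBasis K).reindex eI
  let y : 𝓞 K := ⟨x, hx⟩
  let v : Fin n → K := fun i => x ^ (i : ℕ)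
  let PZ : Matrix (Fin n) (Fin n) ℤ := fun i j => (RingOfIntegers.basis K).repr (y ^ (j : ℕ)) (eI.symm i)
  have hP : bQ.toMatrix v = PZ.map (Int.castRingHom ℚ) := by
    ext i j
    simp only [Module.Basis.toMatrix_apply, bQ, Module.Basis.repr_reindex, Finsupp.mapDomain_equiv_apply, v, PZ,
      Matrix.map_apply]
    have := integralBasis_repr_apply K (y ^ (j:ℕ)) (eI.symm i)
    simp only [map_pow] at this
    exact this
  have h1 := Algebra.discr_of_matrix_vecMul (A := ℚ) bQ (bQ.toMatrix v)
  rw [Module.Basis.toMatrix_map_vecMul, hP, ← RingHom.mapMatrix_apply, ← RingHom.map_det] at h1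
  have h2 : Algebra.discr ℚ bQ = NumberField.discr K := by
    rw [NumberField.coe_discr]
    have := Algebra.discr_reindex ℚ (integralBasis K) eI
    rw [← this]
    congr 1
    funext i
    simp [bQ]
  have h3 := Algebra.discr_eq_det_embeddingsMatrixReindex_pow_two ℚ ℂ v (eJ.symm.trans h.equiv)
  have h4 : (Algebra.embeddingsMatrixReindex ℚ ℂ v (eJ.symm.trans h.equiv))
      = ((Matrix.vandermonde (fun i => σ (eJ.symm i) x)).map Complex.ofRealHom).transpose := by
    ext i j
    simp [Algebra.embeddingsMatrixReindex, Algebra.embeddingsMatrix, v, Matrix.vandermonde, RE.equiv_apply]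
  rw [h4, Matrix.det_transpose, ← RingHom.mapMatrix_apply, ← RingHom.map_det, h1, h2] at h3
  have h5 : ((PZ.det : ℝ)) ^ 2 * (NumberField.discr K : ℝ) = (Matrix.vandermonde (fun i => σ (eJ.symm i) x)).det ^ 2 := by
    have : (((PZ.det : ℝ)) ^ 2 * (NumberField.discr K : ℝ) : ℂ) = ((Matrix.vandermonde (fun i => σ (eJ.symm i) x)).det : ℂ) ^ 2 := by
      simpa using h3
    exact_mod_cast this
  have h6 : (Matrix.vandermonde (fun i => σ (eJ.symm i) x)).det ≠ 0 := by
    rw [Matrix.det_vandermonde_ne_zero_iff]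
    exact hinj.comp eJ.symm.injective
  have h7 : PZ.det ≠ 0 := by
    intro h; rw [h] at h5
    simp at h5; exact h6 (pow_eq_zero_iff (two_ne_zero) |>.1 h5.symm)
  have h8 : (1:ℝ) ≤ (PZ.det : ℝ) ^ 2 := by
    have : 0 < PZ.det ^ 2 := by positivity
    exact_mod_cast this
  have h9 : |(NumberField.discr K : ℝ)| ≤ |(Matrix.vandermonde (fun i => σ (eJ.symm i) x)).det| ^ 2 := by
    rw [← abs_pow, ← h5, abs_mul, abs_of_nonneg (by positivity : (0:ℝ) ≤ (PZ.det:ℝ)^2)]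
    nlinarith [abs_nonneg (NumberField.discr K : ℝ)]
  refine h9.trans ?_
  rw [mul_comm 2, pow_mul]
  refine pow_le_pow_left₀ (abs_nonneg _) ?_ 2
  rw [Matrix.det_vandermonde, Finset.abs_prod]
  simp_rw [Finset.abs_prod]
  calc ∏ i : Fin n, ∏ j ∈ Finset.Ioi i, |σ (eJ.symm j) x - σ (eJ.symm i) x|
      ≤ ∏ i : Fin n, ∏ j ∈ Finset.Ioi i, (w (eJ.symm j) * w (eJ.symm i)) := by
        refine Finset.prod_le_prod (fun i _ => Finset.prod_nonneg fun j _ => abs_nonneg _) fun i _ => ?_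
        refine Finset.prod_le_prod (fun j _ => abs_nonneg _) fun j hj => ?_
        apply hw
        intro h
        have := eJ.symm.injective h
        simp at hj
        omega
    _ = (∏ j, w j) ^ (n - 1) := by
        rw [Finset.prod_prod_Ioi_mul_eq_prod_prod_off_diag (fun i j => w (eJ.symm i))]
        rw [← Equiv.prod_comp eJ.symm w, ← Finset.prod_pow]
        rw [Finset.prod_comm' (s' := fun i => {i}ᶜ) (t' := Finset.univ) (by intro a b; simp [eq_comm])]
        refine Finset.prod_congr rfl fun i _ => ?_
        rw [Finset.prod_const, Finset.card_compl]
        simp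
end
end

section
open Polynomial NumberField Filter Topology

section
variable {K : Type*} [Field K] [NumberField K] {J : Type*} [Fintype J] {σ : J → K →+* ℝ}

/-- logarithms of the conjugates -/
noncomputable def lg (σ : J → K →+* ℝ) (j : J) (u : (𝓞 K)ˣ) : ℝ := Real.log (σ j ((u : 𝓞 K) : K))

/-- two-transitivity -/
def T2 (σ : J → K →+* ℝ) : Prop := ∀ x : K, Function.Injective (fun j => σ j x) ∨ ∀ i j, σ i x = σ j x

lemma unit_ne (u : (𝓞 K)ˣ) : ((u : 𝓞 K) : K) ≠ 0 := by
  have := u.ne_zero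
  simpa using this

lemma sig_ne (j : J) (u : (𝓞 K)ˣ) : σ j ((u : 𝓞 K) : K) ≠ 0 := by
  rw [Ne, map_eq_zero]; exact unit_ne u

lemma unit_inv (u : (𝓞 K)ˣ) : (((u⁻¹ : (𝓞 K)ˣ) : 𝓞 K) : K) = ((u : 𝓞 K) : K)⁻¹ := by
  apply eq_inv_of_mul_eq_one_left
  have := congrArg (algebraMap (𝓞 K) K) (u.inv_mul)
  rwa [map_mul, map_one] at this

lemma lg_mul (j : J) (u v : (𝓞 K)ˣ) : lg σ j (u * v) = lg σ j u + lg σ j v := by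
  unfold lg
  rw [← Real.log_mul (sig_ne j u) (sig_ne j v)]
  simp

lemma lg_inv (j : J) (u : (𝓞 K)ˣ) : lg σ j u⁻¹ = - lg σ j u := by
  unfold lg
  rw [unit_inv, map_inv₀, Real.log_inv]

/-- as a hom -/
noncomputable def lgHom (σ : J → K →+* ℝ) (j : J) : (𝓞 K)ˣ →* Multiplicative ℝ where
  toFun u := Multiplicative.ofAdd (lg σ j u)
  map_one' := by simp [lg]
  map_mul' u v := by rw [lg_mul]; rfl

lemma lg_prod_zpow {ι : Type*} [Fintype ι] (j : J) (e : ι → (𝓞 K)ˣ) (z : ι → ℤ) :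
    lg σ j (∏ k, e k ^ z k) = ∑ k, z k * lg σ j (e k) := by
  have h1 := map_prod (lgHom σ j) (fun k => e k ^ z k) Finset.univ
  simp only [map_zpow] at h1
  have h2 := congrArg Multiplicative.toAdd h1
  simp only [toAdd_prod, toAdd_zpow] at h2
  change lg σ j (∏ k, e k ^ z k) = ∑ k, z k • lg σ j (e k) at h2
  simpa using h2

lemma RE.sum_lg (h : RE K σ) (u : (𝓞 K)ˣ) : ∑ j, lg σ j u = 0 := by
  have h1 := h.prod_unit (x := ((u : 𝓞 K) : K)) (RingOfIntegers.isIntegral_coe _)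
    (by rw [← unit_inv]; exact RingOfIntegers.isIntegral_coe _) (unit_ne u)
  have h2 := congrArg Real.log h1
  rw [Real.log_prod (fun j _ => by simpa using sig_ne j u)] at h2
  simpa [lg] using h2

lemma unit_ext {u v : (𝓞 K)ˣ} (h : ((u : 𝓞 K) : K) = ((v : 𝓞 K) : K)) : u = v := by
  apply Units.ext; exact RingOfIntegers.ext h

lemma unit_pm {u : (𝓞 K)ˣ} (h : ((u : 𝓞 K) : K) ^ 2 = 1) : u = 1 ∨ u = -1 := by
  rcases sq_eq_one_iff.1 h with h | h
  · left; apply unit_ext; simpa using h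
  · right; apply unit_ext; simpa using h

lemma abs_le_of_lg {x B : ℝ} (hx : x ≠ 0) (h : |Real.log x| ≤ B) : |x| ≤ Real.exp B := by
  rw [← Real.log_le_iff_le_exp (by positivity), Real.log_abs]
  exact (abs_le.1 h).2

lemma RE.sep1 (h : RE K σ) {u : (𝓞 K)ˣ} (hu : ∀ j, |lg σ j u| < Real.log (3/2)) : u = 1 ∨ u = -1 := by
  have hJ : Nonempty J := by
    rw [← Fintype.card_pos_iff, h.card]; exact Module.finrank_pos
  set x := ((u : 𝓞 K) : K) with hx
  have h0 : x ≠ 0 := unit_ne u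
  have hint : IsIntegral ℤ (x - x⁻¹) :=
    (RingOfIntegers.isIntegral_coe _).sub (by rw [hx, ← unit_inv]; exact RingOfIntegers.isIntegral_coe _)
  by_cases hz : x - x⁻¹ = 0
  · apply unit_pm
    change x ^ 2 = 1
    field_simp at hz
    linear_combination hz
  exfalso
  have h1 := h.one_le_prod hint hz
  have h2 : ∏ j, |σ j (x - x⁻¹)| < ∏ j : J, 1 := by
    apply Finset.prod_lt_prod_of_nonempty
    · intro j _
      rw [abs_pos, Ne, map_eq_zero]; exact hz
    · intro j _
      have h3 := hu j
      have hne : σ j x ≠ 0 := sig_ne j u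
      have e1 : |σ j (x - x⁻¹)| = |(|σ j x| - |σ j x|⁻¹)| := by
        rw [map_sub, map_inv₀]
        rcases lt_or_gt_of_ne hne with h | h
        · rw [abs_of_neg h, ← abs_neg, inv_neg]; congr 1; ring
        · rw [abs_of_pos h]
      rw [e1]
      have hp : 0 < |σ j x| := by positivity
      have h4 : |Real.log (|σ j x|)| < Real.log (3/2) := by rw [Real.log_abs]; exact h3
      rw [abs_lt] at h4
      have h5 : |σ j x| < 3/2 := (Real.log_lt_log_iff hp (by norm_num)).1 h4.2
      have h6 : |σ j x|⁻¹ < 3/2 := by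
        rw [← Real.log_lt_log_iff (by positivity) (by norm_num), Real.log_inv]
        linarith [h4.1]
      have h7 : |σ j x| * |σ j x|⁻¹ = 1 := mul_inv_cancel₀ hp.ne'
      rw [abs_lt]
      constructor <;> nlinarith [inv_pos.2 hp]
    · exact Finset.univ_nonempty
  rw [Finset.prod_const_one] at h2
  linarith

lemma RE.sep2 (h : RE K σ) (h2 : T2 σ) {u : (𝓞 K)ˣ} {B : ℝ} (hu : ∀ j, |lg σ j u| ≤ B)
    (hd : (2 * Real.exp B) ^ (Fintype.card J * (Fintype.card J - 1)) < |(NumberField.discr K : ℝ)|) :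
    u = 1 ∨ u = -1 := by
  have hJ : Nonempty J := by
    rw [← Fintype.card_pos_iff, h.card]; exact Module.finrank_pos
  set x := ((u : 𝓞 K) : K) with hx
  have hxi : IsIntegral ℤ x := RingOfIntegers.isIntegral_coe _
  rcases h2 x with hinj | heq
  · exfalso
    have h3 := h.disc_le hxi hinj (fun _ => Real.sqrt (2 * Real.exp B)) (by
      intro i j _
      rw [Real.mul_self_sqrt (by positivity)]
      have h4 := abs_le_of_lg (sig_ne i u) (hu i)
      have h5 := abs_le_of_lg (sig_ne j u) (hu j)
      have := abs_sub (σ i x) (σ j x)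
      linarith)
    rw [Finset.prod_const, Finset.card_univ, ← pow_mul, mul_left_comm, pow_mul,
      Real.sq_sqrt (by positivity)] at h3
    linarith
  · obtain ⟨j0⟩ := hJ
    have h1 := h.prod_unit hxi (by rw [← unit_inv]; exact RingOfIntegers.isIntegral_coe _) (unit_ne u)
    have h3 : ∏ j, |σ j x| = |σ j0 x| ^ Fintype.card J := by
      rw [← Finset.card_univ, ← Finset.prod_const]
      exact Finset.prod_congr rfl fun j _ => by rw [heq j j0]
    rw [h3] at h1
    have h4 : |σ j0 x| = 1 := by
      have : Nonempty J := ⟨j0⟩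
      have hc : Fintype.card J ≠ 0 := Fintype.card_ne_zero
      exact (pow_eq_one_iff_of_nonneg (abs_nonneg _) hc).1 h1
    apply unit_pm
    apply (σ j0).injective
    rw [map_pow, map_one, ← hx, ← sq_abs, h4, one_pow]

lemma packing {δ : ℝ} (hδ : 0 < δ) (hs : ∀ u : (𝓞 K)ˣ, (∀ j, |lg σ j u| < δ) → u = 1 ∨ u = -1)
    {B : ℝ} (hB : 0 ≤ B) (S : Finset (𝓞 K)ˣ) (hS : ∀ u ∈ S, ∀ j, |lg σ j u| ≤ B) :
    (S.card : ℝ) ≤ 2 * (2 * B / δ + 2) ^ Fintype.card J := by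
  classical
  let fl : (𝓞 K)ˣ → (J → ℤ) := fun u j => ⌊lg σ j u / δ⌋
  let box : Finset (J → ℤ) := Fintype.piFinset (fun _ : J => Finset.Icc ⌊-B/δ⌋ ⌊B/δ⌋)
  have hmem : ∀ u ∈ S, fl u ∈ box := by
    intro u hu
    simp only [box, Fintype.mem_piFinset, Finset.mem_Icc, fl]
    intro j
    have := abs_le.1 (hS u hu j)
    exact ⟨Int.floor_le_floor (by gcongr; exact this.1), Int.floor_le_floor (by gcongr; exact this.2)⟩
  have hfib : ∀ b ∈ box, (S.filter (fun u => fl u = b)).card ≤ 2 := by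
    intro b _
    by_cases he : (S.filter (fun u => fl u = b)) = ∅
    · rw [he]; simp
    obtain ⟨v, hv⟩ := Finset.nonempty_iff_ne_empty.2 he
    have : S.filter (fun u => fl u = b) ⊆ {v, -v} := by
      intro u hu
      have e : fl u = fl v := by
        rw [(Finset.mem_filter.1 hu).2, (Finset.mem_filter.1 hv).2]
      have h1 := hs (u * v⁻¹) (by
        intro j
        rw [lg_mul, lg_inv]
        have := congrFun e j
        have h2 := Int.abs_sub_lt_one_of_floor_eq_floor this
        rw [← sub_div, abs_div, abs_of_pos hδ, div_lt_one hδ] at h2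
        rwa [← sub_eq_add_neg])
      simp only [Finset.mem_insert, Finset.mem_singleton]
      rcases h1 with h1 | h1
      · left; exact mul_inv_eq_one.1 h1
      · right
        rw [mul_inv_eq_iff_eq_mul] at h1
        rw [h1]; simp
    exact (Finset.card_le_card this).trans Finset.card_le_two
  have h1 := Finset.card_le_mul_card_image_of_maps_to hmem 2 hfib
  have h2 : box.card = (⌊B/δ⌋ + 1 - ⌊-B/δ⌋).toNat ^ Fintype.card J := by
    simp [box, Fintype.card_piFinset]
  have h3 : (((⌊B/δ⌋ + 1 - ⌊-B/δ⌋).toNat : ℕ) : ℝ) ≤ 2 * B / δ + 2 := by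
    have e1 : 0 ≤ B / δ := by positivity
    have e2 : ⌊-B/δ⌋ ≤ ⌊B/δ⌋ := Int.floor_le_floor (by rw [neg_div]; linarith)
    have e3 : (((⌊B/δ⌋ + 1 - ⌊-B/δ⌋).toNat : ℕ) : ℝ) = ((⌊B/δ⌋ + 1 - ⌊-B/δ⌋ : ℤ) : ℝ) := by
      have := Int.toNat_of_nonneg (show 0 ≤ ⌊B/δ⌋ + 1 - ⌊-B/δ⌋ by omega)
      exact_mod_cast this
    rw [e3]
    push_cast
    have e4 := Int.floor_le (B/δ)
    have e5 := Int.lt_floor_add_one (-B/δ)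
    have e6 : -B/δ = -(B/δ) := neg_div _ _
    have e7 : 2 * B / δ = 2 * (B / δ) := by ring
    rw [e6] at e5 ⊢
    linarith
  calc (S.card : ℝ) ≤ ((2 * box.card : ℕ) : ℝ) := by exact_mod_cast h1
    _ = 2 * (((⌊B/δ⌋ + 1 - ⌊-B/δ⌋).toNat : ℕ) : ℝ) ^ Fintype.card J := by rw [h2]; push_cast; rfl
    _ ≤ _ := by gcongr

end

lemma index_bound {K : Type*} [Field K] [NumberField K] {m : ℕ} (hm : 0 < m)
    {σ : Option (Fin m) → K →+* ℝ} (h : RE K σ)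
    {δ : ℝ} (hδ : 0 < δ) (hs : ∀ u : (𝓞 K)ˣ, (∀ j, |lg σ j u| < δ) → u = 1 ∨ u = -1)
    (e : Fin m → (𝓞 K)ˣ) {Λ : ℝ} (hΛ : ∀ i k, |lg σ (some i) (e k)| ≤ Λ)
    (hdom : ∀ i, ∑ k ∈ Finset.univ.erase i, |lg σ (some i) (e k)| < |lg σ (some i) (e i)|)
    (H : Subgroup (𝓞 K)ˣ) (hH : ∀ k, e k ∈ H) :
    H.index ≠ 0 ∧ (H.index : ℝ) ≤ 2 * (2 * (m ^ 2 * Λ) / δ + 2) ^ (m + 1) := by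
  classical
  have hΛ0 : 0 ≤ Λ := (abs_nonneg _).trans (hΛ ⟨0, hm⟩ ⟨0, hm⟩)
  set B : ℝ := m ^ 2 * Λ with hB
  have hB0 : 0 ≤ B := by positivity
  have hm1 : (1:ℝ) ≤ m := by exact_mod_cast hm
  let A : Matrix (Fin m) (Fin m) ℝ := fun i k => lg σ (some i) (e k)
  have hA : A.det ≠ 0 := by
    apply det_ne_zero_of_sum_row_lt_diag
    intro i
    simpa [A] using hdom i
  -- representatives
  have key : ∀ u : (𝓞 K)ˣ, ∃ v : (𝓞 K)ˣ, (∀ j, |lg σ j v| ≤ B) ∧ (v⁻¹ * u) ∈ H := by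
    intro u
    let t : Fin m → ℝ := A⁻¹.mulVec (fun i => lg σ (some i) u)
    have ht : A.mulVec t = fun i => lg σ (some i) u := by
      simp only [t, Matrix.mulVec_mulVec]
      rw [Matrix.mul_nonsing_inv _ (isUnit_iff_ne_zero.2 hA), Matrix.one_mulVec]
    have ht' : ∀ i, ∑ k, lg σ (some i) (e k) * t k = lg σ (some i) u := by
      intro i
      have := congrFun ht i
      simpa [Matrix.mulVec, dotProduct, A] using this
    let p : (𝓞 K)ˣ := ∏ k, e k ^ ⌊t k⌋
    have hp : p ∈ H := Subgroup.prod_mem _ fun k _ => Subgroup.zpow_mem _ (hH k) _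
    have h1 : ∀ i, lg σ (some i) (u * p⁻¹) = ∑ k, Int.fract (t k) * lg σ (some i) (e k) := by
      intro i
      rw [lg_mul, lg_inv, lg_prod_zpow, ← ht' i, ← sub_eq_add_neg, ← Finset.sum_sub_distrib]
      refine Finset.sum_congr rfl fun k _ => ?_
      rw [Int.fract]; ring
    have h2 : ∀ i, |lg σ (some i) (u * p⁻¹)| ≤ m * Λ := by
      intro i
      rw [h1]
      calc |∑ k, Int.fract (t k) * lg σ (some i) (e k)|
          ≤ ∑ k, |Int.fract (t k) * lg σ (some i) (e k)| := Finset.abs_sum_le_sum_abs _ _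
        _ ≤ ∑ k : Fin m, Λ := by
          refine Finset.sum_le_sum fun k _ => ?_
          rw [abs_mul, abs_of_nonneg (Int.fract_nonneg _)]
          nlinarith [hΛ i k, Int.fract_nonneg (t k), Int.fract_lt_one (t k), abs_nonneg (lg σ (some i) (e k))]
        _ = m * Λ := by simp
    refine ⟨u * p⁻¹, ?_, ?_⟩
    · rintro (_ | i)
      · have := h.sum_lg (u * p⁻¹)
        rw [Fintype.sum_option] at this
        have e1 : lg σ none (u * p⁻¹) = - ∑ i, lg σ (some i) (u * p⁻¹) := by linarith
        rw [e1, abs_neg]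
        calc |∑ i, lg σ (some i) (u * p⁻¹)| ≤ ∑ i, |lg σ (some i) (u * p⁻¹)| := Finset.abs_sum_le_sum_abs _ _
          _ ≤ ∑ i : Fin m, m * Λ := Finset.sum_le_sum fun i _ => h2 i
          _ = B := by simp [hB]; ring
      · refine (h2 i).trans ?_
        rw [hB]
        have : (m:ℝ) ≤ m ^ 2 := by nlinarith
        gcongr
    · have : (u * p⁻¹)⁻¹ * u = p := by
        rw [mul_inv_rev, inv_inv, mul_assoc, inv_mul_cancel, mul_one]
      rw [this]; exact hp
  -- finite box
  have hfin : Set.Finite {v : (𝓞 K)ˣ | ∀ j, |lg σ j v| ≤ B} := by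
    by_contra hinf
    obtain ⟨N, hN⟩ := exists_nat_gt (2 * (2 * B / δ + 2) ^ Fintype.card (Option (Fin m)))
    obtain ⟨S, hS, hSc⟩ := Set.Infinite.exists_subset_card_eq hinf N
    have := packing hδ hs hB0 S (fun u hu => hS hu)
    rw [hSc] at this
    linarith
  have hpack := packing hδ hs hB0 hfin.toFinset (fun u hu => by simpa using hu)
  let f : hfin.toFinset → (𝓞 K)ˣ ⧸ H := fun v => QuotientGroup.mk (v : (𝓞 K)ˣ)
  have hf : Function.Surjective f := by
    intro q
    induction q using QuotientGroup.induction_on with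
    | H u =>
      obtain ⟨v, hv, hvH⟩ := key u
      exact ⟨⟨v, by simpa using hv⟩, QuotientGroup.eq.2 hvH⟩
  have : Finite ((𝓞 K)ˣ ⧸ H) := Finite.of_surjective f hf
  refine ⟨?_, ?_⟩
  · have hh : H.FiniteIndex := Subgroup.finiteIndex_of_finite_quotient
    exact hh.index_ne_zero
  · have h1 : H.index ≤ hfin.toFinset.card := by
      have := Nat.card_le_card_of_surjective f hf
      rw [Nat.card_eq_fintype_card (α := hfin.toFinset), Fintype.card_coe] at this
      exact this
    have h2 : (H.index : ℝ) ≤ hfin.toFinset.card := by exact_mod_cast h1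
    refine h2.trans (hpack.trans (le_of_eq ?_))
    simp
end

section
open Polynomial NumberField Filter Topology

lemma gal_data {F E : Type*} [Field F] [Field E] [Algebra F E] (p : F[X]) {J : Type*} [Fintype J]
    (y : J → E) (hp : p.map (algebraMap F E) = ∏ j, (X - C (y j))) (hinj : Function.Injective y) :
    ∃ (ι : p.SplittingField →ₐ[F] E) (y' : J → p.SplittingField) (Φ : (p.SplittingField ≃ₐ[F] p.SplittingField) → Equiv.Perm J),
      (∀ j, ι (y' j) = y j) ∧ Function.Injective y' ∧
      p.map (algebraMap F p.SplittingField) = ∏ j, (X - C (y' j)) ∧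
      (∀ φ : p.SplittingField ≃ₐ[F] p.SplittingField, ∀ j, φ (y' j) = y' (Φ φ j)) ∧ Function.Injective Φ := by
  classical
  have hp0 : p ≠ 0 := by
    rintro rfl
    rw [Polynomial.map_zero] at hp
    exact (Finset.prod_ne_zero_iff.2 fun j _ => X_sub_C_ne_zero (y j)) hp.symm
  have hs : (p.map (algebraMap F E)).Splits := by
    rw [hp]; exact Polynomial.Splits.prod fun j _ => Polynomial.Splits.X_sub_C _
  let ι : p.SplittingField →ₐ[F] E := Polynomial.SplittingField.lift p hs
  have hι : (ι : p.SplittingField →+* E).comp (algebraMap F p.SplittingField) = algebraMap F E :=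
    ι.comp_algebraMap
  have hy : ∀ j, ∃ x : p.SplittingField, x ∈ (p.map (algebraMap F p.SplittingField)).roots ∧ ι x = y j := by
    intro j
    have h1 : y j ∈ (p.map (algebraMap F E)).roots := by
      rw [mem_roots (by rw [Ne, Polynomial.map_eq_zero]; exact hp0), hp, IsRoot, eval_prod]
      exact Finset.prod_eq_zero (Finset.mem_univ j) (by simp)
    rw [← hι, ← Polynomial.map_map] at h1
    rw [Polynomial.Splits.roots_map (SplittingField.splits p) (ι : p.SplittingField →+* E)] at h1
    simpa using h1
  choose y' hy' hιy using hy
  have hy'inj : Function.Injective y' := fun i j h => hinj (by rw [← hιy, ← hιy, h])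
  have hprod : p.map (algebraMap F p.SplittingField) = ∏ j, (X - C (y' j)) := by
    apply Polynomial.map_injective (ι : p.SplittingField →+* E) ι.injective
    rw [Polynomial.map_map, hι, hp, Polynomial.map_prod]
    refine Finset.prod_congr rfl fun j _ => ?_
    simp [hιy]
  have hroot : ∀ x : p.SplittingField, eval₂ (algebraMap F p.SplittingField) x p = 0 → ∃ j, x = y' j := by
    intro x hx
    rw [← eval_map, hprod, eval_prod, Finset.prod_eq_zero_iff] at hx
    obtain ⟨j, -, hj⟩ := hx
    exact ⟨j, by simpa [sub_eq_zero] using hj⟩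
  have hact : ∀ φ : p.SplittingField ≃ₐ[F] p.SplittingField, ∃ s : Equiv.Perm J, ∀ j, φ (y' j) = y' (s j) := by
    intro φ
    have : ∀ j, ∃ k, φ (y' j) = y' k := by
      intro j
      apply hroot
      have h1 : eval₂ (algebraMap F p.SplittingField) (y' j) p = 0 := by
        rw [← eval_map, hprod, eval_prod]
        exact Finset.prod_eq_zero (Finset.mem_univ j) (by simp)
      have h2 := congrArg φ h1
      rw [map_zero] at h2
      rw [← h2]
      exact (Polynomial.aeval_algHom_apply (φ : p.SplittingField →ₐ[F] p.SplittingField) (y' j) p)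
    choose s hs using this
    have hsi : Function.Injective s := fun i j h => hy'inj (φ.injective (by rw [hs, hs, h]))
    exact ⟨Equiv.ofBijective s (Finite.injective_iff_bijective.1 hsi), hs⟩
  choose Φ hΦ using hact
  refine ⟨ι, y', Φ, hιy, hy'inj, hprod, hΦ, ?_⟩
  intro φ ψ h
  refine Polynomial.Gal.ext (p := p) (σ := φ) (τ := ψ) ?_
  intro x hx
  rw [Polynomial.mem_rootSet_of_ne hp0] at hx
  obtain ⟨j, rfl⟩ := hroot x hx
  exact (hΦ φ j).trans ((by rw [h] : y' (Φ φ j) = y' (Φ ψ j)).trans (hΦ ψ j).symm)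

lemma gal_surj {F : Type*} [Field F] (p : F[X]) {J : Type*} [Fintype J]
    {n : ℕ} (hG : Nonempty (p.Gal ≃* Equiv.Perm (Fin n))) (hJ : Fintype.card J = n)
    (Φ : (p.SplittingField ≃ₐ[F] p.SplittingField) → Equiv.Perm J) (hΦ : Function.Injective Φ) : Function.Surjective Φ := by
  classical
  obtain ⟨g⟩ := hG
  have e : Fin n ≃ J := (Fintype.equivFinOfCardEq hJ).symm
  have g : (p.SplittingField ≃ₐ[F] p.SplittingField) ≃* Equiv.Perm (Fin n) := g
  have : Finite (p.SplittingField ≃ₐ[F] p.SplittingField) := Finite.of_injective _ g.injective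
  have h := hΦ.bijective_of_nat_card_le
    (by rw [Nat.card_congr g.toEquiv, Nat.card_congr e.permCongr])
  exact h.2

lemma T2_aux {F E : Type*} [Field F] [Field E] [Algebra F E] (p : F[X]) {J : Type*} [Fintype J]
    (y : J → E) (hp : p.map (algebraMap F E) = ∏ j, (X - C (y j))) (hinj : Function.Injective y)
    {n : ℕ} (hG : Nonempty (p.Gal ≃* Equiv.Perm (Fin n))) (hJ : Fintype.card J = n) (g : F[X])
    : Function.Injective (fun j => aeval (y j) g) ∨ ∀ i j, aeval (y i) g = aeval (y j) g := by
  classical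
  obtain ⟨ι, y', Φ, h1, h2, h3, h4, h5⟩ := gal_data p y hp hinj
  have hsurj := gal_surj p hG hJ Φ h5
  have hev : ∀ j, aeval (y j) g = ι (aeval (y' j) g) := by
    intro j
    rw [← Polynomial.aeval_algHom_apply, h1]
  have hph : ∀ (φ : p.SplittingField ≃ₐ[F] p.SplittingField) j, φ (aeval (y' j) g) = aeval (y' (Φ φ j)) g := by
    intro φ j
    rw [← h4]
    exact (Polynomial.aeval_algHom_apply (φ : p.SplittingField →ₐ[F] p.SplittingField) (y' j) g).symm
  by_contra! hcon
  obtain ⟨hni, i0, j0, hij0⟩ := hcon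
  apply hni
  intro i j hij
  by_contra hne
  have hne0 : i0 ≠ j0 := fun h => hij0 (by rw [h])
  have hij' : aeval (y' i) g = aeval (y' j) g := by
    apply ι.injective
    simpa [hev] using hij
  have : ∃ s : Equiv.Perm J, s i = i0 ∧ s j = j0 := by
    let s1 := Equiv.swap i i0
    refine ⟨(Equiv.swap (s1 j) j0) * s1, ?_, ?_⟩
    · have : s1 i = i0 := Equiv.swap_apply_left _ _
      rw [Equiv.Perm.mul_apply, this]
      apply Equiv.swap_apply_of_ne_of_ne _ hne0
      intro h
      exact hne (s1.injective (by rw [this, h]))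
    · rw [Equiv.Perm.mul_apply]; exact Equiv.swap_apply_left _ _
  obtain ⟨s, hs1, hs2⟩ := this
  obtain ⟨φ, rfl⟩ := hsurj s
  have := congrArg φ hij'
  rw [hph, hph, hs1, hs2] at this
  exact hij0 (by rw [hev, hev, this])

lemma irr_aux {F E : Type*} [Field F] [Field E] [Algebra F E] (p : F[X]) {J : Type*} [Fintype J] [Nonempty J]
    (y : J → E) (hp : p.map (algebraMap F E) = ∏ j, (X - C (y j))) (hinj : Function.Injective y)
    {n : ℕ} (hG : Nonempty (p.Gal ≃* Equiv.Perm (Fin n))) (hJ : Fintype.card J = n) :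
    Irreducible p := by
  classical
  obtain ⟨ι, y', Φ, h1, h2, h3, h4, h5⟩ := gal_data p y hp hinj
  have hsurj := gal_surj p hG hJ Φ h5
  obtain ⟨j0⟩ := ‹Nonempty J›
  have hpm : p.Monic := by
    apply Polynomial.monic_of_injective (algebraMap F E).injective
    rw [hp]; exact monic_prod_of_monic _ _ fun j _ => monic_X_sub_C _
  have hy0 : ∀ j, aeval (y' j) p = 0 := by
    intro j
    rw [aeval_def, ← eval_map, h3, eval_prod]
    exact Finset.prod_eq_zero (Finset.mem_univ j) (by simp)
  have hint : IsIntegral F (y' j0) := ⟨p, hpm, hy0 j0⟩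
  let q := minpoly F (y' j0)
  have hq : ∀ j, aeval (y' j) q = 0 := by
    intro j
    obtain ⟨φ, hφ⟩ := hsurj (Equiv.swap j0 j)
    have : y' j = φ (y' j0) := by rw [h4, hφ, Equiv.swap_apply_left]
    rw [this]
    have := Polynomial.aeval_algHom_apply (φ : p.SplittingField →ₐ[F] p.SplittingField) (y' j0) q
    rw [minpoly.aeval, map_zero] at this
    exact this
  have hdvd : p ∣ q := by
    rw [← Polynomial.map_dvd_map' (algebraMap F p.SplittingField), h3]
    apply Finset.prod_dvd_of_coprime
    · intro i _ j _ hij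
      exact isCoprime_X_sub_C_of_isUnit_sub (by
        rw [isUnit_iff_ne_zero, sub_ne_zero]; exact fun h => hij (h2 h))
    · intro j _
      rw [dvd_iff_isRoot, IsRoot, eval_map]; exact hq j
  have : p = q := eq_of_monic_of_associated hpm (minpoly.monic hint)
    (associated_of_dvd_dvd hdvd (minpoly.dvd F _ (hy0 j0)))
  rw [this]; exact minpoly.irreducible hint

section
variable {J : Type*} [Fintype J] (p : ℚ[X]) (y : J → ℝ)

lemma ev_zero (hp : p.map (algebraMap ℚ ℝ) = ∏ j, (X - C (y j))) (j : J) : eval₂ (algebraMap ℚ ℝ) (y j) p = 0 := by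
  rw [← eval_map, hp, eval_prod]
  exact Finset.prod_eq_zero (Finset.mem_univ j) (by simp)

/-- the embeddings -/
noncomputable def sg (hp : p.map (algebraMap ℚ ℝ) = ∏ j, (X - C (y j))) (j : J) : AdjoinRoot p →+* ℝ :=
  AdjoinRoot.lift (algebraMap ℚ ℝ) (y j) (ev_zero p y hp j)

lemma sg_root (hp) (j : J) : sg p y hp j (AdjoinRoot.root p) = y j := by simp [sg]

lemma sg_mk (hp) (j : J) (g : ℚ[X]) : sg p y hp j (AdjoinRoot.mk p g) = aeval (y j) g := by
  simp [sg, aeval_def]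

lemma sg_RE (hp) (hinj : Function.Injective y) [Fact (Irreducible p)] : RE (AdjoinRoot p) (sg p y hp) := by
  constructor
  · intro i j h
    have := RingHom.congr_fun h (AdjoinRoot.root p)
    simp only [RingHom.comp_apply, sg_root] at this
    exact hinj (by simpa using this)
  · intro f
    have h1 : eval₂ (algebraMap ℚ ℂ) (f (AdjoinRoot.root p)) p = 0 := by
      have h0 : eval₂ (AdjoinRoot.of p) (AdjoinRoot.root p) p = 0 := AdjoinRoot.eval₂_root p
      have := congrArg f h0
      rw [hom_eval₂, map_zero] at this
      rwa [Subsingleton.elim (algebraMap ℚ ℂ) (f.comp (AdjoinRoot.of p))]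
    have h2 : p.map (algebraMap ℚ ℂ) = ∏ j, (X - C ((y j : ℝ) : ℂ)) := by
      rw [Subsingleton.elim (algebraMap ℚ ℂ) (Complex.ofRealHom.comp (algebraMap ℚ ℝ)), ← Polynomial.map_map, hp,
        Polynomial.map_prod]
      simp
    rw [← eval_map, h2, eval_prod, Finset.prod_eq_zero_iff] at h1
    obtain ⟨j, -, hj⟩ := h1
    refine ⟨j, ?_⟩
    have hj' : f (AdjoinRoot.root p) = y j := by simpa [sub_eq_zero] using hj
    have : ∀ x, (Complex.ofRealHom.comp (sg p y hp j)) x = f x := by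
      intro x
      induction x using AdjoinRoot.induction_on with
      | ih g =>
        rw [RingHom.comp_apply, sg_mk, ← AdjoinRoot.aeval_eq, aeval_def, aeval_def, hom_eval₂, hom_eval₂, hj']
        congr 1
        exact Subsingleton.elim _ _
    exact RingHom.ext this

lemma sg_T2 (hp) (hinj : Function.Injective y) {n : ℕ} (hG : Nonempty (p.Gal ≃* Equiv.Perm (Fin n)))
    (hJ : Fintype.card J = n) [Fact (Irreducible p)] : T2 (sg p y hp) := by
  intro x
  induction x using AdjoinRoot.induction_on with
  | ih g =>
    simp only [sg_mk]
    exact T2_aux p y hp hinj hG hJ g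
end
end

section
open Polynomial NumberField Filter Topology

/-- root data -/
structure RD {m : ℕ} (a : Fin m → ℤ) (y : Option (Fin m) → ℝ) (z c0 : ℝ) : Prop where
  prod : ∏ j, (X - C (y j)) = (∏ i, (X - C ((a i : ℤ) : ℝ))) * (X - C z⁻¹) - 1
  inj : Function.Injective y
  ne : ∀ j i, y j ≠ a i
  l1 : ∀ i k, k ≠ i → |Real.log (y (some i) - a k)| ≤ c0
  l2 : ∀ i, |Real.log (y (some i) - a i) - Real.log (z)| ≤ c0
  l3 : ∀ k, |Real.log (y none - a k) + Real.log (z)| ≤ c0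

lemma exists_rd {m : ℕ} (hm : 0 < m) (a : Fin m → ℤ) (ha : Function.Injective a) :
    ∃ (Ξ : Option (Fin m) → ℝ → ℝ) (c0 z0 : ℝ), 0 < z0 ∧ 0 ≤ c0 ∧
      (∀ i, AnalyticAt ℝ (Ξ (some i)) 0) ∧
      (∀ z, Ξ none z = z⁻¹ + ∑ i, (a i : ℝ) - ∑ i, Ξ (some i) z) ∧
      ∀ z, z ≠ 0 → |z| < z0 → RD a (fun j => Ξ j z) z c0 := by
  obtain ⟨Ξ, c0, h1, h2, h3⟩ := exists_roots hm (fun i => (a i : ℝ)) (fun i j h => ha (Int.cast_injective (α := ℝ) h))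
  rw [eventually_nhdsWithin_iff, Metric.eventually_nhds_iff] at h3
  obtain ⟨z0, hz0, h⟩ := h3
  refine ⟨Ξ, c0, z0, hz0, ?_, h1, h2, ?_⟩
  · obtain ⟨-, -, -, -, h4, -⟩ := @h (z0/2) (by simp [abs_of_pos hz0]; linarith) (by simp; linarith)
    exact (abs_nonneg _).trans (h4 ⟨0, hm⟩)
  · intro z hz hzz
    obtain ⟨h3, h4, h5, h6, h7, h8⟩ := @h z (by simpa using hzz) hz
    exact ⟨h3, h4, h5, h6, h7, h8⟩

/-- spec poly with integer parameter -/
noncomputable def pp {m : ℕ} (a : Fin m → ℤ) (t : ℤ) : ℚ[X] :=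
  (∏ i, (X - C ((a i : ℤ) : ℚ))) * (X - C ((t : ℤ) : ℚ)) - 1

section
variable {m : ℕ} {a : Fin m → ℤ} {t : ℤ} {y : Option (Fin m) → ℝ} {c0 : ℝ}

/-- integer version -/
noncomputable def ppZ (a : Fin m → ℤ) (t : ℤ) : ℤ[X] :=
  (∏ i, (X - C (a i))) * (X - C t) - 1

lemma ppZ_monic (hm : 0 < m) (a : Fin m → ℤ) (t : ℤ) : (ppZ a t).Monic := by
  unfold ppZ
  have h1 : (∏ i, (X - C (a i)) : ℤ[X]).Monic := monic_prod_of_monic _ _ fun _ _ => monic_X_sub_C _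
  have h2 := h1.mul (monic_X_sub_C t)
  apply h2.sub_of_left
  rw [degree_one]
  rw [degree_mul, degree_X_sub_C, degree_prod]
  simp only [degree_X_sub_C, Finset.sum_const, Finset.card_univ, Fintype.card_fin, nsmul_eq_mul, mul_one]
  have : ((0 : ℕ) : WithBot ℕ) < ((m + 1 : ℕ) : WithBot ℕ) := by exact_mod_cast Nat.succ_pos m
  exact_mod_cast this

lemma ppZ_map (a : Fin m → ℤ) (t : ℤ) : (ppZ a t).map (algebraMap ℤ ℚ) = pp a t := by
  unfold ppZ pp
  simp [Polynomial.map_prod, Polynomial.map_sub]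

lemma pp_map (h : RD a y (t : ℝ)⁻¹ c0) : (pp a t).map (algebraMap ℚ ℝ) = ∏ j, (X - C (y j)) := by
  rw [h.prod, pp, inv_inv]
  simp [Polynomial.map_prod]

lemma root_integral (hm : 0 < m) (a : Fin m → ℤ) (t : ℤ) : IsIntegral ℤ (AdjoinRoot.root (pp a t)) := by
  refine ⟨ppZ a t, ppZ_monic hm a t, ?_⟩
  have := AdjoinRoot.eval₂_root (pp a t)
  rw [← ppZ_map, eval₂_map] at this
  rw [ppZ_map] at this
  rw [Subsingleton.elim (algebraMap ℤ (AdjoinRoot (pp a t))) ((AdjoinRoot.of (pp a t)).comp (algebraMap ℤ ℚ))]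
  exact this

lemma root_eq (a : Fin m → ℤ) (t : ℤ) :
    (∏ i, (AdjoinRoot.root (pp a t) - (a i : AdjoinRoot (pp a t)))) * (AdjoinRoot.root (pp a t) - t) = 1 := by
  have h := AdjoinRoot.eval₂_root (pp a t)
  conv at h => lhs; arg 3; rw [pp]
  simp only [eval₂_sub, eval₂_mul, eval₂_finset_prod, eval₂_X, eval₂_C, eval₂_one] at h
  simp only [map_intCast] at h
  exact sub_eq_zero.1 h

lemma exists_units (hm : 0 < m) (a : Fin m → ℤ) (t : ℤ) [Fact (Irreducible (pp a t))] :
    ∃ e : Fin m → (𝓞 (AdjoinRoot (pp a t)))ˣ,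
      ∀ k, ((e k : 𝓞 (AdjoinRoot (pp a t))) : AdjoinRoot (pp a t)) = AdjoinRoot.root (pp a t) - a k := by
  have h1 : ∀ k : ℤ, IsIntegral ℤ (AdjoinRoot.root (pp a t) - (k : AdjoinRoot (pp a t))) := by
    intro k
    refine (root_integral hm a t).sub ?_
    simpa using (isIntegral_algebraMap (R := ℤ) (A := AdjoinRoot (pp a t)) (x := k))
  let o : ℤ → 𝓞 (AdjoinRoot (pp a t)) := fun k => ⟨_, h1 k⟩
  have ho : ∀ k, ((o k : 𝓞 (AdjoinRoot (pp a t))) : AdjoinRoot (pp a t)) = AdjoinRoot.root (pp a t) - (k : AdjoinRoot (pp a t)) := fun k => rfl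
  have hprod : (∏ i, o (a i)) * o t = 1 := by
    apply RingOfIntegers.ext
    have := root_eq a t
    simp only [← ho] at this
    rw [← map_prod (algebraMap (𝓞 (AdjoinRoot (pp a t))) (AdjoinRoot (pp a t))), ← map_mul] at this
    exact this.trans (map_one _).symm
  have hu : ∀ k, IsUnit (o (a k)) := by
    intro k
    have h2 : IsUnit (∏ i, o (a i)) := IsUnit.of_mul_eq_one _ hprod
    exact isUnit_of_dvd_unit (Finset.dvd_prod_of_mem (fun i => o (a i)) (Finset.mem_univ k)) h2
  exact ⟨fun k => (hu k).unit, fun k => ho (a k)⟩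

lemma lg_root (h : RD a y (t : ℝ)⁻¹ c0) [Fact (Irreducible (pp a t))] (u : (𝓞 (AdjoinRoot (pp a t)))ˣ) (k : Fin m)
    (hu : ((u : 𝓞 (AdjoinRoot (pp a t))) : AdjoinRoot (pp a t)) = AdjoinRoot.root (pp a t) - a k) (j) :
    lg (sg (pp a t) y (pp_map h)) j u = Real.log (y j - a k) := by
  unfold lg
  rw [hu, map_sub, sg_root, map_intCast]

lemma pp_index (hm : 0 < m) (h : RD a y (t : ℝ)⁻¹ c0) [Fact (Irreducible (pp a t))]
    (hG : Nonempty ((pp a t).Gal ≃* Equiv.Perm (Fin (m+1)))) (hL : m * c0 < Real.log (|(t:ℝ)|)) (hc0 : 0 ≤ c0)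
    {δ : ℝ} (hδ : 0 < δ)
    (hd : (2 * Real.exp δ) ^ ((m+1) * m) < |(NumberField.discr (AdjoinRoot (pp a t)) : ℝ)|)
    (H : Subgroup (𝓞 (AdjoinRoot (pp a t)))ˣ)
    (hH : ∀ u : (𝓞 (AdjoinRoot (pp a t)))ˣ, (∃ i, algebraMap _ (AdjoinRoot (pp a t)) (u : 𝓞 (AdjoinRoot (pp a t))) = AdjoinRoot.root (pp a t) - a i) → u ∈ H) :
    H.index ≠ 0 ∧ (H.index : ℝ) ≤ 2 * (2 * (m ^ 2 * (Real.log (|(t:ℝ)|) + c0)) / δ + 2) ^ (m + 1) := by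
  obtain ⟨e, he⟩ := exists_units hm a t
  have hre := sg_RE (pp a t) y (pp_map h) h.inj
  have ht2 := sg_T2 (pp a t) y (pp_map h) h.inj hG (by simp)
  have hm1 : (1:ℝ) ≤ m := by exact_mod_cast hm
  have hlog : Real.log (t:ℝ)⁻¹ = - Real.log (|(t:ℝ)|) := by rw [Real.log_inv, Real.log_abs]
  apply index_bound hm hre hδ ?_ e ?_ ?_ H (fun k => hH _ ⟨k, he k⟩)
  · intro u hu
    refine hre.sep2 ht2 (fun j => (hu j).le) ?_
    simpa using hd
  · intro i k
    rw [lg_root h _ k (he k)]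
    by_cases hik : k = i
    · subst hik
      have := abs_le.1 (h.l2 k)
      rw [hlog] at this
      rw [abs_le]
      constructor <;> nlinarith
    · have := h.l1 i k hik
      nlinarith
  · intro i
    have h1 : ∑ k ∈ Finset.univ.erase i, |lg (sg (pp a t) y (pp_map h)) (some i) (e k)| ≤ (m - 1) * c0 := by
      calc _ ≤ ∑ k ∈ Finset.univ.erase i, c0 := by
            refine Finset.sum_le_sum fun k hk => ?_
            rw [lg_root h _ k (he k)]
            exact h.l1 i k (Finset.ne_of_mem_erase hk)
        _ = (m - 1) * c0 := by
            rw [Finset.sum_const, Finset.card_erase_of_mem (Finset.mem_univ _), Finset.card_univ, Fintype.card_fin,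
              nsmul_eq_mul, Nat.cast_sub hm, Nat.cast_one]
    refine h1.trans_lt ?_
    rw [lg_root h _ i (he i)]
    have := abs_le.1 (h.l2 i)
    rw [hlog] at this
    have h3 := neg_le_abs (Real.log (y (some i) - a i))
    nlinarith
end
end

section
open Polynomial NumberField Filter Topology

/-- real parameter -/
noncomputable def ar {m : ℕ} (ℓ : ℕ) (a : Fin m → ℤ) (τ : ℝ) : ℝ := (-1) ^ m * (τ ^ ℓ - 1) / (∏ i, (a i : ℝ))

/-- integer parameter -/
noncomputable def tt {m : ℕ} (ℓ : ℕ) (a : Fin m → ℤ) (τ : ℤ) : ℤ := (-1) ^ m * ((τ ^ ℓ - 1) / ∏ i, a i)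

section
variable {m ℓ : ℕ} {a : Fin m → ℤ}

lemma tt_ar (hne : ∀ i, a i ≠ 0) {τ : ℤ} (hτ : (∏ i, a i) ∣ τ - 1) : ((tt ℓ a τ : ℤ) : ℝ) = ar ℓ a τ := by
  unfold tt ar
  have h1 : (∏ i, a i) ∣ τ ^ ℓ - 1 := hτ.trans (by simpa using sub_dvd_pow_sub_pow τ 1 ℓ)
  have h2 : ((∏ i, a i : ℤ) : ℝ) ≠ 0 := by exact_mod_cast Finset.prod_ne_zero_iff.2 fun i _ => hne i
  push_cast [Int.cast_div h1 h2]
  ring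

lemma ar_bounds (hℓ : 1 ≤ ℓ) (hne : ∀ i, a i ≠ 0) {τ : ℝ} (hτ : 2 ≤ |τ|) :
    |τ| / (2 * |∏ i, (a i : ℝ)|) ≤ |ar ℓ a τ| ∧ |ar ℓ a τ| ≤ 2 * |τ| ^ ℓ := by
  have hA : 1 ≤ |∏ i, (a i : ℝ)| := by
    have : 1 ≤ |∏ i, a i| := Int.one_le_abs (Finset.prod_ne_zero_iff.2 fun i _ => hne i)
    have h2 : (1:ℝ) ≤ ((|∏ i, a i| : ℤ) : ℝ) := by exact_mod_cast this
    simpa using h2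
  have h1 : |τ| ≤ |τ| ^ ℓ := le_self_pow₀ (by linarith) (by omega)
  have h2 : |τ ^ ℓ - 1| ≤ |τ| ^ ℓ + 1 := by
    have := abs_sub (τ ^ ℓ) 1
    rwa [abs_pow, abs_one] at this
  have h3 : |τ| ^ ℓ - 1 ≤ |τ ^ ℓ - 1| := by
    have := abs_sub_abs_le_abs_sub (τ ^ ℓ) 1
    rwa [abs_pow, abs_one] at this
  unfold ar
  rw [abs_div, abs_mul, abs_pow, abs_neg, abs_one, one_pow, one_mul]
  constructor
  · rw [div_le_div_iff₀ (by positivity) (by positivity)]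
    nlinarith
  · rw [div_le_iff₀ (by positivity)]
    nlinarith

lemma tau_data (hm : 0 < m) (hℓ : 1 ≤ ℓ) (ha : Function.Injective a) (hne : ∀ i, a i ≠ 0) :
    ∃ (Ξ : Option (Fin m) → ℝ → ℝ) (c0 T1 : ℝ), 0 ≤ c0 ∧ 2 ≤ T1 ∧
      (∀ i, AnalyticAt ℝ (Ξ (some i)) 0) ∧
      (∀ z, Ξ none z = z⁻¹ + ∑ i, (a i : ℝ) - ∑ i, Ξ (some i) z) ∧
      ∀ τ : ℝ, T1 ≤ |τ| → RD a (fun j => Ξ j (ar ℓ a τ)⁻¹) (ar ℓ a τ)⁻¹ c0 ∧ m * c0 < Real.log (|ar ℓ a τ|) ∧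
        Real.log (|ar ℓ a τ|) + c0 ≤ 2 * ℓ * Real.log (|τ|) ∧ 1 ≤ |ar ℓ a τ| ∧ |ar ℓ a τ| ≤ 2 * |τ| ^ ℓ := by
  obtain ⟨Ξ, c0, z0, hz0, hc0, h1, h2, h3⟩ := exists_rd hm a ha
  set A := |∏ i, (a i : ℝ)| with hA
  have hApos : 0 < A := by
    rw [hA, abs_pos]
    exact Finset.prod_ne_zero_iff.2 fun i _ => by exact_mod_cast hne i
  let M := 1 / z0 + Real.exp (m * c0) + 1
  have hM : 0 < M := by positivity
  refine ⟨Ξ, c0, max 2 (max (2 * A * M + 1) (2 * Real.exp c0)), hc0, le_max_left _ _, h1, h2, ?_⟩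
  intro τ hτ
  simp only [max_le_iff] at hτ
  obtain ⟨ht2, htM, htc⟩ := hτ
  obtain ⟨hb1, hb2⟩ := ar_bounds (a := a) hℓ hne ht2
  have hb3 : M < |ar ℓ a τ| := by
    refine lt_of_lt_of_le ?_ hb1
    rw [lt_div_iff₀ (by positivity)]
    linarith
  have hz : 0 < 1 / z0 := by positivity
  have he : 0 < Real.exp (m * c0) := Real.exp_pos _
  have hpos : 0 < |ar ℓ a τ| := hM.trans hb3
  refine ⟨h3 _ (inv_ne_zero (abs_pos.1 hpos)) ?_, ?_, ?_, by linarith, hb2⟩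
  · rw [abs_inv]
    apply inv_lt_of_inv_lt₀ hz0
    rw [inv_eq_one_div]; linarith
  · rw [Real.lt_log_iff_exp_lt hpos]; linarith
  · have h5 : Real.log (|ar ℓ a τ|) ≤ Real.log 2 + ℓ * Real.log (|τ|) := by
      rw [← Real.log_pow, ← Real.log_mul (by norm_num) (by positivity)]
      exact Real.log_le_log hpos hb2
    have h6 : Real.log 2 + c0 ≤ Real.log (|τ|) := by
      rw [← Real.log_exp c0, ← Real.log_mul (by norm_num) (by positivity)]
      exact Real.log_le_log (by positivity) htc
    have h7 : (1:ℝ) ≤ ℓ := by exact_mod_cast hℓ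
    have h8 : 0 ≤ Real.log (|τ|) := Real.log_nonneg (by linarith)
    nlinarith

lemma sep_ineq (hm : 0 < m) {r : ℝ} (hr : (2:ℝ) ^ ((m+1) * m * (m+3)) ≤ r) :
    (2 * Real.exp (1 / ((m+1) * m * (m+3) : ℝ) * Real.log r)) ^ ((m+1) * m) ≤ r ^ ((2:ℝ) / (((m + 1 : ℕ) : ℝ) + 2)) := by
  have hr0 : 0 < r := lt_of_lt_of_le (by positivity) hr
  have hlog : ((m+1) * m * (m+3) : ℝ) * Real.log 2 ≤ Real.log r := by
    have := Real.log_le_log (by positivity) hr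
    rw [Real.log_pow] at this
    push_cast at this
    exact this
  have hm0 : (0:ℝ) < m := by exact_mod_cast hm
  rw [Real.rpow_def_of_pos hr0]
  nth_rewrite 1 [← Real.exp_log (show (0:ℝ) < 2 by norm_num)]
  rw [← Real.exp_add, ← Real.exp_nat_mul, Real.exp_le_exp]
  push_cast
  have e1 : ((m + 1) * m : ℝ) * (Real.log 2 + 1 / ((m+1) * m * (m+3)) * Real.log r) =
    (((m+1) * m * (m+3) : ℝ) * Real.log 2 + Real.log r) / (m+3) := by field_simp
  rw [e1]
  have e2 : Real.log r * (2 / ((m:ℝ) + 1 + 2)) = (2 * Real.log r) / (m+3) := by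
    rw [show (m:ℝ) + 1 + 2 = m + 3 by ring]; ring
  rw [e2]
  gcongr
  linarith

lemma admissible (hm : 0 < m) (hℓ : 1 ≤ ℓ) (ha : Function.Injective a) (hne : ∀ i, a i ≠ 0) :
    ∃ N T0 : ℕ, Admissible (m+1) ℓ a N T0 := by
  obtain ⟨Ξ, c0, T1, hc0, hT1, -, -, h⟩ := tau_data (ℓ := ℓ) hm hℓ ha hne
  let κ : ℝ := 1 / ((m+1) * m * (m+3) : ℝ)
  have hm0 : (0:ℝ) < m := by exact_mod_cast hm
  have hκ : 0 < κ := by positivity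
  refine ⟨⌈2 * (4 * m^2 * ℓ / κ + 2) ^ (m+1)⌉₊, ⌈max T1 ((2:ℝ) ^ ((m+1) * m * (m+3)))⌉₊, ?_, ?_, ?_⟩
  · exact Nat.ceil_pos.2 (by positivity)
  · exact Nat.ceil_pos.2 (lt_of_lt_of_le (by linarith) (le_max_left _ _))
  · intro τ hτ hdvd hG hF hd
    have hτ' : max T1 ((2:ℝ) ^ ((m+1) * m * (m+3))) ≤ |(τ:ℝ)| := by
      refine (Nat.le_ceil _).trans ?_
      exact_mod_cast hτ
    rw [max_le_iff] at hτ'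
    obtain ⟨h1, h2⟩ := hτ'
    obtain ⟨hrd, h3, h4, h5, h6⟩ := h τ h1
    rw [← tt_ar hne hdvd] at hrd h3 h4 h5 h6
    have hlpos : 0 < Real.log (|(τ:ℝ)|) := Real.log_pos (by linarith)
    have hF' : Fact (Irreducible (pp a (tt ℓ a τ))) := hF
    have key := pp_index hm hrd hG h3 hc0 (δ := κ * Real.log (|(τ:ℝ)|)) (by positivity)
      (lt_of_le_of_lt (sep_ineq hm h2) hd) (abcUnitSubgroup (m+1) ℓ a τ)
      (fun u hu => Subgroup.subset_closure (Or.inr hu))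
    refine ⟨key.1, ?_⟩
    have h7 : 2 * (2 * (m ^ 2 * (Real.log (|(tt ℓ a τ:ℝ)|) + c0)) / (κ * Real.log (|(τ:ℝ)|)) + 2) ^ (m + 1) ≤
        2 * (4 * m^2 * ℓ / κ + 2) ^ (m+1) := by
      have h8 : 0 ≤ Real.log (|(tt ℓ a τ:ℝ)|) := Real.log_nonneg h5
      have : 2 * (m ^ 2 * (Real.log (|(tt ℓ a τ:ℝ)|) + c0)) / (κ * Real.log (|(τ:ℝ)|)) ≤ 4 * m^2 * ℓ / κ := by
        rw [div_le_div_iff₀ (by positivity) hκ]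
        have : (m:ℝ)^2 * (Real.log (|(tt ℓ a τ:ℝ)|) + c0) ≤ m^2 * (2 * ℓ * Real.log (|(τ:ℝ)|)) := by gcongr
        nlinarith
      gcongr
    have h9 := key.2.trans (h7.trans (Nat.le_ceil _))
    exact_mod_cast h9
end
end

section
open Polynomial NumberField Filter Topology
set_option synthInstance.maxHeartbeats 1000000
set_option maxHeartbeats 1000000

section
variable {m ℓ : ℕ} {a : Fin m → ℤ}

/-- packaged data -/
def TD {m : ℕ} (ℓ : ℕ) (a : Fin m → ℤ) (Ξ : Option (Fin m) → ℝ → ℝ) (c0 T1 : ℝ) : Prop :=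
  ∀ τ : ℝ, T1 ≤ |τ| → RD a (fun j => Ξ j (ar ℓ a τ)⁻¹) (ar ℓ a τ)⁻¹ c0 ∧ m * c0 < Real.log (|ar ℓ a τ|) ∧
        Real.log (|ar ℓ a τ|) + c0 ≤ 2 * ℓ * Real.log (|τ|) ∧ 1 ≤ |ar ℓ a τ| ∧ |ar ℓ a τ| ≤ 2 * |τ| ^ ℓ

variable {Ξ : Option (Fin m) → ℝ → ℝ} {c0 T1 : ℝ}

lemma disc_bound (hm : 0 < m) (hne : ∀ i, a i ≠ 0) (hc0 : 0 ≤ c0) (h : TD ℓ a Ξ c0 T1) :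
    ∃ C1 : ℝ, 0 < C1 ∧ ∀ τ : ℤ, T1 ≤ |(τ:ℝ)| → (∏ i, a i) ∣ τ - 1 → ∀ [Fact (Irreducible (pp a (tt ℓ a τ)))],
      |(NumberField.discr (AdjoinRoot (pp a (tt ℓ a τ))) : ℝ)| ≤ C1 * |(τ:ℝ)| ^ (2 * ℓ * m) := by
  let E : ℝ := Real.exp c0 + ∑ i, |(a i : ℝ)|
  let W : ℝ := 2 * E
  have hS : 0 ≤ ∑ i, |(a i : ℝ)| := Finset.sum_nonneg fun i _ => abs_nonneg _
  have hE1 : 1 ≤ E := by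
    have := Real.one_le_exp hc0
    simp only [E]; linarith
  have hW1 : 1 ≤ W := by simp only [W]; linarith
  refine ⟨(W ^ (m+1) * 2) ^ (2 * m), by positivity, ?_⟩
  intro τ hτ hdvd hF
  obtain ⟨hrd, h3, h4, h5, h6⟩ := h τ hτ
  rw [← tt_ar hne hdvd] at hrd h3 h4 h5 h6
  revert hF
  generalize tt ℓ a τ = t at *
  intro hF
  set y := fun j => Ξ j (t:ℝ)⁻¹ with hy
  have hre := sg_RE (pp a t) y (pp_map hrd) hrd.inj
  have hak : ∀ k, |(a k : ℝ)| ≤ ∑ i, |(a i : ℝ)| := fun k =>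
    Finset.single_le_sum (f := fun i => |(a i : ℝ)|) (fun i _ => abs_nonneg _) (Finset.mem_univ k)
  have ht0 : (t:ℝ) ≠ 0 := by
    intro h0; rw [h0, abs_zero] at h5; linarith
  have hlz : Real.log (t:ℝ)⁻¹ = - Real.log (|(t:ℝ)|) := by rw [Real.log_inv, Real.log_abs]
  have hb : ∀ x : ℝ, x ≠ 0 → ∀ B, Real.log x ≤ B → |x| ≤ Real.exp B := by
    intro x hx B hB
    rw [← Real.log_abs] at hB
    exact (Real.log_le_iff_le_exp (abs_pos.2 hx)).1 hB
  have hys : ∀ i, |y (some i)| ≤ E := by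
    intro i
    have h1 := hb _ (sub_ne_zero.2 (hrd.ne (some i) i)) c0 (by
      have := abs_le.1 (hrd.l2 i)
      rw [hlz] at this
      have h8 := Real.log_nonneg h5
      linarith [this.2])
    have h2 := hak i
    have h3 : |y (some i)| ≤ |y (some i) - a i| + |(a i : ℝ)| := by
      have := abs_add_le (y (some i) - a i) (a i); simpa using this
    simp only [E]; linarith
  have hyn : |y none| ≤ E * |(t:ℝ)| := by
    let k : Fin m := ⟨0, hm⟩
    have h1 := hb _ (sub_ne_zero.2 (hrd.ne none k)) (c0 + Real.log (|(t:ℝ)|)) (by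
      have := abs_le.1 (hrd.l3 k)
      rw [hlz] at this
      linarith [this.2])
    rw [Real.exp_add, Real.exp_log (by linarith)] at h1
    have h2 := hak k
    have h3 : |y none| ≤ |y none - a k| + |(a k : ℝ)| := by
      have := abs_add_le (y none - a k) (a k); simpa using this
    have h4 : (∑ i, |(a i : ℝ)|) * 1 ≤ (∑ i, |(a i : ℝ)|) * |(t:ℝ)| := by gcongr
    simp only [E]
    rw [add_mul]; linarith
  let w : Option (Fin m) → ℝ := fun j => j.elim (W * |(t:ℝ)|) (fun _ => W)
  have key := hre.disc_le (root_integral hm a t) (by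
    intro i j hij
    simp only [sg_root] at hij
    exact hrd.inj hij) w (by
    rintro (_ | i) (_ | j) hij
    · exact absurd rfl hij
    · rw [sg_root, sg_root]
      have := abs_sub (y none) (y (some j))
      have h2 := hys j
      simp only [w, Option.elim]
      have : |y none - y (some j)| ≤ W * |(t:ℝ)| := by
        have : E * 1 ≤ E * |(t:ℝ)| := by gcongr
        simp only [W]; linarith
      exact this.trans (le_mul_of_one_le_right (by positivity) hW1)
    · rw [sg_root, sg_root]
      have := abs_sub (y (some i)) (y none)
      have h2 := hys i
      simp only [w, Option.elim]
      have : |y (some i) - y none| ≤ W * |(t:ℝ)| := by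
        have : E * 1 ≤ E * |(t:ℝ)| := by gcongr
        simp only [W]; linarith
      exact this.trans (le_mul_of_one_le_left (by positivity) hW1)
    · rw [sg_root, sg_root]
      have := abs_sub (y (some i)) (y (some j))
      have h1 := hys i
      have h2 := hys j
      simp only [w, Option.elim]
      have : |y (some i) - y (some j)| ≤ W := by simp only [W]; linarith
      exact this.trans (le_mul_of_one_le_left (by positivity) hW1))
  rw [Fintype.prod_option] at key
  simp only [w, Option.elim, Finset.prod_const, Finset.card_univ, Fintype.card_option, Fintype.card_fin,
    Nat.add_sub_cancel] at key
  refine key.trans ?_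
  calc (W * |(t:ℝ)| * W ^ m) ^ (2 * m) ≤ (W * (2 * |(τ:ℝ)| ^ ℓ) * W ^ m) ^ (2 * m) := by gcongr
    _ = (W ^ (m+1) * 2) ^ (2 * m) * |(τ:ℝ)| ^ (2 * ℓ * m) := by
      rw [show W * (2 * |(τ:ℝ)| ^ ℓ) * W ^ m = (W ^ (m+1) * 2) * |(τ:ℝ)| ^ ℓ by ring, mul_pow, ← pow_mul]
      congr 2; ring

lemma tt_inj (hℓ : 1 ≤ ℓ) (hne : ∀ i, a i ≠ 0) {τ τ' : ℤ} (h0 : 0 ≤ τ) (h0' : 0 ≤ τ')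
    (hd : (∏ i, a i) ∣ τ - 1) (hd' : (∏ i, a i) ∣ τ' - 1) (h : tt ℓ a τ = tt ℓ a τ') : τ = τ' := by
  have h1 : ar ℓ a τ = ar ℓ a τ' := by rw [← tt_ar hne hd, ← tt_ar hne hd', h]
  unfold ar at h1
  have hA : (∏ i, (a i : ℝ)) ≠ 0 := Finset.prod_ne_zero_iff.2 fun i _ => by exact_mod_cast hne i
  rw [div_left_inj' hA] at h1
  have h2 := mul_left_cancel₀ (pow_ne_zero m (by norm_num : (-1:ℝ) ≠ 0)) h1
  have h3 : (τ:ℝ) ^ ℓ = (τ':ℝ) ^ ℓ := by linarith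
  have := (pow_left_inj₀ (by exact_mod_cast h0) (by exact_mod_cast h0') (by omega)).1 h3
  exact_mod_cast this

lemma mult (hm : 0 < m) (hℓ : 1 ≤ ℓ) (hne : ∀ i, a i ≠ 0) (hT1 : 2 ≤ T1) (hc0 : 0 ≤ c0) (h : TD ℓ a Ξ c0 T1)
    {T : ℝ} (S : Finset ℤ)
    (hS : ∀ τ ∈ S, T1 ≤ τ ∧ τ ≤ T ∧ (∏ i, a i) ∣ τ - 1) (hirr : ∀ τ ∈ S, Irreducible (pp a (tt ℓ a τ)))
    {K : Type*} [Field K] [NumberField K] {J : Type*} [Fintype J] (σ : J → K →+* ℝ)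
    (iso : ∀ τ ∈ S, Nonempty (AdjoinRoot (pp a (tt ℓ a τ)) ≃+* K))
    {δ : ℝ} (hδ : 0 < δ) (hs : ∀ u : (𝓞 K)ˣ, (∀ j, |lg σ j u| < δ) → u = 1 ∨ u = -1) (hT : 1 ≤ T) :
    (S.card : ℝ) ≤ 2 * (2 * (2 * ℓ * Real.log T) / δ + 2) ^ Fintype.card J := by
  classical
  let k0 : Fin m := ⟨0, hm⟩
  have key : ∀ τ ∈ S, ∃ u : (𝓞 K)ˣ, (∀ j, |lg σ j u| ≤ 2 * ℓ * Real.log T) ∧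
      ∃ x : K, ((u : 𝓞 K) : K) = x - a k0 ∧ (∏ i, (x - (a i : K))) * (x - (tt ℓ a τ : K)) = 1 := by
    intro τ hτ
    obtain ⟨ψ⟩ := iso τ hτ
    obtain ⟨h1, h2, h3⟩ := hS τ hτ
    have hF : Fact (Irreducible (pp a (tt ℓ a τ))) := ⟨hirr τ hτ⟩
    have hτ0 : (0:ℝ) ≤ τ := by linarith
    obtain ⟨hrd, h4, h5, h6, h7⟩ := h τ (by rwa [abs_of_nonneg hτ0])
    rw [abs_of_nonneg hτ0] at h5
    rw [← tt_ar hne h3] at hrd h4 h5 h6 h7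
    obtain ⟨e, he⟩ := exists_units hm a (tt ℓ a τ)
    let u : (𝓞 K)ˣ := Units.mapEquiv (RingOfIntegers.mapRingEquiv ψ).toMulEquiv (e k0)
    have hu : ((u : 𝓞 K) : K) = ψ ((e k0 : 𝓞 (AdjoinRoot (pp a (tt ℓ a τ)))) : AdjoinRoot (pp a (tt ℓ a τ))) := rfl
    refine ⟨u, ?_, ψ (AdjoinRoot.root _), ?_, ?_⟩
    · intro j
      have hre := sg_RE (pp a (tt ℓ a τ)) _ (pp_map hrd) hrd.inj
      obtain ⟨j', hj'⟩ := hre.2 (Complex.ofRealHom.comp ((σ j).comp (ψ : AdjoinRoot (pp a (tt ℓ a τ)) →+* K)))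
      have hj2 : ∀ x, sg (pp a (tt ℓ a τ)) _ (pp_map hrd) j' x = σ j (ψ x) := by
        intro x
        have := RingHom.congr_fun hj' x
        exact Complex.ofReal_injective this
      have h8 : lg σ j u = Real.log (Ξ j' (tt ℓ a τ : ℝ)⁻¹ - a k0) := by
        have h9 := lg_root hrd (e k0) k0 (he k0) j'
        rw [← h9]
        unfold lg
        rw [hu, hj2]
      rw [h8]
      have hlT : 2 * ℓ * Real.log τ ≤ 2 * ℓ * Real.log T := by
        have : Real.log τ ≤ Real.log T := Real.log_le_log (by linarith) h2
        gcongr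
      have hlz : Real.log (tt ℓ a τ:ℝ)⁻¹ = - Real.log (|(tt ℓ a τ:ℝ)|) := by rw [Real.log_inv, Real.log_abs]
      have h10 := Real.log_nonneg h6
      rcases j' with _ | i
      · have := abs_le.1 (hrd.l3 k0)
        rw [hlz] at this
        rw [abs_le]; constructor <;> linarith
      · by_cases hik : k0 = i
        · have := abs_le.1 (hrd.l2 i)
          rw [hlz] at this
          rw [hik]
          rw [abs_le]; constructor <;> linarith
        · have := hrd.l1 i k0 hik
          linarith
    · rw [hu, he, map_sub, map_intCast]
    · have := congrArg ψ (root_eq a (tt ℓ a τ))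
      simpa [map_prod] using this
  choose! u hu1 hu2 using key
  have hinj : Set.InjOn u S := by
    intro τ hτ τ' hτ' huu
    obtain ⟨x, hx1, hx2⟩ := hu2 τ hτ
    obtain ⟨x', hx1', hx2'⟩ := hu2 τ' hτ'
    have hxx : x = x' := by
      rw [huu, hx1'] at hx1
      exact (sub_left_inj.1 hx1).symm
    subst hxx
    have h9 : (∏ i, (x - (a i : K))) ≠ 0 := left_ne_zero_of_mul_eq_one hx2
    have h10 := mul_left_cancel₀ h9 (hx2.trans hx2'.symm)
    have h11 : (tt ℓ a τ : K) = tt ℓ a τ' := by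
      linear_combination -h10
    have h12 : tt ℓ a τ = tt ℓ a τ' := by exact_mod_cast h11
    obtain ⟨h1, h2, h3⟩ := hS τ hτ
    obtain ⟨h1', h2', h3'⟩ := hS τ' hτ'
    refine tt_inj hℓ hne ?_ ?_ h3 h3' h12
    · have : (0:ℝ) ≤ τ := by linarith
      exact_mod_cast this
    · have : (0:ℝ) ≤ τ' := by linarith
      exact_mod_cast this
  have hB : 0 ≤ 2 * ℓ * Real.log T := mul_nonneg (by positivity) (Real.log_nonneg hT)
  have := packing hδ hs hB (S.image u) (by
    intro v hv
    obtain ⟨τ, hτ, rfl⟩ := Finset.mem_image.1 hv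
    exact hu1 τ hτ)
  rwa [Finset.card_image_of_injOn hinj] at this
end
end

section
open Polynomial NumberField Filter Topology
set_option synthInstance.maxHeartbeats 1000000
set_option maxHeartbeats 1000000

lemma DZ_of_bound {B : Set ℕ} {C s : ℝ} (hs : s < 1) (h : ∀ T : ℕ, 1 ≤ T → (cnt B T : ℝ) ≤ C * (T:ℝ) ^ s) : DZ B := by
  intro ε hε
  have h1 : Tendsto (fun T : ℕ => C * (T:ℝ) ^ (-(1 - s))) atTop (𝓝 (C * 0)) :=
    ((tendsto_rpow_neg_atTop (by linarith)).comp tendsto_natCast_atTop_atTop).const_mul C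
  rw [mul_zero] at h1
  filter_upwards [h1.eventually (gt_mem_nhds hε), eventually_ge_atTop 1] with T hT hT1
  have hT0 : (0:ℝ) < T := by exact_mod_cast hT1
  refine (h T hT1).trans ?_
  have : (T:ℝ) ^ s = (T:ℝ) ^ (-(1-s)) * T := by
    rw [← Real.rpow_add_one hT0.ne']; congr 1; ring
  rw [this, ← mul_assoc]
  gcongr

lemma coeff_prod_le {J : Type*} (s : Finset J) (c : J → ℝ) (i : ℕ) :
    |(∏ j ∈ s, (X - C (c j))).coeff i| ≤ ∏ j ∈ s, (1 + |c j|) := by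
  classical
  induction s using Finset.induction_on generalizing i with
  | empty =>
    simp only [Finset.prod_empty, coeff_one]
    split_ifs <;> simp
  | insert j s hj ih =>
    rw [Finset.prod_insert hj, Finset.prod_insert hj, sub_mul, coeff_sub, coeff_C_mul, add_mul, one_mul]
    refine (abs_sub _ _).trans ?_
    rw [abs_mul]
    gcongr
    · cases i with
      | zero => simp only [coeff_X_mul_zero, abs_zero]; exact Finset.prod_nonneg fun j _ => by positivity
      | succ i => rw [coeff_X_mul]; exact ih i
    · exact ih i

open scoped NNReal ENNReal in
lemma mink_bound (K : Type*) [Field K] [NumberField K] {D : ℝ≥0} (hD : NNReal.sqrt ‖discr K‖₊ < D) :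
    mixedEmbedding.minkowskiBound K ↑1 < (D * 2 ^ Module.finrank ℚ K : ℝ≥0) := by
  rw [mixedEmbedding.minkowskiBound, mixedEmbedding.volume_fundamentalDomain_fractionalIdealLatticeBasis,
    Units.val_one, FractionalIdeal.absNorm_one, Rat.cast_one,
    ENNReal.ofReal_one, one_mul, mixedEmbedding.finrank, mixedEmbedding.volume_fundamentalDomain_latticeBasis]
  have h1 : ((2:ℝ≥0∞)⁻¹ ^ InfinitePlace.nrComplexPlaces K * (NNReal.sqrt ‖discr K‖₊ : ℝ≥0∞)) * 2 ^ Module.finrank ℚ K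
     ≤ (NNReal.sqrt ‖discr K‖₊ * 2 ^ Module.finrank ℚ K : ℝ≥0) := by
    rw [ENNReal.coe_mul, ENNReal.coe_pow, ENNReal.coe_ofNat]
    gcongr
    calc _ ≤ 1 * (NNReal.sqrt ‖discr K‖₊ : ℝ≥0∞) := by
          gcongr; exact pow_le_one₀ (by positivity) (by simp)
      _ = _ := one_mul _
  refine lt_of_le_of_lt h1 ?_
  rw [ENNReal.coe_lt_coe]
  gcongr

section
variable {K : Type*} [Field K] [NumberField K] {J : Type*} [Fintype J] {σ : J → K →+* ℝ}

open scoped NNReal ENNReal in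
lemma RE.mink (h : RE K σ) (j0 : J) {D : ℝ≥0} (hD : NNReal.sqrt ‖discr K‖₊ < D) :
    ∃ α : 𝓞 K, IntermediateField.adjoin ℚ {(α : K)} = ⊤ ∧ |σ j0 α| ≤ D * 2 ^ Fintype.card J ∧
      ∀ j, j ≠ j0 → |σ j α| ≤ 1 := by
  classical
  let w : J → InfinitePlace K := fun j => InfinitePlace.mk (Complex.ofRealHom.comp (σ j))
  have hw : ∀ j x, w j x = |σ j x| := by
    intro j x
    simp [w, InfinitePlace.apply]
  have hconj : ∀ j, ComplexEmbedding.IsReal (Complex.ofRealHom.comp (σ j)) := by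
    intro j
    rw [ComplexEmbedding.isReal_iff]
    ext x
    simp
  have hreal : ∀ j, (w j).IsReal := fun j => ⟨_, hconj j, rfl⟩
  have hwinj : Function.Injective w := by
    intro i j hij
    have := InfinitePlace.mk_eq_iff.1 hij
    rw [ComplexEmbedding.isReal_iff.1 (hconj i)] at this
    exact h.1 (or_self_iff.1 this)
  let B : ℝ≥0 := D * 2 ^ Module.finrank ℚ K
  have hv : mixedEmbedding.minkowskiBound K ↑1 < MeasureTheory.volume (mixedEmbedding.convexBodyLT K (fun v ↦ if v = w j0 then B else 1)) := by
    rw [mixedEmbedding.convexBodyLT_volume, ← Finset.prod_erase_mul _ _ (Finset.mem_univ (w j0))]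
    simp_rw [ite_pow, one_pow]
    rw [Finset.prod_ite_eq']
    simp_rw [Finset.notMem_erase, ite_false, InfinitePlace.mult, hreal j0, ite_true, one_mul, pow_one]
    refine lt_of_lt_of_le (mink_bound K hD) ?_
    calc ((B : ℝ≥0) : ℝ≥0∞) = 1 * B := (one_mul _).symm
      _ ≤ _ := by gcongr; exact_mod_cast mixedEmbedding.one_le_convexBodyLTFactor K
  obtain ⟨α, h0, hle⟩ := mixedEmbedding.exists_ne_zero_mem_ringOfIntegers_lt K hv
  refine ⟨α, ?_, ?_, ?_⟩
  · exact is_primitive_element_of_infinitePlace_lt h0 (w := w j0)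
      (fun v hne ↦ by have := hle v; rw [if_neg hne] at this; exact_mod_cast this) (Or.inl (hreal j0))
  · have := hle (w j0)
    rw [if_pos rfl, hw] at this
    rw [h.card]
    simpa [B] using this.le
  · intro j hj
    have := hle (w j)
    rw [if_neg (fun h => hj (hwinj h)), hw] at this
    simpa using this.le

lemma RE.code (h : RE K σ) (j0 : J) {D : ℝ} (hD : Real.sqrt |(discr K : ℝ)| < D) :
    ∃ P : ℤ[X], P.natDegree = Fintype.card J ∧ (∀ i, |(P.coeff i : ℝ)| ≤ (1 + D * 2 ^ Fintype.card J) * 2 ^ (Fintype.card J - 1)) ∧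
      Nonempty (K ≃+* AdjoinRoot (P.map (algebraMap ℤ ℚ))) := by
  classical
  have hD0 : 0 ≤ D := (Real.sqrt_nonneg _).trans hD.le
  lift D to NNReal using hD0
  obtain ⟨α, hα, h1, h2⟩ := h.mink j0 (D := D) (by
    rw [← NNReal.coe_lt_coe]
    simpa [Int.norm_eq_abs] using hD)
  have hint : IsIntegral ℤ (α : K) := α.isIntegral_coe
  have hintQ : IsIntegral ℚ (α : K) := hint.tower_top
  have hmp := minpoly.isIntegrallyClosed_eq_field_fractions' ℚ hint
  have hdeg : (minpoly ℚ (α : K)).natDegree = Fintype.card J := by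
    rw [h.card, ← IntermediateField.adjoin.finrank hintQ, hα, IntermediateField.finrank_top']
  have hinj : Function.Injective (fun j => σ j α) := by
    intro i j hij
    apply h.equiv.injective
    have : ∀ x : K, x ∈ IntermediateField.adjoin ℚ {(α : K)} → h.equiv i x = h.equiv j x := by
      intro x hx
      have hle : IntermediateField.adjoin ℚ {(α : K)} ≤
          IntermediateField.mk (AlgHom.equalizer (h.equiv i) (h.equiv j)) (fun x hx => by
            have hx' : h.equiv i x = h.equiv j x := hx
            change h.equiv i x⁻¹ = h.equiv j x⁻¹
            rw [map_inv₀, map_inv₀, hx']) := by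
        rw [IntermediateField.adjoin_simple_le_iff]
        change h.equiv i (α : K) = h.equiv j (α : K)
        rw [RE.equiv_apply, RE.equiv_apply]
        exact congrArg _ hij
      exact hle hx
    ext x
    exact this x (by rw [hα]; trivial)
  have hprod : (minpoly ℚ (α : K)).map (algebraMap ℚ ℝ) = ∏ j, (X - C (σ j α)) := by
    apply eq_of_monic_of_dvd_of_natDegree_le
    · exact monic_prod_of_monic _ _ fun j _ => monic_X_sub_C _
    · exact (minpoly.monic hintQ).map _
    · apply Finset.prod_dvd_of_coprime
      · intro i _ j _ hij
        exact isCoprime_X_sub_C_of_isUnit_sub (by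
          rw [isUnit_iff_ne_zero, sub_ne_zero]; exact fun h => hij (hinj h))
      · intro j _
        rw [dvd_iff_isRoot, IsRoot, eval_map]
        have := congrArg (σ j) (minpoly.aeval ℚ (α : K))
        rw [aeval_def, hom_eval₂, map_zero] at this
        rwa [Subsingleton.elim (algebraMap ℚ ℝ) ((σ j).comp (algebraMap ℚ K))]
    · rw [(minpoly.monic hintQ).natDegree_map, hdeg, natDegree_prod_of_monic _ _ (fun j _ => monic_X_sub_C _)]
      simp
  refine ⟨minpoly ℤ (α : K), ?_, ?_, ?_⟩
  · rw [← hdeg, hmp, (minpoly.monic hint).natDegree_map]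
  · intro i
    have h3 := coeff_prod_le Finset.univ (fun j => σ j α) i
    rw [← hprod, hmp, coeff_map, coeff_map] at h3
    have h4 : |((minpoly ℤ (α : K)).coeff i : ℝ)| ≤ ∏ j, (1 + |σ j α|) := by simpa using h3
    refine h4.trans ?_
    rw [← Finset.mul_prod_erase _ _ (Finset.mem_univ j0)]
    gcongr
    calc ∏ j ∈ Finset.univ.erase j0, (1 + |σ j α|) ≤ ∏ j ∈ Finset.univ.erase j0, 2 := by
          refine Finset.prod_le_prod (fun j _ => by positivity) (fun j hj => ?_)
          have := h2 j (Finset.ne_of_mem_erase hj)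
          linarith
      _ = _ := by rw [Finset.prod_const, Finset.card_erase_of_mem (Finset.mem_univ _), Finset.card_univ]
  · rw [← hmp]
    exact ⟨((IntermediateField.adjoinRootEquivAdjoin ℚ hintQ).trans
      ((IntermediateField.equivOfEq hα).trans IntermediateField.topEquiv)).symm.toRingEquiv⟩
end
end

section
open Polynomial NumberField Filter Topology
set_option synthInstance.maxHeartbeats 1000000
set_option maxHeartbeats 1000000

/-- small discriminant set -/
def B3 {m : ℕ} (ℓ : ℕ) (a : Fin m → ℤ) (T1 : ℝ) : Set ℕ :=
  {τ | T1 ≤ τ ∧ (∏ i, a i) ∣ (τ:ℤ) - 1 ∧ ∃ _ : Fact (Irreducible (pp a (tt ℓ a τ))),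
    |(discr (AdjoinRoot (pp a (tt ℓ a τ))) : ℝ)| ≤ (τ:ℝ) ^ ((2:ℝ) / (((m + 1 : ℕ) : ℝ) + 2))}

section
variable {m ℓ : ℕ} {a : Fin m → ℤ} {Ξ : Option (Fin m) → ℝ → ℝ} {c0 T1 : ℝ}

lemma B3_code (hm : 0 < m) (hne : ∀ i, a i ≠ 0) (hT1 : 2 ≤ T1) (h : TD ℓ a Ξ c0 T1) {T τ : ℕ} (hτ : τ ∈ B3 ℓ a T1)
    (hT : τ < T) :
    ∃ P : ℤ[X], P.natDegree = m + 1 ∧ (∀ i, |P.coeff i| ≤ ⌊(4 ^ (m+2) : ℝ) * (T:ℝ) ^ ((1:ℝ) / (m+3))⌋) ∧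
      Nonempty (AdjoinRoot (pp a (tt ℓ a τ)) ≃+* AdjoinRoot (P.map (algebraMap ℤ ℚ))) := by
  obtain ⟨h1, h2, hF, h3⟩ := hτ
  obtain ⟨hrd, -⟩ := h τ (by rwa [abs_of_nonneg (by positivity)])
  have hc : ((τ:ℤ):ℝ) = τ := by norm_cast
  rw [← hc, ← tt_ar hne h2] at hrd
  have hre := sg_RE (pp a (tt ℓ a τ)) _ (pp_map hrd) hrd.inj
  have hτ0 : (0:ℝ) < τ := by linarith
  have hτT : (τ:ℝ) < T := by exact_mod_cast hT
  have hT1' : (1:ℝ) ≤ (T:ℝ) ^ ((1:ℝ) / (m+3)) := Real.one_le_rpow (by linarith) (by positivity)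
  have hD : Real.sqrt |(discr (AdjoinRoot (pp a (tt ℓ a τ))) : ℝ)| < (T:ℝ) ^ ((1:ℝ) / (m+3)) := by
    calc _ ≤ Real.sqrt ((τ:ℝ) ^ ((2:ℝ) / (((m + 1 : ℕ) : ℝ) + 2))) := Real.sqrt_le_sqrt h3
      _ = (τ:ℝ) ^ ((1:ℝ) / (m+3)) := by
        rw [Real.sqrt_eq_rpow, ← Real.rpow_mul hτ0.le]
        congr 1
        push_cast
        rw [show (m:ℝ) + 1 + 2 = m + 3 by ring]; ring
      _ < _ := Real.rpow_lt_rpow hτ0.le hτT (by positivity)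
  obtain ⟨P, hP1, hP2, hP3⟩ := hre.code none hD
  simp only [Fintype.card_option, Fintype.card_fin, Nat.add_sub_cancel] at hP1 hP2
  refine ⟨P, hP1, fun i => ?_, hP3⟩
  rw [Int.le_floor]
  have := hP2 i
  push_cast
  refine this.trans ?_
  have e1 : (1 + (T:ℝ) ^ ((1:ℝ) / (m+3)) * 2 ^ (m+1)) ≤ (T:ℝ) ^ ((1:ℝ) / (m+3)) * 2 ^ (m+2) := by
    have : (1:ℝ) ≤ 2 ^ (m+1) := one_le_pow₀ (by norm_num)
    rw [pow_succ 2 (m+1)]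
    nlinarith
  calc _ ≤ ((T:ℝ) ^ ((1:ℝ) / (m+3)) * 2 ^ (m+2)) * 2 ^ (m+2) := by
        gcongr
        · norm_num
        · omega
    _ = _ := by rw [mul_assoc, ← mul_pow, mul_comm]; norm_num

lemma DZ_B3 (hm : 0 < m) (hℓ : 1 ≤ ℓ) (hne : ∀ i, a i ≠ 0) (hT1 : 2 ≤ T1) (hc0 : 0 ≤ c0) (h : TD ℓ a Ξ c0 T1) :
    DZ (B3 ℓ a T1) := by
  classical
  let κ : ℝ := 1 / (2 * (m+3) * (m+1))
  have hκ : 0 < κ := by positivity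
  have hl32 : 0 < Real.log (3/2) := Real.log_pos (by norm_num)
  let C3 : ℝ := 2 * (2 * (2 * ℓ * κ⁻¹) / Real.log (3/2) + 2) ^ (m+1)
  let C2 : ℝ := (2 * 4 ^ (m+2) + 1) ^ (m+2)
  refine DZ_of_bound (C := C2 * C3) (s := 1 - 1 / (2 * (m+3))) (by
    have : (0:ℝ) < 1 / (2 * (m+3)) := by positivity
    linarith) ?_
  intro T hT
  have hT1' : (1:ℝ) ≤ T := by exact_mod_cast hT
  have hT0 : (0:ℝ) < T := by linarith
  set S : Finset ℕ := (Finset.range T).filter (· ∈ B3 ℓ a T1) with hS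
  have hcode : ∀ τ ∈ S, ∃ P : ℤ[X], P.natDegree = m + 1 ∧ (∀ i, |P.coeff i| ≤ ⌊(4 ^ (m+2) : ℝ) * (T:ℝ) ^ ((1:ℝ) / (m+3))⌋) ∧
      Nonempty (AdjoinRoot (pp a (tt ℓ a τ)) ≃+* AdjoinRoot (P.map (algebraMap ℤ ℚ))) := by
    intro τ hτ
    rw [hS, Finset.mem_filter, Finset.mem_range] at hτ
    exact B3_code hm hne hT1 h hτ.2 hτ.1
  choose! P hP1 hP2 hP3 using hcode
  set F := ⌊(4 ^ (m+2) : ℝ) * (T:ℝ) ^ ((1:ℝ) / (m+3))⌋ with hF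
  let code : ℕ → (Fin (m+2) → ℤ) := fun τ i => (P τ).coeff i
  let box : Finset (Fin (m+2) → ℤ) := Fintype.piFinset fun _ => Finset.Icc (-F) F
  have hmap : ∀ τ ∈ S, code τ ∈ box := by
    intro τ hτ
    simp only [box, Fintype.mem_piFinset, Finset.mem_Icc]
    intro i
    exact abs_le.1 (hP2 τ hτ i)
  have hfib : ∀ v ∈ box, (((S.filter fun τ => code τ = v).card : ℕ) : ℝ) ≤ C3 * (T:ℝ) ^ (1 / (2 * (m+3)) : ℝ) := by
    intro v _
    rcases (S.filter fun τ => code τ = v).eq_empty_or_nonempty with he | ⟨τ0, hτ0⟩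
    · rw [he]; simp only [Finset.card_empty, Nat.cast_zero]; positivity
    · rw [Finset.mem_filter] at hτ0
      have hτ0B : τ0 ∈ B3 ℓ a T1 := (Finset.mem_filter.1 hτ0.1).2
      obtain ⟨g1, g2, gF, g3⟩ := hτ0B
      obtain ⟨hrd, -⟩ := h τ0 (by rwa [abs_of_nonneg (by positivity)])
      have hc : ((τ0:ℤ):ℝ) = τ0 := by norm_cast
      rw [← hc, ← tt_ar hne g2] at hrd
      have hre := sg_RE (pp a (tt ℓ a τ0)) _ (pp_map hrd) hrd.inj
      have hmem : ∀ τ ∈ (S.filter fun τ => code τ = v).image (Nat.cast : ℕ → ℤ), ∃ k ∈ S, code k = v ∧ (k:ℤ) = τ := by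
        intro τ hτ
        obtain ⟨k, hk, rfl⟩ := Finset.mem_image.1 hτ
        rw [Finset.mem_filter] at hk
        exact ⟨k, hk.1, hk.2, rfl⟩
      have key := mult hm hℓ hne hT1 hc0 h (T := T) ((S.filter fun τ => code τ = v).image (Nat.cast : ℕ → ℤ))
        (by
          intro τ hτ
          obtain ⟨k, hk, -, rfl⟩ := hmem τ hτ
          rw [hS, Finset.mem_filter, Finset.mem_range] at hk
          refine ⟨by exact_mod_cast hk.2.1, by exact_mod_cast hk.1.le, hk.2.2.1⟩)
        (by
          intro τ hτ
          obtain ⟨k, hk, -, rfl⟩ := hmem τ hτ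
          rw [hS, Finset.mem_filter] at hk
          obtain ⟨-, -, -, hF, -⟩ := hk
          exact hF.out)
        (sg (pp a (tt ℓ a τ0)) _ (pp_map hrd))
        (by
          intro τ hτ
          obtain ⟨k, hk, hkv, rfl⟩ := hmem τ hτ
          have hPP : P k = P τ0 := by
            apply Polynomial.ext
            intro i
            by_cases hi : i < m + 2
            · have := congrFun (hkv.trans hτ0.2.symm) ⟨i, hi⟩
              exact this
            · rw [coeff_eq_zero_of_natDegree_lt, coeff_eq_zero_of_natDegree_lt]
              · rw [hP1 τ0 hτ0.1]; omega
              · rw [hP1 k hk]; omega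
          obtain ⟨e1⟩ := hP3 k hk
          obtain ⟨e2⟩ := hP3 τ0 hτ0.1
          rw [hPP] at e1
          exact ⟨e1.trans e2.symm⟩)
        hl32 (fun u hu => hre.sep1 hu) hT1'
      rw [Finset.card_image_of_injective _ Nat.cast_injective] at key
      refine key.trans ?_
      simp only [Fintype.card_option, Fintype.card_fin]
      have hlog : Real.log T ≤ κ⁻¹ * (T:ℝ) ^ κ := by
        have := Real.log_le_rpow_div hT0.le hκ
        rwa [div_eq_inv_mul] at this
      have hTk : (1:ℝ) ≤ (T:ℝ) ^ κ := Real.one_le_rpow hT1' hκ.le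
      have e3 : 2 * (2 * ℓ * Real.log T) / Real.log (3/2) + 2 ≤ (2 * (2 * ℓ * κ⁻¹) / Real.log (3/2) + 2) * (T:ℝ) ^ κ := by
        rw [add_mul]
        have : 2 * (2 * ℓ * Real.log T) / Real.log (3/2) ≤ 2 * (2 * ℓ * κ⁻¹) / Real.log (3/2) * (T:ℝ) ^ κ := by
          calc _ ≤ 2 * (2 * ℓ * (κ⁻¹ * (T:ℝ) ^ κ)) / Real.log (3/2) := by gcongr
            _ = _ := by ring
        linarith
      have hlT : 0 ≤ Real.log T := Real.log_nonneg hT1'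
      calc _ ≤ 2 * ((2 * (2 * ℓ * κ⁻¹) / Real.log (3/2) + 2) * (T:ℝ) ^ κ) ^ (m+1) := by
            gcongr
        _ = C3 * (T:ℝ) ^ (1 / (2 * (m+3)) : ℝ) := by
            rw [mul_pow, ← Real.rpow_natCast ((T:ℝ) ^ κ), ← Real.rpow_mul hT0.le, ← mul_assoc]
            congr 2
            simp only [κ]
            push_cast
            field_simp
  have h1 : ((S.card : ℕ) : ℝ) = ∑ v ∈ box, (((S.filter fun τ => code τ = v).card : ℕ) : ℝ) := by
    rw [Finset.card_eq_sum_card_fiberwise hmap]; push_cast; rfl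
  have h2 : (cnt (B3 ℓ a T1) T : ℝ) = S.card := by
    unfold cnt
    congr!
  rw [h2, h1]
  have hF0 : (0:ℤ) ≤ F := by rw [hF]; positivity
  have hbox : (box.card : ℝ) ≤ C2 * (T:ℝ) ^ ((m+2) / (m+3) : ℝ) := by
    have : box.card = (2 * F + 1).toNat ^ (m+2) := by
      simp only [box, Fintype.card_piFinset, Int.card_Icc, Finset.prod_const, Finset.card_univ, Fintype.card_fin]
      congr 2; ring
    rw [this]
    push_cast
    have h3 : (((2 * F + 1).toNat : ℕ) : ℝ) = 2 * F + 1 := by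
      have : (((2 * F + 1).toNat : ℤ)) = 2 * F + 1 := Int.toNat_of_nonneg (by omega)
      exact_mod_cast this
    rw [h3]
    have h4 : (F:ℝ) ≤ (4 ^ (m+2) : ℝ) * (T:ℝ) ^ ((1:ℝ) / (m+3)) := Int.floor_le _
    have hTk : (1:ℝ) ≤ (T:ℝ) ^ ((1:ℝ) / (m+3)) := Real.one_le_rpow hT1' (by positivity)
    have hF0' : (0:ℝ) ≤ F := by exact_mod_cast hF0
    calc (2 * (F:ℝ) + 1) ^ (m+2) ≤ ((2 * 4 ^ (m+2) + 1) * (T:ℝ) ^ ((1:ℝ) / (m+3))) ^ (m+2) := by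
          gcongr
          rw [add_mul]; linarith
      _ = _ := by
          rw [mul_pow, ← Real.rpow_natCast ((T:ℝ) ^ _), ← Real.rpow_mul hT0.le]
          congr 2
          push_cast
          field_simp
  calc _ ≤ ∑ v ∈ box, C3 * (T:ℝ) ^ (1 / (2 * (m+3)) : ℝ) := Finset.sum_le_sum hfib
    _ = box.card * (C3 * (T:ℝ) ^ (1 / (2 * (m+3)) : ℝ)) := by rw [Finset.sum_const, nsmul_eq_mul]
    _ ≤ (C2 * (T:ℝ) ^ ((m+2) / (m+3) : ℝ)) * (C3 * (T:ℝ) ^ (1 / (2 * (m+3)) : ℝ)) := by gcongr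
    _ = C2 * C3 * ((T:ℝ) ^ ((m+2) / (m+3) : ℝ) * (T:ℝ) ^ (1 / (2 * (m+3)) : ℝ)) := by ring
    _ = _ := by
      rw [← Real.rpow_add hT0]
      congr 2
      field_simp
      ring
end
end

section
open Polynomial NumberField Filter Topology
set_option synthInstance.maxHeartbeats 1000000
set_option maxHeartbeats 1000000

section
variable {m ℓ : ℕ} {a : Fin m → ℤ}

lemma EE_ar_inv (hℓ : 1 ≤ ℓ) (hne : ∀ i, a i ≠ 0) {F : ℝ → ℝ} (hF : AnalyticAt ℝ F 0) :
    (fun τ => F (ar ℓ a τ)⁻¹) ∈ EE 1 one_pos := by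
  let H : ℝ → ℝ := fun u => (-1) ^ m * (∏ i, (a i : ℝ)) * u ^ ℓ / (1 - u ^ ℓ)
  have hH : AnalyticAt ℝ H 0 := by
    refine AnalyticAt.div ?_ ?_ ?_
    · fun_prop
    · fun_prop
    · rw [zero_pow (by omega)]; norm_num
  have hH0 : H 0 = 0 := by simp only [H]; rw [zero_pow (by omega)]; simp
  have h1 := EE_analytic (N := 1) (hN := one_pos) (F := F ∘ H) (AnalyticAt.comp (by rw [hH0]; exact hF) hH)
  refine EE_congr h1 ?_
  filter_upwards [eventually_gt_atTop (1:ℝ)] with τ hτ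
  simp only [Function.comp, H]
  congr 1
  have hu : uu 1 τ = τ⁻¹ := by simpa using uu_pow (ν := 1) one_pos (by linarith : (0:ℝ) < τ)
  rw [hu, ar]
  have hA : (∏ i, (a i : ℝ)) ≠ 0 := Finset.prod_ne_zero_iff.2 fun i _ => by exact_mod_cast hne i
  have h2 : (1:ℝ) < τ ^ ℓ := one_lt_pow₀ hτ (by omega)
  have h3 : τ ^ ℓ - 1 ≠ 0 := by linarith
  have h4 : τ ^ ℓ ≠ 0 := by linarith
  have hs : ((-1:ℝ) ^ m) * (-1) ^ m = 1 := by rw [← mul_pow]; simp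
  have hs0 : ((-1:ℝ) ^ m) ≠ 0 := by positivity
  rw [inv_pow]
  have h5 : 1 - (τ ^ ℓ)⁻¹ = (τ ^ ℓ - 1) / τ ^ ℓ := by field_simp
  rw [h5]
  field_simp
  rw [pow_two] <;> linear_combination (-(1:ℝ)) * hs

noncomputable def arP (ℓ : ℕ) (a : Fin m → ℤ) : ℚ[X] :=
  C ((-1) ^ m / ∏ i, (a i : ℚ)) * (X ^ ℓ - 1)

lemma arP_eval (τ : ℝ) : aeval τ (arP ℓ a) = ar ℓ a τ := by
  simp only [arP, ar, map_mul, map_sub, map_pow, aeval_X, map_one, aeval_C]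
  simp
  ring

variable {Ξ : Option (Fin m) → ℝ → ℝ} {c0 T1 : ℝ}

lemma EE_xi (hℓ : 1 ≤ ℓ) (hne : ∀ i, a i ≠ 0) (hΞ : ∀ i, AnalyticAt ℝ (Ξ (some i)) 0)
    (hΞn : ∀ z, Ξ none z = z⁻¹ + ∑ i, (a i : ℝ) - ∑ i, Ξ (some i) z) (j : Option (Fin m)) :
    (fun τ => Ξ j (ar ℓ a τ)⁻¹) ∈ EE 1 one_pos := by
  cases j with
  | some i => exact EE_ar_inv hℓ hne (hΞ i)
  | none =>
    have h1 := poly_mem_EE (one_pos) (arP ℓ a)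
    have h2 := const_mem_EE (one_pos) (∑ i, (a i : ℝ))
    have h3 := Subring.sum_mem (EE 1 one_pos) (t := Finset.univ) (f := fun i => (fun τ => Ξ (some i) (ar ℓ a τ)⁻¹))
      fun i _ => EE_ar_inv hℓ hne (hΞ i)
    have := Subring.sub_mem _ (Subring.add_mem _ h1 h2) h3
    convert this using 1
    ext τ
    simp [hΞn, arP_eval]

/-- germs -/
noncomputable def GG : Subring (Germ (atTop : Filter ℝ) ℝ) := (EE 1 one_pos).map (Germ.coeRingHom atTop)

lemma GG_mem {g : ℝ → ℝ} (hg : g ∈ EE 1 one_pos) : (g : Germ (atTop : Filter ℝ) ℝ) ∈ GG :=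
  ⟨g, hg, rfl⟩

instance : IsDomain GG := by
  have : Nontrivial GG := by infer_instance
  have : NoZeroDivisors GG := by
    constructor
    rintro ⟨_, f, hf, rfl⟩ ⟨_, g, hg, rfl⟩ h
    have h1 : ((f * g : ℝ → ℝ) : Germ (atTop : Filter ℝ) ℝ) = ((0 : ℝ → ℝ) : Germ (atTop : Filter ℝ) ℝ) := congrArg Subtype.val h
    rw [Germ.coe_eq] at h1
    have h2 : ∀ᶠ x : ℕ in atTop, f x = 0 ∨ g x = 0 := by
      have := tendsto_natCast_atTop_atTop (R := ℝ) |>.eventually h1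
      filter_upwards [this] with x hx
      simpa using hx
    have h3 := h2.frequently
    rw [frequently_or_distrib] at h3
    rcases h3 with h3 | h3
    · left
      obtain ⟨K, hK⟩ := hf
      have := hK.eventually_eq_of_frequently one_pos h3
      apply Subtype.ext
      exact Germ.coe_eq.2 this
    · right
      obtain ⟨K, hK⟩ := hg
      have := hK.eventually_eq_of_frequently one_pos h3
      apply Subtype.ext
      exact Germ.coe_eq.2 this
  exact NoZeroDivisors.to_isDomain _

abbrev GF := FractionRing GG

noncomputable def polyGG : ℚ[X] →+* GG where
  toFun P := ⟨((fun τ : ℝ => aeval τ P : ℝ → ℝ) : Germ (atTop : Filter ℝ) ℝ), GG_mem (poly_mem_EE one_pos P)⟩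
  map_one' := by apply Subtype.ext; simp; rfl
  map_zero' := by apply Subtype.ext; simp; rfl
  map_add' p q := by apply Subtype.ext; simp; rfl
  map_mul' p q := by apply Subtype.ext; simp; rfl

lemma poly_zero_of_eventually {P : ℚ[X]} (h : ∀ᶠ τ : ℝ in atTop, aeval τ P = 0) : P = 0 := by
  have h2 : P.map (algebraMap ℚ ℝ) = 0 := by
    apply Polynomial.eq_zero_of_infinite_isRoot
    obtain ⟨T, hT⟩ := eventually_atTop.1 h
    refine (Set.Ici_infinite T).mono ?_
    intro x hx
    have := hT x hx
    simpa [IsRoot, aeval_def, eval_map] using this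
  exact (Polynomial.map_eq_zero _).1 h2

lemma polyGG_inj : Function.Injective polyGG := by
  rw [injective_iff_map_eq_zero]
  intro P hP
  have h1 : ((fun τ : ℝ => aeval τ P : ℝ → ℝ) : Germ (atTop : Filter ℝ) ℝ) = ((0 : ℝ → ℝ) : Germ (atTop : Filter ℝ) ℝ) :=
    congrArg Subtype.val hP
  exact poly_zero_of_eventually (Germ.coe_eq.1 h1)

noncomputable def ratGF : RatFunc ℚ →+* GF :=
  IsFractionRing.lift (A := ℚ[X]) (K := RatFunc ℚ) (g := (algebraMap GG GF).comp polyGG)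
    ((IsFractionRing.injective GG GF).comp polyGG_inj)

noncomputable instance : Algebra (RatFunc ℚ) GF := ratGF.toAlgebra

lemma ratGF_poly (P : ℚ[X]) : algebraMap (RatFunc ℚ) GF (algebraMap ℚ[X] (RatFunc ℚ) P) = algebraMap GG GF (polyGG P) := by
  change ratGF _ = _
  exact IsFractionRing.lift_algebraMap (A := ℚ[X]) (K := RatFunc ℚ) (g := (algebraMap GG GF).comp polyGG)
    ((IsFractionRing.injective GG GF).comp polyGG_inj) P
end
end

section
open Polynomial NumberField Filter Topology
set_option synthInstance.maxHeartbeats 1000000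
set_option maxHeartbeats 1000000

section
variable {m ℓ : ℕ} {a : Fin m → ℤ}
variable {Ξ : Option (Fin m) → ℝ → ℝ} {c0 T1 : ℝ}

noncomputable def polyFun : ℚ[X] →+* (ℝ → ℝ) := Pi.ringHom fun τ : ℝ => (aeval τ : ℚ[X] →ₐ[ℚ] ℝ).toRingHom

lemma polyFun_apply (P : ℚ[X]) (τ : ℝ) : polyFun P τ = aeval τ P := rfl

lemma polyFun_GG : GG.subtype.comp polyGG = (Germ.coeRingHom atTop).comp polyFun := rfl

abbrev evR (τ : ℝ) : (ℝ → ℝ) →+* ℝ := Pi.evalRingHom (fun _ : ℝ => ℝ) τ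

lemma germ_poly {p q : (ℝ → ℝ)[X]} (h : ∀ᶠ τ in atTop, p.map (evR τ) = q.map (evR τ)) :
    p.map (Germ.coeRingHom (atTop : Filter ℝ)) = q.map (Germ.coeRingHom (atTop : Filter ℝ)) := by
  ext k
  rw [coeff_map, coeff_map]
  refine Germ.coe_eq.2 ?_
  filter_upwards [h] with τ hτ
  have := congrArg (fun r => coeff r k) hτ
  simpa [coeff_map] using this

/-- generic polynomial -/
noncomputable def gp (ℓ : ℕ) (a : Fin m → ℤ) : ℚ[X][X] :=
  (∏ i, (X - C (C (a i : ℚ)))) * (X - C (arP ℓ a)) - 1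

lemma gp_main : (gp ℓ a).map (algebraMap ℚ[X] (RatFunc ℚ)) = mainPoly (m+1) ℓ a := by
  simp only [gp, mainPoly, arP, Polynomial.map_sub, Polynomial.map_mul, Polynomial.map_prod, map_X, map_C, Polynomial.map_one]
  congr 2
  · refine Finset.prod_congr rfl fun i _ => ?_
    simp
  · congr 2
    simp only [map_mul, map_sub, map_pow, map_one, RatFunc.algebraMap_X, map_div₀, map_prod]
    simp
    ring

lemma gp_ev (τ : ℝ) : ((gp ℓ a).map polyFun).map (evR τ) = (∏ i, (X - C (a i : ℝ))) * (X - C (ar ℓ a τ)) - 1 := by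
  simp only [gp, Polynomial.map_sub, Polynomial.map_mul, Polynomial.map_prod, map_X, map_C, Polynomial.map_one]
  congr 2
  · refine Finset.prod_congr rfl fun i _ => ?_
    simp [polyFun_apply]
  · congr 2
    simp [polyFun_apply, arP_eval]

/-- root functions -/
noncomputable def xf {m : ℕ} (ℓ : ℕ) (a : Fin m → ℤ) (Ξ : Option (Fin m) → ℝ → ℝ) (j : Option (Fin m)) : ℝ → ℝ :=
  fun τ => Ξ j (ar ℓ a τ)⁻¹

lemma gp_prod (h : TD ℓ a Ξ c0 T1) : ∀ᶠ τ : ℝ in atTop, ((gp ℓ a).map polyFun).map (evR τ) =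
    (∏ j, (X - C (xf ℓ a Ξ j))).map (evR τ) := by
  filter_upwards [eventually_ge_atTop T1] with τ hτ
  obtain ⟨hrd, -⟩ := h τ (hτ.trans (le_abs_self _))
  rw [gp_ev]
  have := hrd.prod
  rw [inv_inv] at this
  rw [← this]
  simp [Polynomial.map_prod, xf]

section
variable (hX : ∀ j, xf ℓ a Ξ j ∈ EE 1 one_pos)

noncomputable def xg (j : Option (Fin m)) : GG := ⟨(xf ℓ a Ξ j : Germ (atTop : Filter ℝ) ℝ), GG_mem (hX j)⟩

include hX in
lemma gp_GG (h : TD ℓ a Ξ c0 T1) : (gp ℓ a).map polyGG = ∏ j, (X - C (xg hX j)) := by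
  apply Polynomial.map_injective GG.subtype Subtype.val_injective
  rw [Polynomial.map_map, polyFun_GG, ← Polynomial.map_map, germ_poly (gp_prod h)]
  simp [Polynomial.map_prod, xg]

lemma xg_inj (h : TD ℓ a Ξ c0 T1) : Function.Injective (xg hX) := by
  intro i j hij
  have h1 : (xf ℓ a Ξ i : Germ (atTop : Filter ℝ) ℝ) = (xf ℓ a Ξ j : Germ (atTop : Filter ℝ) ℝ) := congrArg Subtype.val hij
  have h2 := Germ.coe_eq.1 h1
  obtain ⟨τ, h3, h4⟩ := (h2.and (eventually_ge_atTop T1)).exists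
  obtain ⟨hrd, -⟩ := h τ (h4.trans (le_abs_self _))
  exact hrd.inj h3

lemma main_GF (h : TD ℓ a Ξ c0 T1) : (mainPoly (m+1) ℓ a).map (algebraMap (RatFunc ℚ) GF) =
    ∏ j, (X - C (algebraMap GG GF (xg hX j))) := by
  rw [← gp_main, Polynomial.map_map]
  have : (algebraMap (RatFunc ℚ) GF).comp (algebraMap ℚ[X] (RatFunc ℚ)) = (algebraMap GG GF).comp polyGG := by
    exact RingHom.ext fun P => ratGF_poly P
  rw [this, ← Polynomial.map_map, gp_GG hX h]
  simp [Polynomial.map_prod]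
end

lemma exists_weights {L : Type*} [Field L] [CharZero L] {J : Type*} [Fintype J] (y : J → L) (hy : Function.Injective y) :
    ∃ w : J → ℤ, Function.Injective fun s : Equiv.Perm J => ∑ j, (w j : L) * y (s j) := by
  classical
  let e := Fintype.equivFin J
  let q : Equiv.Perm J × Equiv.Perm J → L[X] := fun s => ∑ j, C (y (s.1 j) - y (s.2 j)) * X ^ (e j : ℕ)
  have hq : ∀ s, s.1 ≠ s.2 → q s ≠ 0 := by
    intro s hs h0
    apply hs
    ext j
    have := congrArg (fun p => coeff p (e j)) h0
    simp only [q, finset_sum_coeff, coeff_C_mul_X_pow, coeff_zero] at this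
    rw [Finset.sum_eq_single j] at this
    · simp at this
      exact hy (by linear_combination this)
    · intro b _ hb
      rw [if_neg]
      intro h; exact hb (e.injective (Fin.ext h)).symm
    · simp
  let Q : L[X] := ∏ s ∈ Finset.univ.filter (fun s : Equiv.Perm J × Equiv.Perm J => s.1 ≠ s.2), q s
  have hQ : Q ≠ 0 := Finset.prod_ne_zero_iff.2 fun s hs => hq s (Finset.mem_filter.1 hs).2
  have : ∃ k : ℕ, Q.eval (k : L) ≠ 0 := by
    by_contra! hc
    exact hQ (Polynomial.eq_zero_of_infinite_isRoot Q
      ((Set.infinite_range_of_injective (Nat.cast_injective (R := L))).mono (by rintro _ ⟨k, rfl⟩; exact hc k)))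
  obtain ⟨k, hk⟩ := this
  refine ⟨fun j => (k:ℤ) ^ (e j : ℕ), ?_⟩
  intro s s' hss
  by_contra hne
  rw [eval_prod, Finset.prod_ne_zero_iff] at hk
  apply hk (s, s') (by simpa using hne)
  simp only [q, eval_finset_sum, eval_mul, eval_C, eval_pow, eval_X]
  have := sub_eq_zero.2 hss
  rw [← Finset.sum_sub_distrib] at this
  rw [← this]
  refine Finset.sum_congr rfl fun j _ => ?_
  push_cast; ring

/-- resolvent -/
noncomputable def reso {R J : Type*} [CommRing R] [Fintype J] (w : J → ℤ) (y : J → R) (S : Finset (Equiv.Perm J)) : R[X] :=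
  ∏ s ∈ S, (X - C (∑ j, (w j : R) * y (s j)))

lemma reso_map {R R' J : Type*} [CommRing R] [CommRing R'] [Fintype J] (w : J → ℤ) (y : J → R) (S : Finset (Equiv.Perm J)) (f : R →+* R') :
    (reso w y S).map f = reso w (fun j => f (y j)) S := by
  simp only [reso, Polynomial.map_prod, Polynomial.map_sub, map_X, Polynomial.map_C]
  refine Finset.prod_congr rfl fun s _ => ?_
  congr 2
  rw [map_sum]
  refine Finset.sum_congr rfl fun j _ => ?_
  rw [map_mul, map_intCast]

lemma reso_lift {R J : Type*} [CommRing R] [Fintype J] (w : J → ℤ) (y : J → R) (S : Finset (Equiv.Perm J)) (U : Subring R)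
    (hy : ∀ j, y j ∈ U) (k : ℕ) : (reso w y S).coeff k ∈ U := by
  have : reso w y S = (reso w (fun j => (⟨y j, hy j⟩ : U)) S).map U.subtype := by
    rw [reso_map]; rfl
  rw [this, coeff_map]
  exact Subtype.property _

/-- the generic contradiction -/
lemma generic_all {F E : Type*} [Field F] [Field E] [Algebra F E] (p : F[X]) {J : Type*} [Fintype J] [DecidableEq J]
    (y : J → E) (hp : p.map (algebraMap F E) = ∏ j, (X - C (y j))) (hinj : Function.Injective y)
    {n : ℕ} (hG : Nonempty (p.Gal ≃* Equiv.Perm (Fin n))) (hJ : Fintype.card J = n)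
    (w : J → ℤ) (hw : Function.Injective fun s : Equiv.Perm J => ∑ j, (w j : E) * y (s j))
    (S : Finset (Equiv.Perm J)) (hS : S.Nonempty) (Q : F[X]) (hQ : reso w y S = Q.map (algebraMap F E)) (π : Equiv.Perm J) : π ∈ S := by
  obtain ⟨ι, y', Φ, h1, h2, h3, h4, h5⟩ := gal_data p y hp hinj
  have hsur := gal_surj p hG hJ Φ h5
  obtain ⟨s0, hs0⟩ := hS
  obtain ⟨φ, hφ⟩ := hsur (π * s0⁻¹)
  have hQ' : Q.map (algebraMap F p.SplittingField) = reso w y' S := by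
    apply Polynomial.map_injective (ι : p.SplittingField →+* E) ι.injective
    rw [reso_map, Polynomial.map_map, ι.comp_algebraMap, ← hQ]
    congr 1; ext j; exact (h1 j).symm
  have h6 : aeval (∑ j, (w j : p.SplittingField) * y' (s0 j)) Q = 0 := by
    rw [aeval_def, ← eval_map, hQ', reso, eval_prod]
    exact Finset.prod_eq_zero hs0 (by rw [eval_sub, eval_X, eval_C, sub_self])
  have h7 := congrArg φ h6
  rw [map_zero] at h7
  have h8 : aeval (φ (∑ j, (w j : p.SplittingField) * y' (s0 j))) Q = 0 :=
    (Polynomial.aeval_algHom_apply (φ : p.SplittingField →ₐ[F] p.SplittingField) _ Q).trans h7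
  have h9 : φ (∑ j, (w j : p.SplittingField) * y' (s0 j)) = ∑ j, (w j : p.SplittingField) * y' (π j) := by
    rw [map_sum]
    refine Finset.sum_congr rfl fun j _ => ?_
    rw [map_mul, map_intCast, h4, hφ]; simp
  rw [h9, aeval_def, ← eval_map, hQ', reso, eval_prod, Finset.prod_eq_zero_iff] at h8
  obtain ⟨s, hs, h10⟩ := h8
  rw [eval_sub, eval_X, eval_C, sub_eq_zero] at h10
  have h11 := congrArg ι h10
  simp only [map_sum, map_mul, map_intCast, h1] at h11
  rwa [hw h11]
end
end

section
open Polynomial NumberField Filter Topology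
set_option synthInstance.maxHeartbeats 1000000
set_option maxHeartbeats 1000000

lemma reso_int {R : Type*} [CommRing R] {J : Type*} [Fintype J] (w : J → ℤ) (y : J → R) (S : Finset (Equiv.Perm J))
    (hy : ∀ j, IsIntegral ℤ (y j)) (k : ℕ) : IsIntegral ℤ ((reso w y S).coeff k) :=
  reso_lift w y S (integralClosure ℤ R).toSubring hy k

lemma spec_res0 {F E : Type*} [Field F] [CharZero F] [Field E] [Algebra F E] (p : F[X]) (pZ : ℤ[X]) (hpZ : pZ.Monic) (hpm : pZ.map (algebraMap ℤ F) = p) {J : Type*} [Fintype J] [DecidableEq J]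
    (y : J → E) (hp : p.map (algebraMap F E) = ∏ j, (X - C (y j))) (hinj : Function.Injective y) {n : ℕ}
    (hG : ¬ Nonempty (p.Gal ≃* Equiv.Perm (Fin n))) (hJ : Fintype.card J = n) :
    ∃ S : Finset (Equiv.Perm J), S.Nonempty ∧ (∃ π, π ∉ S) ∧ ∀ w k, ∃ q : F, IsIntegral ℤ q ∧ (reso w y S).coeff k = algebraMap F E q := by
  classical
  obtain ⟨ι, y', Φ, h1, h2, h3, h4, h5⟩ := gal_data p y hp hinj
  refine ⟨Finset.univ.image Φ, ⟨Φ 1, by simp⟩, ?_, ?_⟩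
  · by_contra! hc
    apply hG
    have hmul : ∀ φ ψ, Φ (φ * ψ) = Φ φ * Φ ψ := by
      intro φ ψ
      ext j
      apply h2
      rw [← h4, AlgEquiv.mul_apply, h4, h4]; rfl
    let e : (p.SplittingField ≃ₐ[F] p.SplittingField) ≃* Equiv.Perm J :=
      MulEquiv.ofBijective (⟨⟨Φ, by have := hmul 1 1; simpa using this⟩, hmul⟩ : _ →* _)
        ⟨h5, fun π => by
          have := hc π
          obtain ⟨x, -, hx⟩ := Finset.mem_image.1 this
          exact ⟨x, hx⟩⟩
    have e2 : J ≃ Fin n := Fintype.equivFinOfCardEq hJ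
    exact ⟨e.trans e2.permCongrHom⟩
  · intro w k
    have hint : ∀ j, IsIntegral ℤ (y' j) := by
      intro j
      refine ⟨pZ, hpZ, ?_⟩
      have h : eval (y' j) (p.map (algebraMap F p.SplittingField)) = 0 := by
        rw [h3, eval_prod]; exact Finset.prod_eq_zero (Finset.mem_univ j) (by simp)
      have h' : p.map (algebraMap F p.SplittingField) = pZ.map (algebraMap ℤ p.SplittingField) := by
        have := congrArg (fun r => Polynomial.map (algebraMap F p.SplittingField) r) hpm
        simp only [Polynomial.map_map] at this
        rw [← this]; congr 1
      rw [h', eval_map] at h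
      exact h
    have hre : reso w y' (Finset.univ.image Φ) = ∏ ψ : (p.SplittingField ≃ₐ[F] p.SplittingField),
        (X - C (ψ (∑ j, (w j : p.SplittingField) * y' j))) := by
      rw [reso, Finset.prod_image (fun _ _ _ _ h => h5 h)]
      refine Finset.prod_congr rfl fun ψ _ => ?_
      congr 2
      rw [map_sum]
      refine Finset.sum_congr rfl fun j _ => ?_
      rw [map_mul, map_intCast, h4]
    have hfix : ∀ φ : (p.SplittingField ≃ₐ[F] p.SplittingField), (reso w y' (Finset.univ.image Φ)).map (φ : p.SplittingField →+* p.SplittingField) = reso w y' (Finset.univ.image Φ) := by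
      intro φ
      rw [hre, Polynomial.map_prod]
      conv_rhs => rw [← Equiv.prod_comp (Equiv.mulLeft φ)]
      refine Finset.prod_congr rfl fun ψ _ => ?_
      simp only [Polynomial.map_sub, map_X, Polynomial.map_C]
      rfl
    haveI : IsGalois F p.SplittingField := by
      haveI : Normal F p.SplittingField := Normal.of_isSplittingField p
      exact ⟨⟩
    have hq : ∃ q : F, algebraMap F p.SplittingField q = (reso w y' (Finset.univ.image Φ)).coeff k := by
      have := (IsGalois.mem_bot_iff_fixed (F := F) (E := p.SplittingField) ((reso w y' (Finset.univ.image Φ)).coeff k)).2 (by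
        intro φ
        have := congrArg (fun r => coeff r k) (hfix φ)
        simpa [coeff_map] using this)
      exact IntermediateField.mem_bot.1 this
    obtain ⟨q, hq⟩ := hq
    have hi : IsIntegral ℤ q := by
      have := reso_int w y' (Finset.univ.image Φ) hint k
      rw [← hq] at this
      exact (isIntegral_algebraMap_iff (algebraMap F p.SplittingField).injective).1 this
    refine ⟨q, hi, ?_⟩
    have h6 : reso w y (Finset.univ.image Φ) = (reso w y' (Finset.univ.image Φ)).map (ι : p.SplittingField →+* E) := by
      rw [reso_map]; congr 1; ext j; exact (h1 j).symm
    rw [h6, coeff_map, ← hq]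
    exact ι.commutes q

lemma spec_res (p : ℚ[X]) (pZ : ℤ[X]) (hpZ : pZ.Monic) (hpm : pZ.map (algebraMap ℤ ℚ) = p) {J : Type*} [Fintype J] [DecidableEq J]
    (y : J → ℝ) (hp : p.map (algebraMap ℚ ℝ) = ∏ j, (X - C (y j))) (hinj : Function.Injective y) {n : ℕ}
    (hG : ¬ Nonempty (p.Gal ≃* Equiv.Perm (Fin n))) (hJ : Fintype.card J = n) :
    ∃ S : Finset (Equiv.Perm J), S.Nonempty ∧ (∃ π, π ∉ S) ∧ ∀ w k, ∃ z : ℤ, (reso w y S).coeff k = z := by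
  obtain ⟨S, h1, h2, h3⟩ := spec_res0 p pZ hpZ hpm y hp hinj hG hJ
  refine ⟨S, h1, h2, fun w k => ?_⟩
  obtain ⟨q, hq, h⟩ := h3 w k
  obtain ⟨z, hz⟩ := IsIntegrallyClosed.isIntegral_iff.1 hq
  exact ⟨z, by rw [h, ← hz]; simp⟩

section
variable {m ℓ : ℕ} {a : Fin m → ℤ}
variable {Ξ : Option (Fin m) → ℝ → ℝ} {c0 T1 : ℝ}

def B2 {m : ℕ} (ℓ : ℕ) (a : Fin m → ℤ) (T1 : ℝ) : Set ℕ :=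
  {τ | T1 ≤ τ ∧ (∏ i, a i) ∣ (τ:ℤ) - 1 ∧ ¬ Nonempty ((pp a (tt ℓ a τ)).Gal ≃* Equiv.Perm (Fin (m+1)))}

lemma DZ_B2 (hm : 0 < m) (hℓ : 1 ≤ ℓ) (hne : ∀ i, a i ≠ 0) (h : TD ℓ a Ξ c0 T1)
    (hΞ : ∀ i, AnalyticAt ℝ (Ξ (some i)) 0) (hΞn : ∀ z, Ξ none z = z⁻¹ + ∑ i, (a i : ℝ) - ∑ i, Ξ (some i) z)
    (hGal : Nonempty ((mainPoly (m+1) ℓ a).Gal ≃* Equiv.Perm (Fin (m+1)))) : DZ (B2 ℓ a T1) := by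
  classical
  have hX : ∀ j, xf ℓ a Ξ j ∈ EE 1 one_pos := EE_xi hℓ hne hΞ hΞn
  have hinj : Function.Injective fun j => algebraMap GG GF (xg hX j) :=
    (IsFractionRing.injective GG GF).comp (xg_inj hX h)
  haveI : CharZero GF := charZero_of_injective_algebraMap (algebraMap (RatFunc ℚ) GF).injective
  obtain ⟨w, hw⟩ := exists_weights (fun j => algebraMap GG GF (xg hX j)) hinj
  let BS : Finset (Equiv.Perm (Option (Fin m))) → Set ℕ := fun S =>
    {τ | S.Nonempty ∧ (∃ π, π ∉ S) ∧ ∀ k, ∃ z : ℤ, (reso w (fun j => xf ℓ a Ξ j τ) S).coeff k = z}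
  have hsub : B2 ℓ a T1 ⊆ ⋃ S, BS S := by
    rintro τ ⟨h1, h2, h3⟩
    obtain ⟨hrd, -⟩ := h (τ:ℝ) (h1.trans (le_abs_self _))
    have hrd' : RD a (fun j => xf ℓ a Ξ j τ) ((tt ℓ a τ : ℤ) : ℝ)⁻¹ c0 := by rw [tt_ar hne h2]; exact hrd
    obtain ⟨S, hS1, hS2, hS3⟩ := spec_res (pp a (tt ℓ a τ)) (ppZ a (tt ℓ a τ)) (ppZ_monic hm _ _) (ppZ_map _ _) (fun j => xf ℓ a Ξ j τ)
      (pp_map hrd') hrd'.inj h3 (by simp)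
    exact Set.mem_iUnion.2 ⟨S, hS1, hS2, hS3 w⟩
  refine DZ.mono ?_ hsub
  refine DZ.iUnion fun S => ?_
  by_contra hB
  have hne2 : ∃ τ, τ ∈ BS S := by
    by_contra! hc
    exact hB (DZ.of_finite (by rw [Set.eq_empty_iff_forall_notMem.2 hc]; exact Set.finite_empty))
  obtain ⟨-, hS, ⟨π, hπ⟩, -⟩ := hne2
  let R : (ℝ → ℝ)[X] := reso w (xf ℓ a Ξ) S
  have hRτ : ∀ (τ : ℝ) k, R.coeff k τ = (reso w (fun j => xf ℓ a Ξ j τ) S).coeff k := by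
    intro τ k
    have := reso_map w (xf ℓ a Ξ) S (evR τ)
    have := congrArg (fun r => coeff r k) this
    simpa [coeff_map] using this
  have hco : ∀ k, ∃ P : ℚ[X], ∀ᶠ τ : ℝ in atTop, R.coeff k τ = aeval τ P := by
    intro k
    refine integral_values one_pos hB (reso_lift w _ S _ hX k) ?_
    rintro τ ⟨-, -, hτ⟩
    rw [hRτ]; exact hτ k
  choose P hP using hco
  let Q : ℚ[X][X] := ∑ k ∈ Finset.range (R.natDegree + 1), C (P k) * X ^ k
  have hQ : R.map (Germ.coeRingHom (atTop : Filter ℝ)) = (Q.map polyFun).map (Germ.coeRingHom (atTop : Filter ℝ)) := by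
    have hPk : ∀ k, Germ.coeRingHom (atTop : Filter ℝ) (R.coeff k) = Germ.coeRingHom (atTop : Filter ℝ) (polyFun (P k)) :=
      fun k => Germ.coe_eq.2 (hP k)
    conv_lhs => rw [R.as_sum_range_C_mul_X_pow]
    simp only [Q, Polynomial.map_sum, Polynomial.map_mul, Polynomial.map_pow, map_X, Polynomial.map_C, hPk]
  apply hπ
  refine generic_all (mainPoly (m+1) ℓ a) (fun j => algebraMap GG GF (xg hX j)) (main_GF hX h) hinj hGal (by simp) w hw S hS
    (Q.map (algebraMap ℚ[X] (RatFunc ℚ))) ?_ π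
  rw [Polynomial.map_map]
  have : (algebraMap (RatFunc ℚ) GF).comp (algebraMap ℚ[X] (RatFunc ℚ)) = (algebraMap GG GF).comp polyGG := by
    exact RingHom.ext fun P => ratGF_poly P
  rw [this, ← Polynomial.map_map, ← reso_map w (xg hX) S (algebraMap GG GF)]
  congr 1
  apply Polynomial.map_injective GG.subtype Subtype.val_injective
  rw [Polynomial.map_map, polyFun_GG, ← Polynomial.map_map, ← hQ, reso_map, reso_map]
  rfl
end
end

section
open Polynomial NumberField Filter Topology
set_option synthInstance.maxHeartbeats 1000000
set_option maxHeartbeats 1000000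

/-- abstract Kummer-type averaging -/
lemma kummer0 {Fx L : Type*} [Field Fx] [Field L] [Algebra ℂ Fx] [Algebra Fx L] [Algebra ℂ L] [IsScalarTower ℂ Fx L]
    {ℓ M : ℕ} (hℓ : 0 < ℓ) (hM : 0 < M) (hh b : Fx) (T : L) (hT : T ^ ℓ = algebraMap Fx L hh) (hh0 : hh ≠ 0) (hb : b ≠ 0)
    (G : Fx[X]) (hG : ∀ ω : ℂ, ω ^ ℓ = 1 → (aeval (algebraMap ℂ L ω * T) G) ^ M = algebraMap Fx L b) :
    ∃ i < ℓ, ∃ (κ : ℂ) (q : Fx), κ ≠ 0 ∧ q ≠ 0 ∧ (algebraMap Fx L q * T ^ i) ^ M = algebraMap Fx L (algebraMap ℂ Fx κ * b) := by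
  have hmon : (X ^ ℓ - C hh : Fx[X]).Monic := monic_X_pow_sub_C hh hℓ.ne'
  have hT0 : T ≠ 0 := by
    rintro rfl
    rw [zero_pow hℓ.ne'] at hT
    exact hh0 ((map_eq_zero (algebraMap Fx L)).1 hT.symm)
  let R := G %ₘ (X ^ ℓ - C hh)
  have hR : ∀ ω : ℂ, ω ^ ℓ = 1 → aeval (algebraMap ℂ L ω * T) G = aeval (algebraMap ℂ L ω * T) R := by
    intro ω hω
    conv_lhs => rw [← modByMonic_add_div G (X ^ ℓ - C hh)]
    rw [map_add, map_mul]
    have : aeval (algebraMap ℂ L ω * T) (X ^ ℓ - C hh : Fx[X]) = 0 := by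
      rw [map_sub, map_pow, aeval_X, aeval_C, mul_pow, ← map_pow, hω, map_one, one_mul, hT, sub_self]
    rw [this, zero_mul, add_zero]
  have hdeg : R.natDegree < ℓ := by
    have := natDegree_modByMonic_lt G hmon (by
      intro h1
      have := congrArg natDegree h1
      rw [natDegree_X_pow_sub_C, natDegree_one] at this
      omega)
    rwa [natDegree_X_pow_sub_C] at this
  have hexp : ∀ ω : ℂ, aeval (algebraMap ℂ L ω * T) R = ∑ i ∈ Finset.range ℓ, algebraMap Fx L (R.coeff i) * (algebraMap ℂ L ω ^ i * T ^ i) := by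
    intro ω
    rw [aeval_eq_sum_range' hdeg]
    refine Finset.sum_congr rfl fun i _ => ?_
    rw [Algebra.smul_def, mul_pow]
  let z : ℂ := Complex.exp (2 * Real.pi * Complex.I / ℓ)
  have hz : IsPrimitiveRoot z ℓ := Complex.isPrimitiveRoot_exp ℓ hℓ.ne'
  have hz0 : z ≠ 0 := hz.ne_zero hℓ.ne'
  let y : ℂ := Complex.exp (2 * Real.pi * Complex.I / M)
  have hy : IsPrimitiveRoot y M := Complex.isPrimitiveRoot_exp M hM.ne'
  have hy' : IsPrimitiveRoot (algebraMap ℂ L y) M := hy.map_of_injective (algebraMap ℂ L).injective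
  let v : ℕ → L := fun k => aeval (algebraMap ℂ L (z ^ k) * T) G
  have hzk : ∀ k : ℕ, (z ^ k) ^ ℓ = 1 := fun k => by rw [← pow_mul, mul_comm, pow_mul, hz.pow_eq_one, one_pow]
  have hv : ∀ k, v k ^ M = algebraMap Fx L b := fun k => hG _ (hzk k)
  have hv0 : v 0 ≠ 0 := by
    intro h0
    have := hv 0
    rw [h0, zero_pow hM.ne'] at this
    exact hb ((map_eq_zero (algebraMap Fx L)).1 this.symm)
  have hε : ∀ k, ∃ e : ℂ, v k = algebraMap ℂ L e * v 0 := by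
    intro k
    have h1 : (v k / v 0) ^ M = 1 := by
      rw [div_pow, hv, hv, div_self]
      exact (map_ne_zero (algebraMap Fx L)).2 hb
    haveI : NeZero M := ⟨hM.ne'⟩
    obtain ⟨i, -, hi⟩ := hy'.eq_pow_of_pow_eq_one h1
    refine ⟨y ^ i, ?_⟩
    rw [map_pow, hi, div_mul_cancel₀ _ hv0]
  choose e he using hε
  have hq : ∃ i ∈ Finset.range ℓ, R.coeff i ≠ 0 := by
    by_contra! hc
    apply hv0
    simp only [v]
    rw [hR _ (hzk 0), hexp]
    exact Finset.sum_eq_zero fun i hi => by rw [hc i hi, map_zero, zero_mul]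
  obtain ⟨i0, hi0, hq0⟩ := hq
  have hsum : ∑ k ∈ Finset.range ℓ, algebraMap ℂ L ((z⁻¹ ^ i0) ^ k) * v k = (ℓ : L) * (algebraMap Fx L (R.coeff i0) * T ^ i0) := by
    have h1 : ∀ k, algebraMap ℂ L ((z⁻¹ ^ i0) ^ k) * v k =
        ∑ i ∈ Finset.range ℓ, algebraMap Fx L (R.coeff i) * T ^ i * algebraMap ℂ L ((z ^ i * z⁻¹ ^ i0) ^ k) := by
      intro k
      simp only [v]
      rw [hR _ (hzk k), hexp, Finset.mul_sum]
      refine Finset.sum_congr rfl fun i _ => ?_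
      simp only [map_pow, map_mul, mul_pow]
      ring
    rw [Finset.sum_congr rfl fun k _ => h1 k, Finset.sum_comm]
    rw [Finset.sum_eq_single_of_mem i0 hi0]
    · rw [← mul_pow, mul_inv_cancel₀ hz0]
      simp [mul_comm]
    · intro i hi hii
      rw [← Finset.mul_sum, ← map_sum]
      have h2 : z ^ i * z⁻¹ ^ i0 ≠ 1 := by
        intro h
        rw [inv_pow, mul_inv_eq_one₀ (pow_ne_zero _ hz0)] at h
        exact hii (hz.pow_inj (Finset.mem_range.1 hi) (Finset.mem_range.1 hi0) h)
      have h3 : (z ^ i * z⁻¹ ^ i0) ^ ℓ = 1 := by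
        rw [mul_pow, hzk, one_mul, inv_pow, inv_pow, hzk, inv_one]
      rw [geom_sum_eq h2, h3, sub_self, zero_div, map_zero, mul_zero]
  have hκ : ∑ k ∈ Finset.range ℓ, algebraMap ℂ L ((z⁻¹ ^ i0) ^ k) * v k =
      algebraMap ℂ L (∑ k ∈ Finset.range ℓ, (z⁻¹ ^ i0) ^ k * e k) * v 0 := by
    rw [map_sum, Finset.sum_mul]
    refine Finset.sum_congr rfl fun k _ => ?_
    rw [he k, map_mul]; ring
  set κ := ∑ k ∈ Finset.range ℓ, (z⁻¹ ^ i0) ^ k * e k with hκd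
  haveI : CharZero L := charZero_of_injective_algebraMap (algebraMap ℂ L).injective
  haveI : CharZero Fx := charZero_of_injective_algebraMap (algebraMap ℂ Fx).injective
  have hℓL : (ℓ : L) ≠ 0 := by exact_mod_cast hℓ.ne'
  have hℓF : (ℓ : Fx) ≠ 0 := by exact_mod_cast hℓ.ne'
  have hfin : algebraMap Fx L ((ℓ : Fx) * R.coeff i0) * T ^ i0 = algebraMap ℂ L κ * v 0 := by
    rw [← hκ, hsum, map_mul, map_natCast, mul_assoc]
  refine ⟨i0, Finset.mem_range.1 hi0, κ ^ M, (ℓ : Fx) * R.coeff i0, ?_, mul_ne_zero hℓF hq0, ?_⟩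
  · apply pow_ne_zero
    intro h0
    rw [h0, map_zero, zero_mul] at hfin
    have := mul_ne_zero ((map_ne_zero (algebraMap Fx L)).2 (mul_ne_zero hℓF hq0)) (pow_ne_zero i0 hT0)
    exact this hfin
  · rw [hfin, mul_pow, hv 0, map_mul, ← map_pow, ← IsScalarTower.algebraMap_apply]

lemma eq_zero_pw {x : ℂ} {n : ℕ} (h : x ^ n = 0) : x = 0 := by
  by_contra hx
  exact pow_ne_zero n hx h

lemma rootMult_pow (p : ℂ[X]) (n : ℕ) (x : ℂ) : (p ^ n).rootMultiplicity x = n * p.rootMultiplicity x := by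
  classical
  rw [← count_roots, roots_pow, Multiset.count_nsmul, count_roots]

lemma kummer2 {m ℓ ν d i : ℕ} (hν : 1 ≤ ν) (hd : 1 ≤ d) (hdℓ : d < ℓ) (hi : i < ℓ) (νs : Fin m → ℕ) (b : Fin m → ℂ) (hb : ∀ i, b i ≠ 0)
    (F0 u v : ℂ[X]) (hu : u ≠ 0) (hv : v ≠ 0) (κ : ℂ) (hκ : κ ≠ 0) (hF0 : F0.Separable) (h0 : F0.IsRoot 0) (ρ : ℂ) (hρ0 : ρ ≠ 0)
    (hρ : F0.IsRoot ρ) (hρb : ∀ i, ρ ≠ b i)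
    (h : u ^ (2 * ℓ * ν) * F0 ^ (2 * ν * i) = C κ * (X ^ ν * ∏ k, (X - C (b k)) ^ νs k) ^ (2 * d) * (∏ k, (X - C (b k))) ^ (2 * ν * i) * v ^ (2 * ℓ * ν)) :
    False := by
  have hF00 : F0 ≠ 0 := hF0.ne_zero
  have mul_c : ∀ x : ℂ, (∀ k, x ≠ b k) → F0.IsRoot x →
      2 * ℓ * ν * u.rootMultiplicity x + 2 * ν * i = 2 * ν * d * (X : ℂ[X]).rootMultiplicity x + 2 * ℓ * ν * v.rootMultiplicity x := by
    intro x hx hr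
    have h1 : F0.rootMultiplicity x = 1 := by
      have h2 := rootMultiplicity_le_one_of_separable hF0 x
      have h3 := (rootMultiplicity_pos hF00).2 hr
      omega
    have hP : ∀ k, (X - C (b k)) ≠ 0 := fun k => X_sub_C_ne_zero _
    have hPm : ∀ k, (X - C (b k)).rootMultiplicity x = 0 := by
      intro k
      apply rootMultiplicity_eq_zero
      simp [IsRoot, sub_eq_zero, hx k]
    have hP0 : (∏ k, (X - C (b k))) ≠ 0 := Finset.prod_ne_zero_iff.2 fun k _ => hP k
    have hPP0 : (∏ k, (X - C (b k)) ^ νs k) ≠ 0 := Finset.prod_ne_zero_iff.2 fun k _ => pow_ne_zero _ (hP k)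
    have hPr : (∏ k, (X - C (b k))).rootMultiplicity x = 0 := by
      apply rootMultiplicity_eq_zero
      rw [IsRoot, eval_prod, Finset.prod_eq_zero_iff]
      rintro ⟨k, -, hk⟩
      exact hx k (by simpa [sub_eq_zero] using hk)
    have hPPr : (∏ k, (X - C (b k)) ^ νs k).rootMultiplicity x = 0 := by
      apply rootMultiplicity_eq_zero
      rw [IsRoot, eval_prod, Finset.prod_eq_zero_iff]
      rintro ⟨k, -, hk⟩
      rw [eval_pow] at hk
      have hk' := eq_zero_pw hk
      exact hx k (by simpa [sub_eq_zero] using hk')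
    have hCκ : (C κ : ℂ[X]) ≠ 0 := C_ne_zero.2 hκ
    have key := congrArg (rootMultiplicity x) h
    have hX0 : (X : ℂ[X]) ≠ 0 := X_ne_zero
    rw [rootMultiplicity_mul (mul_ne_zero (pow_ne_zero _ hu) (pow_ne_zero _ hF00)),
      rootMultiplicity_mul (by positivity), rootMultiplicity_mul (by positivity), rootMultiplicity_mul (by positivity)] at key
    simp only [rootMult_pow] at key
    rw [rootMultiplicity_mul (by positivity), rootMultiplicity_C, hPr, hPPr, rootMult_pow, h1] at key
    linarith
  have hρX : (X : ℂ[X]).rootMultiplicity ρ = 0 := rootMultiplicity_eq_zero (by simpa [IsRoot] using hρ0)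
  have h0X : (X : ℂ[X]).rootMultiplicity 0 = 1 := by simpa using rootMultiplicity_X_sub_C_self (x := (0:ℂ))
  have k1 := mul_c ρ hρb hρ
  have k2 := mul_c 0 (fun k => (hb k).symm) h0
  rw [hρX] at k1
  rw [h0X] at k2
  have k1' : ℓ * u.rootMultiplicity ρ + i = ℓ * v.rootMultiplicity ρ := by
    apply Nat.eq_of_mul_eq_mul_left (show 0 < 2 * ν by omega)
    linarith
  have k2' : ℓ * u.rootMultiplicity 0 + i = d + ℓ * v.rootMultiplicity 0 := by
    apply Nat.eq_of_mul_eq_mul_left (show 0 < 2 * ν by omega)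
    linarith
  have k3 : ℓ ∣ i := (Nat.dvd_add_right (Dvd.intro _ rfl)).1 (k1' ▸ Dvd.intro _ rfl)
  have k4 : i = 0 := Nat.eq_zero_of_dvd_of_lt k3 hi
  rw [k4, add_zero] at k2'
  have k5 : ℓ ∣ d := (Nat.dvd_add_left (Dvd.intro _ rfl)).1 (k2' ▸ Dvd.intro _ rfl)
  have := Nat.le_of_dvd (by omega) k5
  omega
end

section
open Polynomial NumberField Filter Topology
set_option synthInstance.maxHeartbeats 1000000
set_option maxHeartbeats 1000000

section
variable {m ℓ : ℕ} {a : Fin m → ℤ}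

lemma gp_derivative : derivative (gp ℓ a) = derivative (∏ i, (X - C (C (a i : ℚ)))) * (X - C (arP ℓ a)) + ∏ i, (X - C (C (a i : ℚ))) := by
  simp [gp, derivative_mul]

lemma prodZ_map {S : Type*} [CommRing S] (f : ℚ[X] →+* S) (xx : S) :
    eval₂ f xx (derivative (∏ i, (X - C (C (a i : ℚ))))) = aeval xx (derivative (∏ i, (X - C (a i : ℤ)))) := by
  have h1 : (∏ i, (X - C (C (a i : ℚ))) : ℚ[X][X]) = (∏ i, (X - C (a i : ℤ))).map (algebraMap ℤ ℚ[X]) := by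
    simp [Polynomial.map_prod]
  rw [h1, derivative_map, eval₂_map, aeval_def]
  congr 1
  exact RingHom.ext_int _ _

lemma kummer1 {Fx L : Type*} [Field Fx] [Field L] [Algebra ℂ Fx] [Algebra Fx L] [Algebra ℂ L] [IsScalarTower ℂ Fx L]
    [CharZero Fx] [CharZero L] [IsAlgClosed L] (ι : ℂ[X] →+* Fx) (hι : Function.Injective ι)
    (hιC : ∀ c : ℂ, ι (C c) = algebraMap ℂ Fx c) (hfr : ∀ q : Fx, ∃ u v : ℂ[X], v ≠ 0 ∧ q = ι u / ι v)
    (hm : 1 ≤ m) (hne : ∀ i, a i ≠ 0) (hsep0 : (mainPolyZero (m+1) ℓ a).Separable) (hℓ : 1 ≤ ℓ)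
    {ν d : ℕ} (νs : Fin m → ℕ) (hν : 1 ≤ ν) (hd : 1 ≤ d) (hdℓ : d < ℓ) (Q : ℚ[X][X])
    (hdiv : gp ℓ a ∣ Q ^ (2 * ℓ * ν) - (X ^ ν * ∏ i, (X - C (C (a i : ℚ))) ^ νs i) ^ (2 * d) * (derivative (gp ℓ a)) ^ (2 * ℓ * ν)) : False := by
  obtain ⟨x, hιX⟩ : ∃ x : Fx, ι X = x := ⟨_, rfl⟩
  obtain ⟨A, hA⟩ : ∃ A : Fx, A = ∏ i, (a i : Fx) := ⟨_, rfl⟩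
  obtain ⟨s, hs⟩ : ∃ s : Fx, s = (-1) ^ m := ⟨_, rfl⟩
  obtain ⟨P, hP⟩ : ∃ P : Fx, P = ∏ i, (x - (a i : Fx)) := ⟨_, rfl⟩
  obtain ⟨Pp, hPpd⟩ : ∃ Pp : ℂ[X], Pp = ∏ i, (X - C (a i : ℂ)) := ⟨_, rfl⟩
  obtain ⟨F0, hF0d⟩ : ∃ F0 : ℂ[X], F0 = (mainPolyZero (m+1) ℓ a).map (algebraMap ℚ ℂ) := ⟨_, rfl⟩
  have hss : s * s = 1 := by rw [hs, ← mul_pow]; simp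
  have hA0 : A ≠ 0 := hA ▸ Finset.prod_ne_zero_iff.2 fun i _ => by exact_mod_cast hne i
  have hPp : ι Pp = P := by
    simp only [hPpd, hP, map_prod, map_sub, hιX, hιC, map_intCast]
  have hPp0 : Pp ≠ 0 := hPpd ▸ Finset.prod_ne_zero_iff.2 fun i _ => X_sub_C_ne_zero _
  have hP0 : P ≠ 0 := by rw [← hPp]; exact (map_ne_zero_iff ι hι).2 hPp0
  have hF0f : F0 = Pp * (X + C ((-1) ^ m / ∏ i, (a i : ℂ))) - 1 := by
    simp only [hF0d, mainPolyZero, hPpd, Polynomial.map_sub, Polynomial.map_mul, Polynomial.map_prod, map_X, Polynomial.map_C, Polynomial.map_one]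
    rw [zero_pow (by omega)]
    have : ∏ i : Fin m, (X - C ((algebraMap ℚ ℂ) (a i : ℚ))) = ∏ i, (X - C (a i : ℂ)) :=
      Finset.prod_congr rfl fun i _ => by simp
    congr 1
    refine congrArg₂ (· * ·) this ?_
    rw [sub_eq_add_neg, ← C_neg]
    congr 2
    simp
    ring
  have hF0 : ι F0 = P * (x + s / A) - 1 := by
    rw [hF0f, map_sub, map_mul, hPp, map_add, hιX, hιC, map_one]
    simp [hs, hA]
  have hF00 : F0 ≠ 0 := by
    have : F0.Separable := hF0d ▸ hsep0.map
    exact this.ne_zero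
  obtain ⟨hh, hhd⟩ : ∃ hh : Fx, hh = s * A * ι F0 / P := ⟨_, rfl⟩
  have hh0 : hh ≠ 0 := by
    rw [hhd]
    refine div_ne_zero (mul_ne_zero (mul_ne_zero ?_ hA0) ((map_ne_zero_iff ι hι).2 hF00)) hP0
    intro h; rw [h] at hss; simp at hss
  have hhe : x - s / A * (hh - 1) = P⁻¹ := by
    rw [hhd, hF0]
    field_simp
    linear_combination (-(x * P * A - A ) - P * s) * hss
  obtain ⟨T, hT⟩ := IsAlgClosed.exists_pow_nat_eq (algebraMap Fx L hh) (show 0 < ℓ by omega)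
  let Ψ : ℚ[X][X] →+* Fx[X] := eval₂RingHom (mapRingHom (algebraMap ℚ Fx)) (C x)
  obtain ⟨D, hDd⟩ : ∃ D : Fx, D = aeval x (derivative (∏ i, (X - C (a i : ℤ)))) * P⁻¹ + P := ⟨_, rfl⟩
  have hD0 : D ≠ 0 := by
    have h1 : D = ι (derivative Pp + Pp * Pp) * P⁻¹ := by
      have h2 : ι (derivative Pp) = aeval x (derivative (∏ i, (X - C (a i : ℤ)))) := by
        have h3 : Pp = (∏ i, (X - C (a i : ℤ))).map (algebraMap ℤ ℂ) := by simp [hPpd, Polynomial.map_prod]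
        rw [h3, derivative_map, aeval_def, ← hιX]
        conv_lhs => rw [← eval₂_C_X (p := map (algebraMap ℤ ℂ) _)]
        rw [hom_eval₂, eval₂_map]
        congr 1
        exact RingHom.ext_int _ _
      rw [map_add, map_mul, hPp, h2]
      rw [hDd]; field_simp
    rw [h1]
    refine mul_ne_zero ((map_ne_zero_iff ι hι).2 ?_) (inv_ne_zero hP0)
    intro h
    have hmon : Pp.Monic := hPpd ▸ monic_prod_of_monic _ _ fun i _ => monic_X_sub_C _
    have hdeg : Pp.natDegree = m := by
      rw [hPpd, natDegree_prod_of_monic _ _ fun i _ => monic_X_sub_C _]; simp only [natDegree_X_sub_C, Finset.sum_const, Finset.card_univ, Fintype.card_fin, smul_eq_mul, mul_one]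
    have h2 : (Pp * Pp).natDegree = m + m := by rw [hmon.natDegree_mul hmon, hdeg]
    have h3 : (derivative Pp).natDegree ≤ m - 1 := by rw [← hdeg]; exact natDegree_derivative_le _
    have h4 : Pp * Pp = - derivative Pp := by linear_combination h
    rw [h4, natDegree_neg] at h2
    omega
  obtain ⟨b, hbd⟩ : ∃ b : Fx, b = (x ^ ν * ∏ i, (x - (a i : Fx)) ^ νs i) ^ (2 * d) * D ^ (2 * ℓ * ν) := ⟨_, rfl⟩
  have hx0 : x ≠ 0 := by rw [← hιX]; exact (map_ne_zero_iff ι hι).2 X_ne_zero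
  have hxa : ∀ i, x - (a i : Fx) ≠ 0 := fun i => Finset.prod_ne_zero_iff.1 (hP ▸ hP0) i (Finset.mem_univ i)
  have hβ0 : x ^ ν * ∏ i, (x - (a i : Fx)) ^ νs i ≠ 0 :=
    mul_ne_zero (pow_ne_zero _ hx0) (Finset.prod_ne_zero_iff.2 fun i _ => pow_ne_zero _ (hxa i))
  have hb0 : b ≠ 0 := hbd ▸ mul_ne_zero (pow_ne_zero _ hβ0) (pow_ne_zero _ hD0)
  have hM : 0 < 2 * ℓ * ν := by positivity
  obtain ⟨i, hi, κ, q, hκ, hq, hfin⟩ := kummer0 (Fx := Fx) (L := L) (show 0 < ℓ by omega) hM hh b T hT hh0 hb0 (Ψ Q) (by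
    intro ω hω
    let θ : ℚ[X][X] →+* L := ((aeval (algebraMap ℂ L ω * T) : Fx[X] →ₐ[Fx] L) : Fx[X] →+* L).comp Ψ
    change (θ Q) ^ (2 * ℓ * ν) = _
    have hθX : θ X = algebraMap Fx L x := by simp [θ, Ψ]
    have hθa : ∀ i, θ (C (C (a i : ℚ))) = algebraMap Fx L (a i : Fx) := by intro i; simp [θ, Ψ]
    have hθr : θ (C (arP ℓ a)) = algebraMap Fx L (s / A * (hh - 1)) := by
      rw [map_mul, map_sub, ← hT]
      simp only [θ, Ψ, arP]
      simp [mul_pow, ← map_pow, hω, hs, hA]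
      left; rw [map_pow, aeval_X, mul_pow, ← map_pow, hω, map_one, one_mul]
    have hθP : θ (∏ i, (X - C (C (a i : ℚ)))) = algebraMap Fx L P := by
      rw [hP, map_prod, map_prod]
      refine Finset.prod_congr rfl fun i _ => ?_
      rw [map_sub, map_sub, hθX, hθa]
    have hθg : θ (gp ℓ a) = 0 := by
      rw [gp, map_sub, map_mul, hθP, map_sub, hθX, hθr, map_one, ← map_sub, hhe, ← map_mul, mul_inv_cancel₀ hP0, map_one, sub_self]
    have hθd : θ (derivative (gp ℓ a)) = algebraMap Fx L D := by
      rw [gp_derivative, map_add, map_mul, hθP, map_sub, hθX, hθr, ← map_sub, hhe]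
      have h1 : θ (derivative (∏ i, (X - C (C (a i : ℚ))))) = algebraMap Fx L (aeval x (derivative (∏ i, (X - C (a i : ℤ))))) := by
        have h2 : θ = eval₂RingHom (θ.comp C) (θ X) := by
          apply Polynomial.ringHom_ext'
          · ext <;> simp
          · simp
        rw [h2, coe_eval₂RingHom, prodZ_map, hθX, aeval_algebraMap_apply]
      rw [h1, ← map_mul, ← map_add, ← hDd]
    obtain ⟨W, hW⟩ := hdiv
    have h5 := congrArg θ hW
    rw [map_mul, hθg, zero_mul, map_sub, sub_eq_zero, map_pow, map_mul, map_pow, map_pow, hθd, map_mul, map_pow, hθX, map_prod] at h5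
    rw [h5]
    simp only [hbd, map_mul, map_pow, map_prod, map_sub, hθX, hθa])
  -- descend
  have hfin2 : q ^ (2 * ℓ * ν) * hh ^ (2 * ν * i) = algebraMap ℂ Fx κ * b := by
    apply (algebraMap Fx L).injective
    rw [← hfin, mul_pow, map_mul, map_pow, map_pow, ← hT, ← pow_mul, ← pow_mul]
    congr 2; ring
  obtain ⟨u, v, hv, huv⟩ : ∃ u v : ℂ[X], v ≠ 0 ∧ q / D = ι u / ι v := hfr _
  have hιv : ι v ≠ 0 := (map_ne_zero_iff ι hι).2 hv
  have hq' : q = ι u / ι v * D := by rw [← huv, div_mul_cancel₀ _ hD0]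
  have hu : u ≠ 0 := by
    rintro rfl
    rw [map_zero, zero_div, zero_mul] at hq'
    exact hq hq'
  have hsA : algebraMap ℂ Fx ((-1) ^ m * ∏ i, (a i : ℂ)) = s * A := by simp [hs, hA]
  have hc0 : ((-1 : ℂ) ^ m * ∏ i, (a i : ℂ)) ≠ 0 :=
    mul_ne_zero (pow_ne_zero _ (by norm_num)) (Finset.prod_ne_zero_iff.2 fun i _ => by exact_mod_cast hne i)
  have hfin3 : u ^ (2 * ℓ * ν) * F0 ^ (2 * ν * i) = C (κ / ((-1) ^ m * ∏ i, (a i : ℂ)) ^ (2 * ν * i)) * (X ^ ν * ∏ k, (X - C (a k : ℂ)) ^ νs k) ^ (2 * d) * (∏ k, (X - C (a k : ℂ))) ^ (2 * ν * i) * v ^ (2 * ℓ * ν) := by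
    apply hι
    have e1 : ι (X ^ ν * ∏ k, (X - C (a k : ℂ)) ^ νs k) = x ^ ν * ∏ i, (x - (a i : Fx)) ^ νs i := by
      simp only [map_mul, map_pow, map_prod, map_sub, hιX, hιC, map_intCast]
    have e2 : ι (∏ k, (X - C (a k : ℂ))) = P := hPpd ▸ hPp
    have hsA0 : s * A ≠ 0 := by rw [← hsA]; exact (_root_.map_ne_zero _).2 hc0
    rw [map_mul, map_mul, map_mul, map_mul, map_pow, map_pow, map_pow, map_pow, map_pow, e1, e2, hιC, map_div₀, map_pow, hsA]
    rw [hq'] at hfin2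
    simp only [hhd, hbd] at hfin2
    rw [mul_pow, div_pow, div_pow, mul_pow (s * A)] at hfin2
    generalize x ^ ν * ∏ i, (x - (a i : Fx)) ^ νs i = β at *
    have hDp := pow_ne_zero (2 * ℓ * ν) hD0
    have hsAp := pow_ne_zero (2 * ν * i) hsA0
    have hPp' := pow_ne_zero (2 * ν * i) hP0
    have hvp := pow_ne_zero (2 * ℓ * ν) hιv
    generalize D ^ (2 * ℓ * ν) = D' at *
    generalize (s * A) ^ (2 * ν * i) = sA' at *
    generalize P ^ (2 * ν * i) = P' at *
    generalize (ι v) ^ (2 * ℓ * ν) = v' at *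
    generalize (ι u) ^ (2 * ℓ * ν) = u' at *
    generalize (ι F0) ^ (2 * ν * i) = F' at *
    generalize β ^ (2 * d) = β' at *
    field_simp at hfin2 ⊢
    linear_combination hfin2
  have hF0sep : F0.Separable := hF0d ▸ hsep0.map
  have hroot0 : F0.IsRoot 0 := by
    rw [IsRoot, hF0f]
    simp only [eval_sub, eval_mul, eval_add, eval_X, eval_C, eval_one, hPpd, eval_prod, zero_sub, zero_add]
    have : ∏ i, (-(a i : ℂ)) = (-1) ^ m * ∏ i, (a i : ℂ) := by
      simp [Finset.prod_neg]
    rw [this]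
    have h1 : (∏ i, (a i : ℂ)) ≠ 0 := Finset.prod_ne_zero_iff.2 fun i _ => by exact_mod_cast hne i
    have h2 : ((-1:ℂ)) ^ m * (-1) ^ m = 1 := by rw [← mul_pow]; simp
    field_simp
    linear_combination h2
  have hFdeg : F0.natDegree = m + 1 := by
    have hmon : Pp.Monic := hPpd ▸ monic_prod_of_monic _ _ fun i _ => monic_X_sub_C _
    have hdeg : Pp.natDegree = m := by
      rw [hPpd, natDegree_prod_of_monic _ _ fun i _ => monic_X_sub_C _]; simp only [natDegree_X_sub_C, Finset.sum_const, Finset.card_univ, Fintype.card_fin, smul_eq_mul, mul_one]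
    have h1 : (Pp * (X + C ((-1) ^ m / ∏ i, (a i : ℂ)))).natDegree = m + 1 := by
      rw [hmon.natDegree_mul (monic_X_add_C _), hdeg, natDegree_X_add_C]
    rw [hF0f, natDegree_sub_eq_left_of_natDegree_lt, h1]
    rw [natDegree_one, h1]; omega
  obtain ⟨ρ, hρ, hρ0⟩ : ∃ ρ, F0.IsRoot ρ ∧ ρ ≠ 0 := by
    by_contra! hc
    have h1 : F0.roots ⊆ {0} := fun r hr => by
      rw [mem_roots hF00] at hr; simp [hc r hr]
    have h2 : F0.roots.Nodup := nodup_roots hF0sep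
    have h3 : F0.roots.card ≤ 1 := by
      have := Multiset.card_le_card ((Multiset.le_iff_subset h2).2 h1)
      simpa using this
    have h4 : F0.roots.card = F0.natDegree := splits_iff_card_roots.1 (IsAlgClosed.splits F0)
    omega
  refine kummer2 hν hd hdℓ hi νs (fun k => (a k : ℂ)) (fun k => by exact_mod_cast hne k) F0 u v hu hv _ (div_ne_zero hκ (pow_ne_zero _ hc0))
    hF0sep hroot0 ρ hρ0 hρ ?_ hfin3
  intro k hk
  rw [IsRoot, hF0f, hk] at hρ
  simp only [eval_sub, eval_mul, eval_one, hPpd, eval_prod] at hρ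
  rw [Finset.prod_eq_zero (Finset.mem_univ k) (by simp)] at hρ
  simp at hρ

lemma kummer (hm : 1 ≤ m) (hne : ∀ i, a i ≠ 0) (hsep0 : (mainPolyZero (m+1) ℓ a).Separable) (hℓ : 1 ≤ ℓ)
    {ν d : ℕ} (νs : Fin m → ℕ) (hν : 1 ≤ ν) (hd : 1 ≤ d) (hdℓ : d < ℓ) (Q : ℚ[X][X])
    (hdiv : gp ℓ a ∣ Q ^ (2 * ℓ * ν) - (X ^ ν * ∏ i, (X - C (C (a i : ℚ))) ^ νs i) ^ (2 * d) * (derivative (gp ℓ a)) ^ (2 * ℓ * ν)) : False := by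
  haveI : CharZero (RatFunc ℂ) := charZero_of_injective_algebraMap (algebraMap ℂ (RatFunc ℂ)).injective
  haveI : CharZero (AlgebraicClosure (RatFunc ℂ)) := charZero_of_injective_algebraMap (algebraMap (RatFunc ℂ) _).injective
  exact kummer1 (Fx := RatFunc ℂ) (L := AlgebraicClosure (RatFunc ℂ)) (algebraMap ℂ[X] (RatFunc ℂ)) (RatFunc.algebraMap_injective ℂ)
    (fun c => RatFunc.algebraMap_C c) (fun q => ⟨q.num, q.denom, RatFunc.denom_ne_zero _, (RatFunc.num_div_denom _).symm⟩)
    hm hne hsep0 hℓ νs hν hd hdℓ Q hdiv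
end
end

section
open Polynomial NumberField Filter Topology
set_option synthInstance.maxHeartbeats 1000000
set_option maxHeartbeats 1000000

lemma norm_aux {K L : Type*} [Field K] [Field L] [Algebra K L] {M : ℕ} (hM : 0 < M) (β : K) (ζ : L) (h : ζ ^ M = algebraMap K L β) :
    1 ≤ Module.finrank K (IntermediateField.adjoin K {ζ}) ∧ ∃ η : K, η ^ M = β ^ Module.finrank K (IntermediateField.adjoin K {ζ}) := by
  have hint : IsIntegral K ζ := by
    refine IsIntegral.of_pow hM ?_
    rw [h]; exact isIntegral_algebraMap
  haveI : FiniteDimensional K (IntermediateField.adjoin K {ζ}) := IntermediateField.adjoin.finiteDimensional hint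
  refine ⟨Module.finrank_pos, Algebra.norm K (IntermediateField.AdjoinSimple.gen K ζ), ?_⟩
  rw [← map_pow]
  have : IntermediateField.AdjoinSimple.gen K ζ ^ M = algebraMap K _ β := by
    apply Subtype.ext
    simpa using h
  rw [this, Algebra.norm_algebraMap]

lemma trace_aux (p : ℚ[X]) [Fact (Irreducible p)] (pZ : ℤ[X]) (hpm : pZ.map (algebraMap ℤ ℚ) = p)
    (hr : IsIntegral ℤ (AdjoinRoot.root p)) {J : Type*} [Fintype J] [DecidableEq J]
    (y : J → ℝ) (hp : p.map (algebraMap ℚ ℝ) = ∏ j, (X - C (y j))) (hinj : Function.Injective y) (η : AdjoinRoot p) (hη : IsIntegral ℤ η) (k : ℕ) :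
    ∃ z : ℤ, (∑ j, C (sg p y hp j η) * ∏ i ∈ Finset.univ.erase j, (X - C (y i))).coeff k = z := by
  let O := integralClosure ℤ (AdjoinRoot p)
  let r : O := ⟨AdjoinRoot.root p, hr⟩
  let qO : O[X] := pZ.map (algebraMap ℤ O) /ₘ (X - C r)
  have hroot : (pZ.map (algebraMap ℤ O)).IsRoot r := by
    rw [IsRoot, eval_map]
    apply Subtype.val_injective
    change (algebraMap O (AdjoinRoot p)) _ = (algebraMap O (AdjoinRoot p)) 0
    rw [hom_eval₂, map_zero]
    have h1 : eval₂ (AdjoinRoot.of p) (AdjoinRoot.root p) p = 0 := AdjoinRoot.eval₂_root p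
    have h2 : eval₂ (AdjoinRoot.of p) (AdjoinRoot.root p) (pZ.map (algebraMap ℤ ℚ)) = 0 :=
      (congrArg (eval₂ (AdjoinRoot.of p) (AdjoinRoot.root p)) hpm).trans h1
    rw [eval₂_map] at h2
    rw [← h2]
    congr 1
  have hq : (X - C r) * qO = pZ.map (algebraMap ℤ O) := mul_divByMonic_eq_iff_isRoot.2 hroot
  have hσ : ∀ j, (qO.map ((sg p y hp j).comp (algebraMap O (AdjoinRoot p)))) = ∏ i ∈ Finset.univ.erase j, (X - C (y i)) := by
    intro j
    have h1 := congrArg (Polynomial.map ((sg p y hp j).comp (algebraMap O (AdjoinRoot p)))) hq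
    rw [Polynomial.map_mul, Polynomial.map_sub, map_X, Polynomial.map_C, Polynomial.map_map] at h1
    have h2 : ((sg p y hp j).comp (algebraMap O (AdjoinRoot p))) r = y j := sg_root p y hp j
    have h3 : pZ.map (((sg p y hp j).comp (algebraMap O (AdjoinRoot p))).comp (algebraMap ℤ O)) = ∏ j, (X - C (y j)) := by
      have h4 := congrArg (Polynomial.map (algebraMap ℚ ℝ)) hpm
      rw [Polynomial.map_map] at h4
      rw [← hp, ← h4]
      congr 1; exact RingHom.ext_int _ _
    rw [h2, h3, ← Finset.mul_prod_erase _ _ (Finset.mem_univ j)] at h1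
    exact mul_left_cancel₀ (X_sub_C_ne_zero _) h1
  obtain ⟨z, hz⟩ := (sg_RE p y hp hinj).trace_int (hη.mul (qO.coeff k).2)
  refine ⟨z, ?_⟩
  rw [← hz, finset_sum_coeff]
  refine Finset.sum_congr rfl fun j _ => ?_
  rw [coeff_C_mul, ← hσ, coeff_map, map_mul]
  rfl

lemma sign_aux {η β : ℝ} {M d : ℕ} (hM : 0 < M) (h : η ^ M = β ^ d) : ∃ e : ℤˣ, η = ((e : ℤ) : ℝ) * |β| ^ ((d:ℝ) / M) := by
  have h1 : |η| = |β| ^ ((d:ℝ) / M) := by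
    have h2 : |η| ^ M = |β| ^ d := by rw [← abs_pow, h, abs_pow]
    rw [← Real.pow_rpow_inv_natCast (abs_nonneg η) hM.ne', h2, ← Real.rpow_natCast, ← Real.rpow_mul (abs_nonneg _)]
    rfl
  rw [← h1]
  rcases abs_choice η with h3 | h3
  · exact ⟨1, by simp [h3]⟩
  · exact ⟨-1, by simp [h3]⟩

section
variable {m ℓ : ℕ} {a : Fin m → ℤ}
variable {Ξ : Option (Fin m) → ℝ → ℝ} {c0 T1 : ℝ}

noncomputable def bf {m : ℕ} (ℓ : ℕ) (a : Fin m → ℤ) (Ξ : Option (Fin m) → ℝ → ℝ) (ν : ℕ) (νs : Fin m → ℕ) (j : Option (Fin m)) : ℝ → ℝ :=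
  fun τ => (xf ℓ a Ξ j τ) ^ ν * ∏ i, (xf ℓ a Ξ j τ - (a i : ℝ)) ^ νs i

noncomputable def ef {m : ℕ} (ℓ : ℕ) (a : Fin m → ℤ) (Ξ : Option (Fin m) → ℝ → ℝ) (ν : ℕ) (νs : Fin m → ℕ) (d : ℕ) (ε : Option (Fin m) → ℤˣ) (j : Option (Fin m)) : ℝ → ℝ :=
  fun τ => (((ε j : ℤˣ) : ℤ) : ℝ) * |bf ℓ a Ξ ν νs j τ| ^ ((d:ℝ) / ((ℓ * ν : ℕ) : ℝ))

def B4 {m : ℕ} (ℓ : ℕ) (a : Fin m → ℤ) (T1 : ℝ) (N : ℕ) : Set ℕ :=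
  {τ | T1 ≤ τ ∧ (∏ i, a i) ∣ (τ:ℤ) - 1 ∧ ∃ _ : Fact (Irreducible (pp a (tt ℓ a τ))), ∃ (ν : ℕ) (νs : Fin m → ℕ), 1 ≤ ν ∧ ν ≤ N ∧ (∀ i, νs i < ν * ℓ) ∧
        ∃ ζ : AlgebraicClosure (AdjoinRoot (pp a (tt ℓ a τ))),
          ζ ^ (ℓ * ν) =
            algebraMap (AdjoinRoot (pp a (tt ℓ a τ)))
                (AlgebraicClosure (AdjoinRoot (pp a (tt ℓ a τ))))
                (AdjoinRoot.root (pp a (tt ℓ a τ))) ^ ν *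
              ∏ i, (algebraMap (AdjoinRoot (pp a (tt ℓ a τ)))
                  (AlgebraicClosure (AdjoinRoot (pp a (tt ℓ a τ))))
                  (AdjoinRoot.root (pp a (tt ℓ a τ))) -
                (a i : AlgebraicClosure (AdjoinRoot (pp a (tt ℓ a τ))))) ^ (νs i) ∧
          Module.finrank (AdjoinRoot (pp a (tt ℓ a τ)))
            (IntermediateField.adjoin (AdjoinRoot (pp a (tt ℓ a τ))) {ζ}) < ℓ}

open Classical in
def BS {m : ℕ} (ℓ : ℕ) (a : Fin m → ℤ) (Ξ : Option (Fin m) → ℝ → ℝ) (ν : ℕ) (νs : Fin m → ℕ) (d : ℕ) (ε : Option (Fin m) → ℤˣ) : Set ℕ :=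
  {τ | ∀ k, ∃ z : ℤ, (∑ j, C (ef ℓ a Ξ ν νs d ε j τ) * ∏ i ∈ Finset.univ.erase j, (X - C (xf ℓ a Ξ i τ))).coeff k = z}

lemma B4_BS (hm : 0 < m) (hℓ : 1 ≤ ℓ) (hne : ∀ i, a i ≠ 0) (h : TD ℓ a Ξ c0 T1) {N τ : ℕ} (hτ : τ ∈ B4 ℓ a T1 N) :
    ∃ ν νs d ε, 1 ≤ ν ∧ ν ≤ N ∧ (∀ i, νs i < ν * ℓ) ∧ 1 ≤ d ∧ d < ℓ ∧ τ ∈ BS ℓ a Ξ ν νs d ε := by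
  classical
  obtain ⟨h1, h2, hF, ν, νs, hν, hνN, hνs, ζ, hζ, hd⟩ := hτ
  obtain ⟨hrd, -⟩ := h (τ:ℝ) (h1.trans (le_abs_self _))
  have hrd' : RD a (fun j => xf ℓ a Ξ j τ) ((tt ℓ a τ : ℤ) : ℝ)⁻¹ c0 := by rw [tt_ar hne h2]; exact hrd
  have hM : 0 < ℓ * ν := by positivity
  generalize hd' : Module.finrank (AdjoinRoot (pp a (tt ℓ a τ))) (IntermediateField.adjoin (AdjoinRoot (pp a (tt ℓ a τ))) {ζ}) = d at hd
  have h3 := norm_aux hM ((AdjoinRoot.root (pp a (tt ℓ a τ))) ^ ν * ∏ i, ((AdjoinRoot.root (pp a (tt ℓ a τ))) - (a i : AdjoinRoot (pp a (tt ℓ a τ)))) ^ νs i) ζ (by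
    rw [hζ]; simp)
  rw [hd'] at h3
  obtain ⟨hd1, η, hη⟩ := h3
  have hr := root_integral hm a (tt ℓ a τ)
  have hηi : IsIntegral ℤ η := by
    refine IsIntegral.of_pow hM ?_
    rw [hη]
    exact ((hr.pow _).mul (IsIntegral.prod _ fun i _ => (hr.sub (isIntegral_algebraMap (x := a i))).pow _)).pow _
  have hs : ∀ j, ∃ e : ℤˣ, sg _ _ (pp_map hrd') j η = ((e : ℤ) : ℝ) * |bf ℓ a Ξ ν νs j τ| ^ ((d:ℝ) / ((ℓ * ν : ℕ) : ℝ)) := by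
    intro j
    apply sign_aux hM
    rw [← map_pow, hη, map_pow, map_mul, map_pow, map_prod, sg_root]
    congr 1
    simp only [bf]
    congr 1
    refine Finset.prod_congr rfl fun i _ => ?_
    rw [map_pow, map_sub, sg_root, map_intCast]
  choose ε hε using hs
  refine ⟨ν, νs, d, ε, hν, hνN, hνs, hd1, hd, fun k => ?_⟩
  obtain ⟨z, hz⟩ := trace_aux _ _ (ppZ_map a (tt ℓ a τ)) hr _ (pp_map hrd') hrd'.inj η hηi k
  refine ⟨z, ?_⟩
  rw [← hz]
  refine congrArg (fun r => coeff r k) (Finset.sum_congr rfl fun j _ => ?_)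
  rw [hε]
  refine congrArg₂ _ rfl (Finset.prod_congr ?_ fun i _ => rfl)
  congr!
end
end

section
open Polynomial NumberField Filter Topology
set_option synthInstance.maxHeartbeats 1000000
set_option maxHeartbeats 1000000

lemma eval_lag {J : Type*} [Fintype J] [DecidableEq J] (e y : J → ℝ) (j : J) :
    eval (y j) (∑ k, C (e k) * ∏ i ∈ Finset.univ.erase k, (X - C (y i))) = e j * ∏ i ∈ Finset.univ.erase j, (y j - y i) := by
  rw [eval_finset_sum, Finset.sum_eq_single j]
  · simp [eval_prod]
  · intro k _ hk
    rw [eval_mul, eval_prod, Finset.prod_eq_zero (i := j), mul_zero]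
    · simp [hk.symm]
    · simp
  · simp

lemma eval_der {J : Type*} [Fintype J] [DecidableEq J] (y : J → ℝ) (j : J) :
    eval (y j) (derivative (∏ i, (X - C (y i)))) = ∏ i ∈ Finset.univ.erase j, (y j - y i) := by
  have := eval_lag (fun _ => 1) y j
  rw [one_mul] at this
  rw [← this, derivative_prod_finset]
  simp

section
variable {m ℓ : ℕ} {a : Fin m → ℤ}
variable {Ξ : Option (Fin m) → ℝ → ℝ} {c0 T1 : ℝ}

lemma gp_monic (hm : 0 < m) : (gp ℓ a).Monic := by
  have h1 : (∏ i, (X - C (C (a i : ℚ))) : ℚ[X][X]).Monic := monic_prod_of_monic _ _ fun i _ => monic_X_sub_C _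
  have h2 : (∏ i, (X - C (C (a i : ℚ))) : ℚ[X][X]).natDegree = m := by
    rw [natDegree_prod_of_monic _ _ fun i _ => monic_X_sub_C _]
    simp only [natDegree_X_sub_C, Finset.sum_const, Finset.card_univ, Fintype.card_fin, smul_eq_mul, mul_one]
  have h3 := h1.mul (monic_X_sub_C (arP ℓ a))
  refine h3.sub_of_left ?_
  rw [degree_one, degree_eq_natDegree h3.ne_zero, h1.natDegree_mul (monic_X_sub_C _), h2, natDegree_X_sub_C]
  exact_mod_cast Nat.succ_pos m

lemma bf_EE (hX : ∀ j, xf ℓ a Ξ j ∈ EE 1 one_pos) (ν νs j) : bf ℓ a Ξ ν νs j ∈ EE 1 one_pos := by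
  have : bf ℓ a Ξ ν νs j = (xf ℓ a Ξ j) ^ ν * ∏ i, (xf ℓ a Ξ j - fun _ => (a i : ℝ)) ^ νs i := by
    ext τ; simp [bf, Finset.prod_apply]
  rw [this]
  exact mul_mem (pow_mem (hX j) _) (prod_mem fun i _ => pow_mem (sub_mem (hX j) (const_mem_EE _ _)) _)

lemma ef_EE (hX : ∀ j, xf ℓ a Ξ j ∈ EE 1 one_pos) {ν νs d ε} (hM : 0 < ℓ * ν) (j) : ef ℓ a Ξ ν νs d ε j ∈ EE (ℓ * ν) hM := by
  exact mul_mem (const_mem_EE hM (((ε j : ℤˣ) : ℤ) : ℝ)) (EE_root_pow hM d (bf_EE hX ν νs j))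

lemma ef_pow {ν νs d ε} (hM : 0 < ℓ * ν) (j) (τ : ℝ) : (ef ℓ a Ξ ν νs d ε j τ) ^ (2 * ℓ * ν) = (bf ℓ a Ξ ν νs j τ) ^ (2 * d) := by
  have h1 : ((((ε j : ℤˣ) : ℤ) : ℝ)) ^ 2 = 1 := by
    rcases Int.units_eq_one_or (ε j) with h | h <;> simp [h]
  rw [ef, mul_assoc 2, pow_mul, mul_pow, h1, one_mul, ← pow_mul, mul_comm 2, pow_mul, ← Real.rpow_mul_natCast (abs_nonneg _),
    div_mul_cancel₀ _ (by exact_mod_cast hM.ne'), Real.rpow_natCast, ← pow_mul, mul_comm d, pow_mul, sq_abs, ← pow_mul]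

lemma DZ_BS (hm : 0 < m) (hℓ : 1 ≤ ℓ) (hne : ∀ i, a i ≠ 0) (h : TD ℓ a Ξ c0 T1)
    (hΞ : ∀ i, AnalyticAt ℝ (Ξ (some i)) 0) (hΞn : ∀ z, Ξ none z = z⁻¹ + ∑ i, (a i : ℝ) - ∑ i, Ξ (some i) z)
    (hsep0 : (mainPolyZero (m+1) ℓ a).Separable) {ν d : ℕ} (νs : Fin m → ℕ) (hν : 1 ≤ ν) (hd : 1 ≤ d) (hdℓ : d < ℓ) (ε) :
    DZ (BS ℓ a Ξ ν νs d ε) := by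
  classical
  by_contra hB
  have hM : 0 < ℓ * ν := by positivity
  have hX : ∀ j, xf ℓ a Ξ j ∈ EE 1 one_pos := EE_xi hℓ hne hΞ hΞn
  obtain ⟨S, hS⟩ : ∃ S : (ℝ → ℝ)[X], S = ∑ j, C (ef ℓ a Ξ ν νs d ε j) * ∏ i ∈ Finset.univ.erase j, (X - C (xf ℓ a Ξ i)) := ⟨_, rfl⟩
  have hSτ : ∀ τ : ℝ, S.map (evR τ) = ∑ j, C (ef ℓ a Ξ ν νs d ε j τ) * ∏ i ∈ Finset.univ.erase j, (X - C (xf ℓ a Ξ i τ)) := by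
    intro τ
    rw [hS]
    simp only [Polynomial.map_sum, Polynomial.map_mul, Polynomial.map_C, Polynomial.map_prod, Polynomial.map_sub, map_X]
    rfl
  have hSE : ∀ k, S.coeff k ∈ EE (ℓ * ν) hM := by
    intro k
    let S' : (EE (ℓ * ν) hM)[X] := ∑ j, C ⟨ef ℓ a Ξ ν νs d ε j, ef_EE hX hM j⟩ * ∏ i ∈ Finset.univ.erase j, (X - C ⟨xf ℓ a Ξ i, EE_lift hM (hX i)⟩)
    have : S = S'.map (EE (ℓ * ν) hM).subtype := by
      rw [hS]
      simp only [S', Polynomial.map_sum, Polynomial.map_mul, Polynomial.map_C, Polynomial.map_prod, Polynomial.map_sub, map_X]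
      rfl
    rw [this, coeff_map]
    exact (S'.coeff k).2
  have hco : ∀ k, ∃ P : ℚ[X], ∀ᶠ τ : ℝ in atTop, S.coeff k τ = aeval τ P := by
    intro k
    refine integral_values hM hB (hSE k) ?_
    intro τ hτ
    obtain ⟨z, hz⟩ := hτ k
    refine ⟨z, ?_⟩
    rw [← hz]
    have := congrArg (fun r => coeff r k) (hSτ τ)
    rw [coeff_map] at this
    refine Eq.trans this ?_
    congr!
  choose P hP using hco
  obtain ⟨Q, hQ⟩ : ∃ Q : ℚ[X][X], Q = ∑ k ∈ Finset.range (S.natDegree + 1), C (P k) * X ^ k := ⟨_, rfl⟩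
  have hQS : ∀ᶠ τ : ℝ in atTop, (Q.map polyFun).map (evR τ) = S.map (evR τ) := by
    have : ∀ᶠ τ : ℝ in atTop, ∀ k ∈ Finset.range (S.natDegree + 1), S.coeff k τ = aeval τ (P k) :=
      (Finset.eventually_all _).2 fun k _ => hP k
    filter_upwards [this] with τ hτ
    conv_rhs => rw [S.as_sum_range_C_mul_X_pow]
    rw [hQ]
    simp only [Polynomial.map_sum, Polynomial.map_mul, Polynomial.map_pow, map_X, Polynomial.map_C]
    refine Finset.sum_congr rfl fun k hk => ?_
    congr 2
    exact (hτ k hk).symm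
  refine kummer hm hne hsep0 hℓ νs hν hd hdℓ Q ?_
  have hmon := gp_monic (ℓ := ℓ) (a := a) hm
  rw [← modByMonic_eq_zero_iff_dvd hmon]
  generalize hW : Q ^ (2 * ℓ * ν) - (X ^ ν * ∏ i, (X - C (C (a i : ℚ))) ^ νs i) ^ (2 * d) * (derivative (gp ℓ a)) ^ (2 * ℓ * ν) = W
  ext1 k
  rw [coeff_zero]
  apply poly_zero_of_eventually
  filter_upwards [hQS, gp_prod h, eventually_ge_atTop T1] with τ h1 h2 h3
  obtain ⟨hrd, -⟩ := h τ (h3.trans (le_abs_self _))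
  have h4 : (((W %ₘ gp ℓ a).map polyFun).map (evR τ)) = 0 := by
    rw [map_modByMonic _ hmon, map_modByMonic _ (hmon.map _), modByMonic_eq_zero_iff_dvd ((hmon.map _).map _)]
    have h2' : ((gp ℓ a).map polyFun).map (evR τ) = ∏ j, (X - C (xf ℓ a Ξ j τ)) := by
      rw [h2]
      simp only [Polynomial.map_prod, Polynomial.map_sub, map_X, Polynomial.map_C]
      rfl
    rw [h2']
    refine Finset.prod_dvd_of_coprime (fun i _ j _ hij => pairwise_coprime_X_sub_C hrd.inj hij) fun j _ => ?_
    rw [dvd_iff_isRoot, IsRoot, ← hW]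
    simp only [Polynomial.map_sub, Polynomial.map_mul, Polynomial.map_pow, Polynomial.map_prod, map_X, Polynomial.map_C, ← derivative_map, h2', h1, hSτ]
    rw [eval_sub, eval_mul, eval_pow, eval_pow, eval_pow, eval_der (fun j => xf ℓ a Ξ j τ) j, eval_lag (fun j => ef ℓ a Ξ ν νs d ε j τ) (fun j => xf ℓ a Ξ j τ) j, mul_pow, ef_pow hM, sub_eq_zero]
    congr 2
    simp [eval_prod, bf]
  have h5 := congrArg (fun r => coeff r k) h4
  have h6 : polyFun ((W %ₘ gp ℓ a).coeff k) τ = 0 := by simpa [coeff_map] using h5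
  exact h6

lemma DZ_B4 (hm : 0 < m) (hℓ : 1 ≤ ℓ) (hne : ∀ i, a i ≠ 0) (h : TD ℓ a Ξ c0 T1)
    (hΞ : ∀ i, AnalyticAt ℝ (Ξ (some i)) 0) (hΞn : ∀ z, Ξ none z = z⁻¹ + ∑ i, (a i : ℝ) - ∑ i, Ξ (some i) z)
    (hsep0 : (mainPolyZero (m+1) ℓ a).Separable) (N : ℕ) : DZ (B4 ℓ a T1 N) := by
  let I := {p : (Fin (N + 1)) × (Fin m → Fin (N * ℓ + 1)) × (Fin ℓ) × (Option (Fin m) → ℤˣ) // 1 ≤ (p.1 : ℕ) ∧ 1 ≤ (p.2.2.1 : ℕ)}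
  refine DZ.mono (B := ⋃ p : I, BS ℓ a Ξ p.1.1 (fun i => p.1.2.1 i) p.1.2.2.1 p.1.2.2.2) ?_ ?_
  · exact DZ.iUnion fun p => DZ_BS hm hℓ hne h hΞ hΞn hsep0 _ p.2.1 p.2.2 p.1.2.2.1.2 _
  · intro τ hτ
    obtain ⟨ν, νs, d, ε, h1, h2, h3, h4, h5, h6⟩ := B4_BS hm hℓ hne h hτ
    refine Set.mem_iUnion.2 ⟨⟨⟨⟨ν, by omega⟩, fun i => ⟨νs i, ?_⟩, ⟨d, h5⟩, ε⟩, h1, h4⟩, h6⟩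
    have := h3 i
    have := Nat.mul_le_mul_right ℓ h2
    omega
end
end

section
open Polynomial NumberField Filter Topology
set_option synthInstance.maxHeartbeats 1000000
set_option maxHeartbeats 1000000

section
variable {m ℓ : ℕ} {a : Fin m → ℤ}
variable {Ξ : Option (Fin m) → ℝ → ℝ} {c0 T1 : ℝ}

lemma reps {α : Type*} [DecidableEq α] (G : Finset α) (s : Setoid α) (M : ℕ) (h : ∀ x ∈ G, ∀ S ⊆ G, x ∈ S → (∀ y ∈ S, s y x) → S.card ≤ M) :
    ∃ (k : ℕ) (t : Fin k → α), G.card ≤ M * k ∧ (∀ j, t j ∈ G) ∧ ∀ i j, i ≠ j → ¬ s (t i) (t j) := by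
  classical
  let f : α → Quotient s := Quotient.mk s
  have h1 := Finset.card_le_mul_card_image (f := f) G M (by
    intro c hc
    obtain ⟨x, hx, rfl⟩ := Finset.mem_image.1 hc
    refine h x hx _ (Finset.filter_subset _ _) (by simp [hx]) ?_
    intro y hy
    exact Quotient.exact (Finset.mem_filter.1 hy).2)
  let e := (G.image f).equivFin.symm
  have h2 : ∀ j, ∃ x ∈ G, f x = (e j).1 := fun j => Finset.mem_image.1 (e j).2
  choose t ht hft using h2
  refine ⟨_, t, h1, ht, fun i j hij hs => hij ?_⟩
  apply e.injective
  apply Subtype.ext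
  rw [← hft, ← hft]
  exact Quotient.sound hs

lemma q_aux (hne : ∀ i, a i ≠ 0) (hsep0 : (mainPolyZero (m+1) ℓ a).Separable) (hℓ : 1 ≤ ℓ) :
    ∃ q : ℕ, 0 < q ∧ ∀ τ : ℤ, (q : ℤ) ∣ τ - 1 → (∏ i, a i) ∣ τ - 1 ∧ ∀ Dz : ℤ, (Dz : ℚ) = (∏ i, ((a i : ℤ) : ℚ)) *
        ((mainPolyZero (m+1) ℓ a).derivative.eval 0) → Int.gcd τ Dz = 1 := by
  have hA0 : (∏ i, a i) ≠ 0 := Finset.prod_ne_zero_iff.2 fun i _ => hne i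
  have hA1 : (∏ i, (a i : ℚ)) ≠ 0 := Finset.prod_ne_zero_iff.2 fun i _ => by exact_mod_cast hne i
  have hr : aeval (0:ℚ) (mainPolyZero (m+1) ℓ a) = 0 := by
    have h2 : ((-1:ℚ)) ^ m * (-1) ^ m = 1 := by rw [← mul_pow]; simp
    have h3 : ∏ i, (-(a i : ℚ)) = (-1) ^ m * ∏ i, (a i : ℚ) := by simp [Finset.prod_neg]
    rw [coe_aeval_eq_eval, mainPolyZero, zero_pow (by omega)]
    simp only [eval_sub, eval_mul, eval_X, eval_C, eval_one, eval_prod, zero_sub]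
    change (∏ i : Fin m, (-(a i : ℚ))) * _ - 1 = 0
    rw [h3]
    push_cast
    change (-1) ^ m * (∏ i, (a i : ℚ)) * -((-1) ^ m * -1 / (∏ i : Fin m, (a i : ℚ))) - 1 = 0
    field_simp
    linear_combination h2
  have hD : (∏ i, ((a i : ℤ) : ℚ)) * ((mainPolyZero (m+1) ℓ a).derivative.eval 0) ≠ 0 := by
    refine mul_ne_zero hA1 ?_
    have := hsep0.aeval_derivative_ne_zero hr
    rwa [coe_aeval_eq_eval] at this
  by_cases hex : ∃ Dz : ℤ, (Dz : ℚ) = (∏ i, ((a i : ℤ) : ℚ)) * ((mainPolyZero (m+1) ℓ a).derivative.eval 0)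
  · obtain ⟨Dz, hDz⟩ := hex
    have hD0 : Dz ≠ 0 := by rintro rfl; rw [← hDz] at hD; simp at hD
    refine ⟨((∏ i, a i) * Dz).natAbs, Int.natAbs_pos.2 (mul_ne_zero hA0 hD0), fun τ hτ => ?_⟩
    rw [Int.natAbs_dvd] at hτ
    refine ⟨(Dvd.intro _ rfl).trans hτ, fun Dz' h' => ?_⟩
    have : Dz' = Dz := by rw [← hDz] at h'; exact_mod_cast h'
    subst this
    have h1 : Dz' ∣ τ - 1 := (Dvd.intro_left _ rfl).trans hτ
    have h2 : ((Int.gcd τ Dz' : ℕ) : ℤ) ∣ 1 := by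
      have h3 := (Int.gcd_dvd_right τ Dz').trans h1
      have h4 := dvd_sub (Int.gcd_dvd_left τ Dz') h3
      simpa using h4
    have := Int.natAbs_dvd_natAbs.2 h2
    simpa using this
  · refine ⟨(∏ i, a i).natAbs, Int.natAbs_pos.2 hA0, fun τ hτ => ?_⟩
    rw [Int.natAbs_dvd] at hτ
    exact ⟨hτ, fun Dz h' => (hex ⟨Dz, h'⟩).elim⟩

lemma class_bound (hm : 0 < m) (hℓ : 1 ≤ ℓ) (hne : ∀ i, a i ≠ 0) (hT1 : 2 ≤ T1) (hc0 : 0 ≤ c0) (h : TD ℓ a Ξ c0 T1) :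
    ∃ M : ℕ, 0 < M ∧ ∀ (S : Finset ℤ) (τ0 : ℤ), τ0 ∈ S →
      (∀ τ ∈ S, T1 ≤ τ ∧ (τ:ℝ) ≤ 2 * τ0 ∧ (∏ i, a i) ∣ τ - 1 ∧ Irreducible (pp a (tt ℓ a τ))) →
      (2:ℝ) ^ ((m+1)*m*(m+3)) ≤ τ0 → Nonempty ((pp a (tt ℓ a τ0)).Gal ≃* Equiv.Perm (Fin (m+1))) →
      (∀ [Fact (Irreducible (pp a (tt ℓ a τ0)))], (τ0:ℝ) ^ ((2:ℝ) / (((m+1:ℕ):ℝ) + 2)) < |(NumberField.discr (AdjoinRoot (pp a (tt ℓ a τ0))) : ℝ)|) →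
      (∀ τ ∈ S, Nonempty (AdjoinRoot (pp a (tt ℓ a τ)) ≃+* AdjoinRoot (pp a (tt ℓ a τ0)))) → S.card ≤ M := by
  let κ : ℝ := 1 / (((m:ℝ) + 1) * m * (m + 3))
  have hm' : (0:ℝ) < m := by exact_mod_cast hm
  have hκ : 0 < κ := by positivity
  let V : ℝ := 2 * (8 * ℓ / κ + 2) ^ (m + 1)
  refine ⟨⌊V⌋₊ + 1, by omega, fun S τ0 h0 hS h2 hG hdisc hiso => ?_⟩
  obtain ⟨ht1, -, hdvd, hirr⟩ := hS τ0 h0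
  haveI : Fact (Irreducible (pp a (tt ℓ a τ0))) := ⟨hirr⟩
  have hdisc' := hdisc
  have ht2 : (2:ℝ) ≤ τ0 := hT1.trans ht1
  obtain ⟨hrd, -⟩ := h (τ0:ℝ) (ht1.trans (le_abs_self _))
  have hrd' : RD a (fun j => xf ℓ a Ξ j τ0) ((tt ℓ a τ0 : ℤ) : ℝ)⁻¹ c0 := by rw [tt_ar hne hdvd]; exact hrd
  have hlog : 0 < Real.log τ0 := Real.log_pos (by linarith)
  have hlog2 : Real.log (2 * τ0) ≤ 2 * Real.log τ0 := by
    rw [Real.log_mul (by norm_num) (by linarith)]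
    have := Real.log_le_log (by norm_num) ht2
    linarith
  have hcard : Fintype.card (Option (Fin m)) = m + 1 := by simp
  have hb := mult hm hℓ hne hT1 hc0 h (T := 2 * τ0) S (fun τ hτ => ⟨(hS τ hτ).1, (hS τ hτ).2.1, (hS τ hτ).2.2.1⟩) (fun τ hτ => (hS τ hτ).2.2.2)
    (sg _ _ (pp_map hrd')) hiso (δ := κ * Real.log τ0) (by positivity) (by
      intro u hu
      refine (sg_RE _ _ (pp_map hrd') hrd'.inj).sep2 (sg_T2 _ _ (pp_map hrd') hrd'.inj hG hcard) (fun j => (hu j).le) ?_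
      rw [hcard, Nat.add_sub_cancel]
      exact (sep_ineq hm h2).trans_lt hdisc') (by linarith)
  have hV : (S.card : ℝ) ≤ V := by
    refine hb.trans ?_
    rw [hcard]
    have hlg0 : 0 ≤ Real.log (2 * τ0) := Real.log_nonneg (by linarith)
    have : 2 * (2 * ℓ * Real.log (2 * τ0)) / (κ * Real.log τ0) ≤ 8 * ℓ / κ := by
      rw [div_le_div_iff₀ (by positivity) hκ]
      have hl0 : (0:ℝ) ≤ ℓ := by positivity
      nlinarith [mul_le_mul_of_nonneg_left hlog2 (mul_nonneg hl0 hκ.le)]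
    simp only [V]
    gcongr
  have := Nat.lt_floor_add_one V
  have h5 : (S.card : ℝ) < ((⌊V⌋₊ + 1 : ℕ) : ℝ) := by push_cast; linarith
  exact_mod_cast h5.le
end
end

section
open Polynomial NumberField Filter Topology
set_option synthInstance.maxHeartbeats 1000000
set_option maxHeartbeats 1000000

section
variable {m ℓ : ℕ} {a : Fin m → ℤ}
variable {Ξ : Option (Fin m) → ℝ → ℝ} {c0 T1 : ℝ}

lemma good_K (hm : 0 < m) (hℓ : 1 ≤ ℓ) (hinj : Function.Injective a) (hne : ∀ i, a i ≠ 0)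
    (hGal : Nonempty ((mainPoly (m+1) ℓ a).Gal ≃* Equiv.Perm (Fin (m+1))))
    (hsep0 : (mainPolyZero (m+1) ℓ a).Separable) (N T0 : ℕ) :
    ∃ (q M K0 : ℕ) (C1 : ℝ), 0 < q ∧ 0 < M ∧ 0 < C1 ∧ ∀ K : ℕ, K0 ≤ K → ∃ (k : ℕ) (t : Fin k → ℤ), (K:ℝ) / 2 ≤ M * k ∧
      (∀ j, Suitable (m+1) ℓ a N T0 (t j)) ∧
      (∀ i j, i ≠ j → IsEmpty (AdjoinRoot (pp a (tt ℓ a (t i))) ≃+* AdjoinRoot (pp a (tt ℓ a (t j))))) ∧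
      (∀ j, ∀ [Fact (Irreducible (pp a (tt ℓ a (t j))))],
              |(NumberField.discr (AdjoinRoot (pp a (tt ℓ a (t j)))) : ℝ)| ≤ C1 * (2 * q * K) ^ (2 * ℓ * m)) := by
  classical
  obtain ⟨Ξ, c0, T1, hc0, hT1, hΞ, hΞn, h⟩ := tau_data hm hℓ hinj hne
  replace h : TD ℓ a Ξ c0 T1 := h
  obtain ⟨q, hq, hqp⟩ := q_aux hne hsep0 hℓ
  obtain ⟨M, hM, hMb⟩ := class_bound hm hℓ hne hT1 hc0 h
  obtain ⟨C1, hC1, hdb⟩ := disc_bound hm hne hc0 h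
  obtain ⟨B, hBd⟩ : ∃ B, B = (B2 ℓ a T1 ∪ B3 ℓ a T1) ∪ B4 ℓ a T1 N := ⟨_, rfl⟩
  have hB : DZ B := hBd ▸ ((DZ_B2 hm hℓ hne h hΞ hΞn hGal).union (DZ_B3 hm hℓ hne hT1 hc0 h)).union (DZ_B4 hm hℓ hne h hΞ hΞn hsep0 N)
  have hq' : (1:ℝ) ≤ q := by exact_mod_cast hq
  obtain ⟨TT, hTT⟩ := eventually_atTop.1 (hB (1 / (6 * q)) (by positivity))
  refine ⟨q, M, TT + ⌈T1⌉₊ + T0 + 2 ^ ((m+1)*m*(m+3)) + 1, C1, hq, hM, hC1, fun K hK => ?_⟩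
  obtain ⟨hK_TT, hK_T1, hK_T0, hK_p⟩ : TT ≤ K ∧ ⌈T1⌉₊ ≤ K ∧ T0 ≤ K ∧ 2 ^ ((m+1)*m*(m+3)) ≤ K := by
    clear * - hK
    generalize 2 ^ ((m+1)*m*(m+3)) = z at *
    refine ⟨by omega, by omega, by omega, by omega⟩
  clear hK
  have hK1 : T1 ≤ K := (Nat.le_ceil T1).trans (by exact_mod_cast hK_T1)
  have hKq : K ≤ q * K := Nat.le_mul_of_pos_left K hq
  let P : Finset ℕ := (Finset.Ico K (2 * K)).image fun k => q * k + 1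
  have hPc : P.card = K := by
    rw [Finset.card_image_of_injective]
    · simp; omega
    · intro x y hxy
      simpa [hq.ne'] using hxy
  have hPm : ∀ τ ∈ P, q * K + 1 ≤ τ ∧ τ ≤ 2 * q * K ∧ (q:ℤ) ∣ (τ:ℤ) - 1 := by
    intro τ hτ
    obtain ⟨k, hk, rfl⟩ := Finset.mem_image.1 hτ
    rw [Finset.mem_Ico] at hk
    refine ⟨?_, ?_, by simp⟩
    · have := Nat.mul_le_mul_left q hk.1; omega
    · have h1 := Nat.mul_le_mul_left q (show k + 1 ≤ 2 * K by omega)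
      have h2 : q * (2 * K) = 2 * q * K := by ring
      rw [h2, mul_add] at h1; omega
  let G : Finset ℕ := P.filter (· ∉ B)
  have hGc : (K:ℝ) / 2 ≤ G.card := by
    have h1 : (P.filter (· ∈ B)).card ≤ cnt B (2 * q * K + 1) := by
      refine Finset.card_le_card fun τ hτ => ?_
      rw [Finset.mem_filter] at hτ
      have := hPm τ hτ.1
      have h2 : τ ∈ (Finset.range (2 * q * K + 1)).filter (· ∈ B) := by
        rw [Finset.mem_filter, Finset.mem_range]; exact ⟨by omega, hτ.2⟩
      convert h2
    have hqK : 2 * q * K = 2 * (q * K) := by ring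
    have h2 := hTT (2 * q * K + 1) (by omega)
    have h3 := Finset.card_filter_add_card_filter_not (s := P) (· ∈ B)
    rw [hPc] at h3
    have h3' : ((P.filter (· ∈ B)).card : ℝ) + (G.card : ℝ) = K := by exact_mod_cast h3
    have h1' : ((P.filter (· ∈ B)).card : ℝ) ≤ cnt B (2 * q * K + 1) := by exact_mod_cast h1
    have h4 : 1 / (6 * (q:ℝ)) * ((2 * q * K + 1 : ℕ) : ℝ) ≤ K / 2 := by
      rw [div_mul_eq_mul_div, div_le_iff₀ (by positivity)]
      push_cast
      have : (1:ℝ) ≤ K := by linarith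
      nlinarith
    linarith
  -- properties of good elements
  have hgood : ∀ τ ∈ G, T1 ≤ (τ:ℝ) ∧ K ≤ τ ∧ τ ≤ 2 * q * K ∧ (q:ℤ) ∣ (τ:ℤ) - 1 ∧ (∏ i, a i) ∣ (τ:ℤ) - 1 ∧
      Nonempty ((pp a (tt ℓ a τ)).Gal ≃* Equiv.Perm (Fin (m+1))) ∧ Irreducible (pp a (tt ℓ a τ)) ∧ τ ∉ B3 ℓ a T1 ∧ τ ∉ B4 ℓ a T1 N := by
    intro τ hτ
    rw [Finset.mem_filter] at hτ
    obtain ⟨h1, h2, h3⟩ := hPm τ hτ.1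
    have hd := (hqp τ h3).1
    have hτT : T1 ≤ (τ:ℝ) := hK1.trans (by exact_mod_cast (by omega : K ≤ τ))
    rw [hBd, Set.mem_union, Set.mem_union, not_or, not_or] at hτ
    have hgal : Nonempty ((pp a (tt ℓ a τ)).Gal ≃* Equiv.Perm (Fin (m+1))) := by
      by_contra hc
      exact hτ.2.1.1 ⟨hτT, hd, hc⟩
    obtain ⟨hrd, -⟩ := h (τ:ℝ) (hτT.trans (le_abs_self _))
    have hrd' : RD a (fun j => xf ℓ a Ξ j τ) ((tt ℓ a τ : ℤ) : ℝ)⁻¹ c0 := by rw [tt_ar hne hd]; exact hrd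
    exact ⟨hτT, by omega, h2, h3, hd, hgal, irr_aux _ _ (pp_map hrd') hrd'.inj hgal (by simp), hτ.2.1.2, hτ.2.2⟩
  have hdisc : ∀ τ ∈ G, ∀ [Fact (Irreducible (pp a (tt ℓ a τ)))],
      ((τ:ℤ):ℝ) ^ ((2:ℝ) / (((m+1:ℕ):ℝ) + 2)) < |(NumberField.discr (AdjoinRoot (pp a (tt ℓ a τ))) : ℝ)| := by
    intro τ hτ hF
    obtain ⟨h1, h2, h3, h4, h5, h6, h7, h8, h9⟩ := hgood τ hτ
    by_contra! hc
    refine h8 ⟨h1, h5, hF, ?_⟩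
    rw [Int.cast_natCast] at hc
    exact hc
  let s : Setoid ℕ := ⟨fun x y => Nonempty (AdjoinRoot (pp a (tt ℓ a x)) ≃+* AdjoinRoot (pp a (tt ℓ a y))),
    fun x => ⟨RingEquiv.refl _⟩, fun ⟨e⟩ => ⟨e.symm⟩, fun ⟨e⟩ ⟨f⟩ => ⟨e.trans f⟩⟩
  obtain ⟨k, t, hk, htG, hts⟩ := reps G s M (by
    intro x hx S hSG hxS hS
    have hx' := hgood x hx
    have hc : (S.map (Nat.castEmbedding (R := ℤ))).card ≤ M := by
      refine hMb _ (x:ℤ) (by simpa using hxS) ?_ ?_ hx'.2.2.2.2.2.1 (hdisc x hx) ?_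
      · intro τ hτ
        obtain ⟨y, hy, rfl⟩ := Finset.mem_map.1 hτ
        obtain ⟨h1, h2, h3, h4, h5, h6, h7, h8, h9⟩ := hgood y (hSG hy)
        refine ⟨by simpa using h1, ?_, h5, h7⟩
        have h10 := hPm x (Finset.mem_filter.1 hx).1
        have : y ≤ 2 * x := by
          have : 2 * q * K = 2 * (q * K) := by ring
          omega
        simp only [Nat.castEmbedding_apply, Int.cast_natCast]
        exact_mod_cast this
      · have : 2 ^ ((m+1)*m*(m+3)) ≤ x := hK_p.trans hx'.2.1
        rw [Int.cast_natCast]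
        exact_mod_cast this
      · intro τ hτ
        obtain ⟨y, hy, rfl⟩ := Finset.mem_map.1 hτ
        exact hS y hy
    simpa using hc)
  refine ⟨k, fun j => (t j : ℤ), ?_, ?_, ?_, ?_⟩
  · refine hGc.trans ?_
    exact_mod_cast hk
  · intro j
    obtain ⟨h1, h2, h3, h4, h5, h6, h7, h8, h9⟩ := hgood _ (htG j)
    refine ⟨?_, h5, (hqp _ h4).2, h6, ?_⟩
    · rw [Nat.abs_cast]; exact_mod_cast (hK_T0.trans h2)
    · intro hF
      have hF' : Fact (Irreducible (pp a (tt ℓ a (t j)))) := hF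
      refine ⟨?_, ?_⟩
      · have := hdisc _ (htG j)
        rw [abs_of_nonneg (a := (((t j : ℕ) : ℤ) : ℝ)) (by positivity)]
        exact this
      · intro ν νs hν hνN hνs ζ hζ
        by_contra! hc
        exact h9 ⟨h1, h5, hF', ν, νs, hν, hνN, hνs, ζ, hζ, hc⟩
  · intro i j hij
    rw [← not_nonempty_iff]
    exact hts i j hij
  · intro j hF
    obtain ⟨h1, h2, h3, h4, h5, h6, h7, h8, h9⟩ := hgood _ (htG j)
    refine (hdb (t j) (by rw [Int.cast_natCast, Nat.abs_cast]; exact h1) h5).trans ?_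
    rw [Int.cast_natCast, Nat.abs_cast]
    have : ((t j : ℕ) : ℝ) ≤ 2 * q * K := by exact_mod_cast h3
    gcongr

lemma main_m (hm : 0 < m) (hℓ : 1 ≤ ℓ) (hinj : Function.Injective a) (hne : ∀ i, a i ≠ 0)
    (hGal : Nonempty ((mainPoly (m+1) ℓ a).Gal ≃* Equiv.Perm (Fin (m+1))))
    (hsep0 : (mainPolyZero (m+1) ℓ a).Separable) :
    ∃ N T₀ : ℕ, Admissible (m+1) ℓ a N T₀ ∧
      ∃ c X₁ : ℝ, 0 < c ∧ 0 < X₁ ∧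
        ∀ X : ℝ, X₁ < X →
          ∃ (k : ℕ) (τ : Fin k → ℤ),
            c * X ^ ((1 : ℝ) / (2 * (ℓ : ℝ) * (((m + 1 : ℕ) : ℝ) - 1))) ≤ (k : ℝ) ∧
            (∀ j, Suitable (m+1) ℓ a N T₀ (τ j)) ∧
            (∀ j k, j ≠ k →
              IsEmpty (AdjoinRoot (specPolyQ (m+1) ℓ a (τ j)) ≃+*
                AdjoinRoot (specPolyQ (m+1) ℓ a (τ k)))) ∧
            (∀ j, ∀ [Fact (Irreducible (specPolyQ (m+1) ℓ a (τ j)))],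
              |(NumberField.discr (AdjoinRoot (specPolyQ (m+1) ℓ a (τ j))) : ℝ)| ≤ X) := by
  obtain ⟨N, T0, hadm⟩ := admissible hm hℓ hinj hne
  obtain ⟨q, M, K0, C1, hq, hM, hC1, hmain⟩ := good_K hm hℓ hinj hne hGal hsep0 N T0
  refine ⟨N, T0, hadm, ?_⟩
  have hE : 0 < 2 * ℓ * m := by positivity
  have hEe : (1 : ℝ) / (2 * (ℓ : ℝ) * (((m + 1 : ℕ) : ℝ) - 1)) = ((2 * ℓ * m : ℕ) : ℝ)⁻¹ := by
    push_cast; rw [one_div]; congr 1; ring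
  rw [hEe]
  obtain ⟨E, hEd⟩ : ∃ E, E = 2 * ℓ * m := ⟨_, rfl⟩
  rw [← hEd] at hE hmain ⊢
  have hq' : (0:ℝ) < q := by exact_mod_cast hq
  have hM' : (0:ℝ) < M := by exact_mod_cast hM
  have hEr : (0:ℝ) < (E:ℝ)⁻¹ := by positivity
  let Y : ℝ := 4 * q * (K0 + 1)
  have hY : 0 < Y := by positivity
  refine ⟨C1⁻¹ ^ (E:ℝ)⁻¹ / (8 * q * M), C1 * Y ^ E, by positivity, by positivity, fun X hX => ?_⟩
  have hX0 : 0 < X := lt_trans (by positivity) hX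
  obtain ⟨T, hT⟩ : ∃ T, T = (X / C1) ^ (E:ℝ)⁻¹ := ⟨_, rfl⟩
  have hT0 : 0 ≤ T := by rw [hT]; positivity
  have hTE : T ^ E = X / C1 := by rw [hT]; exact Real.rpow_inv_natCast_pow (by positivity) hE.ne'
  have hTY : Y ≤ T := by
    have : Y ^ E ≤ T ^ E := by
      rw [hTE, le_div_iff₀ hC1]; linarith
    exact le_of_pow_le_pow_left₀ hE.ne' hT0 this
  obtain ⟨K, hK⟩ : ∃ K, K = ⌊T / (2 * q)⌋₊ := ⟨_, rfl⟩
  have hK1 : (K:ℝ) ≤ T / (2 * q) := hK ▸ Nat.floor_le (by positivity)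
  have hK2 : T / (2 * q) < K + 1 := hK ▸ Nat.lt_floor_add_one _
  rw [le_div_iff₀ (by positivity)] at hK1
  rw [div_lt_iff₀ (by positivity)] at hK2
  have hKK : (K0:ℝ) ≤ K := by
    have h1 : 4 * (q:ℝ) * (K0 + 1) < (K + 1) * (2 * q) := lt_of_le_of_lt hTY hK2
    have h2 : (2 * (q:ℝ)) * (2 * (K0 + 1)) < (2 * q) * (K + 1) := by linarith
    have h3 := lt_of_mul_lt_mul_left h2 (by positivity)
    have : (0:ℝ) ≤ K0 := by positivity
    linarith
  have hKT : T ≤ 4 * q * K := by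
    have h1 : 4 * (q:ℝ) ≤ T := by
      refine le_trans ?_ hTY
      simp only [Y]
      have : (0:ℝ) ≤ q * K0 := by positivity
      nlinarith
    nlinarith
  obtain ⟨k, t, h1, h2, h3, h4⟩ := hmain K (by exact_mod_cast hKK)
  refine ⟨k, t, ?_, h2, h3, ?_⟩
  · have h5 : C1⁻¹ ^ (E:ℝ)⁻¹ * X ^ (E:ℝ)⁻¹ = T := by
      rw [hT, ← Real.mul_rpow (by positivity) hX0.le]; congr 1; field_simp
    rw [div_mul_eq_mul_div, h5, div_le_iff₀ (by positivity)]
    nlinarith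
  · intro j hF
    haveI hF' : Fact (Irreducible (pp a (tt ℓ a (t j)))) := hF
    have h6 : |(NumberField.discr (AdjoinRoot (pp a (tt ℓ a (t j)))) : ℝ)| ≤ C1 * (2 * q * K) ^ E := h4 j
    refine le_trans h6 ?_
    calc C1 * (2 * q * K) ^ E ≤ C1 * T ^ E := by
          have : 2 * (q:ℝ) * K ≤ T := by linarith
          gcongr
      _ = X := by rw [hTE]; field_simp
end
end

/-- **Theorem 6.3.**  Put `μ = 1/(2ℓ(n−1))`.  There exist an admissible pair
`(N, T₀)` and constants `c > 0`, `X₁ > 0` such that for every real `X > X₁` there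
are at least `c·X^μ` suitable integers `τ` giving rise to pairwise non-isomorphic
fields `K_{a(τ)}` of discriminants of absolute value at most `X`. -/
theorem suitable_integers_count (n ℓ : ℕ) (hn : 3 ≤ n) (hℓ : 1 ≤ ℓ)
    (a : Fin (n - 1) → ℤ) (hinj : Function.Injective a) (hne : ∀ i, a i ≠ 0)
    (hsep : (mainPoly n ℓ a).Separable)
    (hGal : Nonempty ((mainPoly n ℓ a).Gal ≃* Equiv.Perm (Fin n)))
    (hsep0 : (mainPolyZero n ℓ a).Separable) :
    ∃ N T₀ : ℕ, Admissible n ℓ a N T₀ ∧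
      ∃ c X₁ : ℝ, 0 < c ∧ 0 < X₁ ∧
        ∀ X : ℝ, X₁ < X →
          ∃ (m : ℕ) (τ : Fin m → ℤ),
            c * X ^ ((1 : ℝ) / (2 * (ℓ : ℝ) * ((n : ℝ) - 1))) ≤ (m : ℝ) ∧
            (∀ j, Suitable n ℓ a N T₀ (τ j)) ∧
            (∀ j k : Fin m, j ≠ k →
              IsEmpty (AdjoinRoot (specPolyQ n ℓ a (τ j)) ≃+*
                AdjoinRoot (specPolyQ n ℓ a (τ k)))) ∧
            (∀ j, ∀ [Fact (Irreducible (specPolyQ n ℓ a (τ j)))],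
              |(NumberField.discr (AdjoinRoot (specPolyQ n ℓ a (τ j))) : ℝ)| ≤ X) := by
  obtain ⟨m, rfl⟩ : ∃ m, n = m + 1 := ⟨n - 1, by omega⟩
  exact main_m (m := m) (a := a) (by omega) hℓ hinj hne hGal hsep0
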